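/- arXiv:1606.01586 — 5 statements merged into one kernel-verified Lean document; each statement's English description precedes it below -/
import Mathlib

section
/- Let x = (x_1,…,x_n) be a tree degree sequence, let a ≤ b be reals, let φ : {1,…,n} → [a,b], and for a tree T on {1,…,n} let F(T) = Σ_{{j,k}∈E(T)} φ(j)φ(k). Let F̄(x) be the average of F(T) over all trees T with degree sequence x, let ‖φ‖_m = min_{c∈ℝ} Σ_{j=1}^n |φ(j) − c|, and let L_φ = (b−a)³ · min{ (b−a)n, ‖φ‖_m (ln n + 2) }. Then for each ξ ∈ {−1, 1}, (1/|T_x|)·Σ_{T∈T_x} e^{ξ F(T)} = exp( ξ F̄(x) + K ) for some real constant K with 0 ≤ K ≤ L_φ/8, where T_x is the set of trees on {1,…,n} with degree sequence x. -/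
attribute [local instance] Classical.propDecidable

open Finset

namespace DegreeTrees

variable {V : Type*}

/-- Add the vertex `l` to a graph on the other vertices as a pendant neighbour of `k`. -/
def attachLeaf (l : V) (H : SimpleGraph {v // v ≠ l}) (k : {v // v ≠ l}) : SimpleGraph V where
  Adj u v := (∃ (hu : u ≠ l) (hv : v ≠ l), H.Adj ⟨u, hu⟩ ⟨v, hv⟩) ∨
    (u = l ∧ v = k) ∨ (u = k ∧ v = l)
  symm := ⟨by
    rintro u v (⟨hu, hv, h⟩ | ⟨h, h'⟩ | ⟨h, h'⟩)
    · exact Or.inl ⟨hv, hu, h.symm⟩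
    · exact Or.inr (Or.inr ⟨h', h⟩)
    · exact Or.inr (Or.inl ⟨h', h⟩)⟩
  loopless := ⟨by
    rintro u (⟨hu, hv, h⟩ | ⟨h, h'⟩ | ⟨h, h'⟩)
    · exact h.ne rfl
    · exact k.2 (h'.symm.trans h)
    · exact k.2 (h.symm.trans h')⟩

section attachLeaf

variable {l : V} {H : SimpleGraph {v // v ≠ l}} {k : {v // v ≠ l}}

@[simp] lemma attachLeaf_adj_leaf {v : V} : (attachLeaf l H k).Adj l v ↔ v = k := by
  have := k.2
  simp only [attachLeaf]
  grind

@[simp] lemma attachLeaf_adj_coe {u v : {v // v ≠ l}} :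
    (attachLeaf l H k).Adj u v ↔ H.Adj u v := by
  have := u.2
  have := v.2
  simp only [attachLeaf]
  grind

@[simp] lemma attachLeaf_adj_coe_leaf {u : {v // v ≠ l}} :
    (attachLeaf l H k).Adj u l ↔ u = k := by
  rw [SimpleGraph.adj_comm, attachLeaf_adj_leaf, Subtype.ext_iff]

lemma attachLeaf_inj {H' : SimpleGraph {v // v ≠ l}} {k' : {v // v ≠ l}}
    (h : attachLeaf l H k = attachLeaf l H' k') : H = H' ∧ k = k' := by
  constructor
  · ext u v
    rw [← attachLeaf_adj_coe (k := k), h, attachLeaf_adj_coe]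
  · have hk : (attachLeaf l H k).Adj l k := attachLeaf_adj_leaf.2 rfl
    rw [h, attachLeaf_adj_leaf] at hk
    exact Subtype.ext hk

end attachLeaf

/-- Degrees of the other vertices after deleting a leaf `l` with neighbour `k`. -/
noncomputable def leafDeleted (x : V → ℕ) (l : V) (k : {v // v ≠ l}) : {v // v ≠ l} → ℕ :=
  fun j => x j - if j = k then 1 else 0

lemma leafDeleted_add (x : V → ℕ) (hx : ∀ j, 1 ≤ x j) (l : V) (k j : {v // v ≠ l}) :
    leafDeleted x l k j + (if j = k then 1 else 0) = x j := by
  have := hx j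
  simp only [leafDeleted]
  grind

variable [Fintype V]

/-- Half the sum of `φ u * φ v` over ordered adjacent pairs, that is, the sum over edges. -/
noncomputable def edgeSum (φ : V → ℝ) (T : SimpleGraph V) : ℝ :=
  (∑ u, ∑ v, if T.Adj u v then φ u * φ v else 0) / 2

/-- Connected graphs with degree sequence `x`. -/
noncomputable def connectedWithDegrees (x : V → ℕ) : Finset (SimpleGraph V) :=
  univ.filter fun T => T.Connected ∧ ∀ j, T.degree j = x j

lemma mem_connectedWithDegrees {x : V → ℕ} {T : SimpleGraph V} :
    T ∈ connectedWithDegrees x ↔ T.Connected ∧ ∀ j, T.degree j = x j := by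
  simp [connectedWithDegrees]

lemma degree_eq_sum (T : SimpleGraph V) (u : V) :
    T.degree u = ∑ v, if T.Adj u v then 1 else 0 := by
  rw [← SimpleGraph.card_neighborFinset_eq_degree, SimpleGraph.neighborFinset_eq_filter,
    card_filter]

lemma sum_edgeFinset_eq_edgeSum (φ : V → ℝ) (T : SimpleGraph V) :
    ∑ e ∈ T.edgeFinset, Sym2.lift ⟨fun j k => φ j * φ k, fun j k => by ring⟩ e =
      edgeSum φ T := by
  have hpairs : (∑ u, ∑ v, if T.Adj u v then φ u * φ v else 0) =
      ∑ p ∈ univ.filter (fun p : V × V => T.Adj p.1 p.2), φ p.1 * φ p.2 := by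
    rw [sum_filter, Fintype.sum_prod_type]
  rw [edgeSum, hpairs, eq_div_iff two_ne_zero, sum_mul,
    ← sum_fiberwise_of_maps_to (g := fun p : V × V => s(p.1, p.2)) (t := T.edgeFinset)
      (fun p hp => by simpa using hp)]
  refine sum_congr rfl fun e he => ?_
  induction e with
  | _ v w =>
    have hvw : T.Adj v w := by simpa using he
    have hfiber : (univ.filter (fun p : V × V => T.Adj p.1 p.2)).filter
        (fun p => s(p.1, p.2) = s(v, w)) = {(v, w), (w, v)} := by
      ext ⟨p, q⟩
      simp only [mem_filter, mem_univ, true_and, Sym2.eq_iff, mem_insert, mem_singleton,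
        Prod.mk.injEq]
      constructor
      · exact fun h => h.2
      · rintro (⟨rfl, rfl⟩ | ⟨rfl, rfl⟩)
        · exact ⟨hvw, Or.inl ⟨rfl, rfl⟩⟩
        · exact ⟨hvw.symm, Or.inr ⟨rfl, rfl⟩⟩
    rw [hfiber, sum_pair (by simp [hvw.ne])]
    simp only [Sym2.lift_mk]
    ring

lemma isTree_iff_connected_of_degree {x : V → ℕ} (hsum : (∑ j, x j) + 2 = 2 * Fintype.card V)
    {T : SimpleGraph V} (hT : ∀ j, T.degree j = x j) : T.IsTree ↔ T.Connected := by
  rw [SimpleGraph.isTree_iff_connected_and_card, and_iff_left]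
  have h := T.sum_degrees_eq_twice_card_edges
  simp only [hT] at h
  rw [Nat.card_eq_fintype_card, Nat.card_eq_fintype_card, ← SimpleGraph.edgeFinset_card]
  lia

section attachLeaf

variable {l : V} {H : SimpleGraph {v // v ≠ l}} {k : {v // v ≠ l}}

lemma degree_attachLeaf_leaf : (attachLeaf l H k).degree l = 1 := by
  simp [degree_eq_sum]

lemma degree_attachLeaf_coe (u : {v // v ≠ l}) :
    (attachLeaf l H k).degree u = H.degree u + if u = k then 1 else 0 := by
  rw [degree_eq_sum, degree_eq_sum, Fintype.sum_eq_add_sum_subtype_ne _ l]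
  simp [add_comm]

lemma edgeSum_attachLeaf (φ : V → ℝ) :
    edgeSum φ (attachLeaf l H k) = φ l * φ k + edgeSum (fun v : {v // v ≠ l} => φ v) H := by
  simp only [edgeSum]
  rw [Fintype.sum_eq_add_sum_subtype_ne _ l]
  simp only [Fintype.sum_eq_add_sum_subtype_ne (fun v => ite _ _ (0 : ℝ)) l]
  simp [sum_add_distrib, Subtype.coe_inj]
  ring

lemma attachLeaf_connected_iff : (attachLeaf l H k).Connected ↔ H.Connected := by
  constructor
  · intro h
    have h' := h.induce_compl_singleton_of_degree_eq_one (degree_attachLeaf_leaf)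
    let e : (attachLeaf l H k).induce {l}ᶜ ≃g H :=
      { toEquiv := Equiv.subtypeEquivRight (by simp)
        map_rel_iff' := by
          rintro ⟨u, hu⟩ ⟨v, hv⟩
          exact (attachLeaf_adj_coe (u := ⟨u, hu⟩) (v := ⟨v, hv⟩)).symm }
    exact e.connected_iff.1 h'
  · intro h
    have hk : ∀ v, (attachLeaf l H k).Reachable k v := by
      intro v
      by_cases hv : v = l
      · subst hv
        exact (attachLeaf_adj_coe_leaf.2 rfl).reachable
      · let f : H →g attachLeaf l H k := ⟨Subtype.val, fun h => attachLeaf_adj_coe.2 h⟩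
        exact (h.preconnected k ⟨v, hv⟩).map f
    exact { preconnected := fun u v => (hk u).symm.trans (hk v), nonempty := ⟨l⟩ }

lemma exists_eq_attachLeaf {T : SimpleGraph V} (hT : T.degree l = 1) :
    ∃ H k, T = attachLeaf l H k := by
  obtain ⟨k, hk, huniq⟩ := SimpleGraph.degree_eq_one_iff_existsUnique_adj.1 hT
  refine ⟨T.comap Subtype.val, ⟨k, hk.ne'⟩, ?_⟩
  ext u v
  simp only [attachLeaf, SimpleGraph.comap_adj]
  have := T.adj_comm u v
  have := huniq u
  have := huniq v
  have := T.irrefl (v := l)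
  grind

end attachLeaf

lemma attachLeaf_mem_connectedWithDegrees {x : V → ℕ} (hx : ∀ j, 1 ≤ x j) {l : V} (hl : x l = 1)
    {H : SimpleGraph {v // v ≠ l}} {k : {v // v ≠ l}} :
    attachLeaf l H k ∈ connectedWithDegrees x ↔
      H ∈ connectedWithDegrees (leafDeleted x l k) := by
  rw [mem_connectedWithDegrees, mem_connectedWithDegrees, attachLeaf_connected_iff]
  refine and_congr_right fun _ => ⟨fun h j => ?_, fun h j => ?_⟩
  · have := h j
    rw [degree_attachLeaf_coe] at this
    simp only [leafDeleted]
    lia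
  · by_cases hj : j = l
    · rw [hj, degree_attachLeaf_leaf, hl]
    · have := h ⟨j, hj⟩
      have h1 := hx j
      rw [degree_attachLeaf_coe ⟨j, hj⟩, this]
      simp only [leafDeleted]
      grind

lemma sum_connectedWithDegrees_eq {x : V → ℕ} (hx : ∀ j, 1 ≤ x j) {l : V} (hl : x l = 1)
    (G : SimpleGraph V → ℝ) :
    ∑ T ∈ connectedWithDegrees x, G T =
      ∑ k, ∑ H ∈ connectedWithDegrees (leafDeleted x l k), G (attachLeaf l H k) := by
  rw [sum_sigma']
  symm
  refine sum_bij (fun p _ => attachLeaf l p.2 p.1) ?_ ?_ ?_ (fun _ _ => rfl)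
  · rintro ⟨k, H⟩ hp
    exact (attachLeaf_mem_connectedWithDegrees hx hl).2 (mem_sigma.1 hp).2
  · rintro ⟨k, H⟩ _ ⟨k', H'⟩ _ h
    obtain ⟨rfl, rfl⟩ := attachLeaf_inj h
    rfl
  · intro T hT
    obtain ⟨H, k, rfl⟩ := exists_eq_attachLeaf (l := l)
      ((mem_connectedWithDegrees.1 hT).2 l |>.trans hl)
    exact ⟨⟨k, H⟩, by simpa [attachLeaf_mem_connectedWithDegrees hx hl] using hT, rfl⟩


/-- Positive integers summing to `2 * card V - 2`. -/
def IsTreeSequence (x : V → ℕ) : Prop :=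
  (∀ j, 1 ≤ x j) ∧ (∑ j, x j) + 2 = 2 * Fintype.card V

lemma IsTreeSequence.exists_leaf {x : V → ℕ} (hx : IsTreeSequence x) : ∃ l, x l = 1 := by
  by_contra! h
  have h2 : ∀ j ∈ (univ : Finset V), 2 ≤ x j := fun j _ => by
    have := hx.1 j
    have := h j
    lia
  have := card_nsmul_le_sum univ x 2 h2
  have := hx.2
  simp only [card_univ, smul_eq_mul] at *
  lia

lemma IsTreeSequence.two_le_card {x : V → ℕ} (hx : IsTreeSequence x) : 2 ≤ Fintype.card V := by
  have := card_nsmul_le_sum univ x 1 fun j _ => hx.1 j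
  have := hx.2
  simp only [card_univ, smul_eq_mul] at *
  lia

lemma card_ne_add_one (l : V) : Fintype.card {v // v ≠ l} + 1 = Fintype.card V := by
  have := Fintype.card_pos_iff.2 ⟨l⟩
  simp only [Fintype.card_subtype_compl, Fintype.card_subtype_eq, ne_eq]
  lia

lemma IsTreeSequence.leafDeleted {x : V → ℕ} (hx : IsTreeSequence x) {l : V} (hl : x l = 1)
    {k : {v // v ≠ l}} (hk : 2 ≤ x k) : IsTreeSequence (leafDeleted x l k) := by
  refine ⟨fun j => ?_, ?_⟩
  · have := hx.1 j
    simp only [DegreeTrees.leafDeleted]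
    grind
  · have h := hx.2
    rw [Fintype.sum_eq_add_sum_subtype_ne _ l] at h
    simp only [← leafDeleted_add x hx.1 l k, sum_add_distrib, sum_ite_eq', mem_univ, if_true] at h
    have := card_ne_add_one l
    lia

lemma connectedWithDegrees_eq_empty {x : V → ℕ} {k : V} (hk : x k = 0)
    (hV : 2 ≤ Fintype.card V) : connectedWithDegrees x = ∅ := by
  have : Nontrivial V := Fintype.one_lt_card_iff_nontrivial.1 hV
  refine eq_empty_of_forall_notMem fun T hT => ?_
  obtain ⟨hc, hd⟩ := mem_connectedWithDegrees.1 hT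
  have := hc.preconnected.degree_pos_of_nontrivial k
  rw [hd, hk] at this
  lia

lemma connectedWithDegrees_leafDeleted_eq_empty {x : V → ℕ} {l : V} {k : {v // v ≠ l}}
    (hk : x k = 1) (hV : 3 ≤ Fintype.card V) :
    connectedWithDegrees (leafDeleted x l k) = ∅ := by
  have := card_ne_add_one l
  exact connectedWithDegrees_eq_empty (k := k) (by simp [leafDeleted, hk]) (by lia)

/-- The excess degrees over the vertices other than a leaf sum to `card V - 2`. -/
lemma IsTreeSequence.sum_excess {x : V → ℕ} (hx : IsTreeSequence x) {l : V} (hl : x l = 1) :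
    ∑ k : {v // v ≠ l}, ((x k : ℝ) - 1) = Fintype.card V - 2 := by
  have h := hx.2
  rw [Fintype.sum_eq_add_sum_subtype_ne _ l, hl] at h
  have h' := card_ne_add_one l
  rw [← h'] at h ⊢
  have h2 : (1 + ∑ k : {v // v ≠ l}, (x k : ℝ)) + 2 =
      2 * (Fintype.card {v // v ≠ l} + 1) := by exact_mod_cast h
  rw [sum_sub_distrib, sum_const, card_univ, nsmul_eq_mul]
  push_cast
  linarith

lemma eq_top_of_card_eq_two (hV : Fintype.card V = 2) {T : SimpleGraph V} (hT : T.Connected) :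
    T = ⊤ := by
  have : Nontrivial V := Fintype.one_lt_card_iff_nontrivial.1 (by lia)
  ext u v
  refine ⟨fun h => h.ne, fun h => ?_⟩
  have hne : u ≠ v := h
  obtain ⟨w, hw⟩ := hT.preconnected.exists_adj_of_nontrivial u
  have huniv : ({u, v} : Finset V) = univ := by
    rw [← card_eq_iff_eq_univ, hV, card_pair hne]
  have hmem : w ∈ ({u, v} : Finset V) := huniv ▸ mem_univ w
  rcases mem_insert.1 hmem with rfl | h'
  · exact absurd rfl hw.ne
  · rwa [mem_singleton.1 h'] at hw

lemma IsTreeSequence.eq_one_of_card_eq_two {x : V → ℕ} (hx : IsTreeSequence x)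
    (hV : Fintype.card V = 2) (j : V) : x j = 1 := by
  have hs : ∑ _j : V, 1 = ∑ j, x j := by
    have := hx.2
    simp only [sum_const, card_univ, smul_eq_mul]
    lia
  exact ((sum_eq_sum_iff_of_le fun j _ => hx.1 j).1 hs j (mem_univ j)).symm

lemma connectedWithDegrees_of_card_eq_two {x : V → ℕ} (hx : IsTreeSequence x)
    (hV : Fintype.card V = 2) : connectedWithDegrees x = {⊤} := by
  have hne : Nonempty V := Fintype.card_pos_iff.1 (by lia)
  ext T
  rw [mem_connectedWithDegrees, mem_singleton]
  refine ⟨fun h => eq_top_of_card_eq_two hV h.1, fun hT => ?_⟩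
  refine ⟨hT ▸ SimpleGraph.connected_top, fun j => ?_⟩
  rw [hx.eq_one_of_card_eq_two hV, SimpleGraph.degree_eq_one_iff_existsUnique_adj]
  have hcard : #(univ.erase j) = 1 := by
    rw [card_erase_of_mem (mem_univ j), card_univ, hV]
  obtain ⟨w, hw⟩ := card_eq_one.1 hcard
  refine ⟨w, ?_, fun v hv => ?_⟩
  · simp only [hT, SimpleGraph.top_adj]
    exact (ne_of_mem_erase (hw ▸ mem_singleton_self w)).symm
  · exact mem_singleton.1 (hw ▸ mem_erase.2 ⟨SimpleGraph.Adj.ne' hv, mem_univ v⟩)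

lemma prod_factorial_leafDeleted {x : V → ℕ} {l : V} (hl : x l = 1) {k : {v // v ≠ l}}
    (hk : 2 ≤ x k) : ∏ j, ((x j - 1).factorial : ℝ) =
      ((x k : ℝ) - 1) * ∏ j, ((leafDeleted x l k j - 1).factorial : ℝ) := by
  rw [Fintype.prod_eq_mul_prod_subtype_ne _ l, hl,
    ← mul_prod_erase univ (fun j : {v // v ≠ l} => ((x j - 1).factorial : ℝ)) (mem_univ k),
    ← mul_prod_erase univ _ (mem_univ k)]
  have herase : ∏ j ∈ univ.erase k, ((leafDeleted x l k j - 1).factorial : ℝ) =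
      ∏ j ∈ univ.erase k, ((x j - 1).factorial : ℝ) := by
    refine prod_congr rfl fun j hj => ?_
    simp [leafDeleted, ne_of_mem_erase hj]
  rw [herase]
  obtain ⟨d, hd⟩ := Nat.exists_eq_add_of_le' hk
  simp only [leafDeleted, if_true, hd]
  simp [Nat.factorial_succ]
  ring

lemma card_connectedWithDegrees_mul (m : ℕ) : ∀ {V : Type*} [Fintype V] {x : V → ℕ},
    IsTreeSequence x → Fintype.card V = m + 2 →
    (#(connectedWithDegrees x) : ℝ) * ∏ j, ((x j - 1).factorial : ℝ) = (m.factorial : ℝ) := by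
  induction m with
  | zero =>
    intro V _ x hx hV
    rw [connectedWithDegrees_of_card_eq_two hx hV]
    simp [hx.eq_one_of_card_eq_two hV]
  | succ m ih =>
    intro V _ x hx hV
    obtain ⟨l, hl⟩ := hx.exists_leaf
    have hsum := sum_connectedWithDegrees_eq hx.1 hl fun _ => 1
    simp only [sum_const, nsmul_eq_mul, mul_one] at hsum
    have hterm : ∀ k : {v // v ≠ l}, (#(connectedWithDegrees (leafDeleted x l k)) : ℝ) *
        ∏ j, ((x j - 1).factorial : ℝ) = ((x k : ℝ) - 1) * (m.factorial : ℝ) := by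
      intro k
      rcases (hx.1 k).eq_or_lt with hk | hk
      · rw [connectedWithDegrees_leafDeleted_eq_empty hk.symm (by lia), ← hk]
        simp
      · have hcard := card_ne_add_one l
        rw [← ih (hx.leafDeleted hl hk) (by lia), prod_factorial_leafDeleted hl hk]
        ring
    rw [hsum, sum_mul, sum_congr rfl fun k _ => hterm k, ← sum_mul, hx.sum_excess hl, hV,
      Nat.factorial_succ]
    push_cast
    ring

lemma card_connectedWithDegrees_pos {x : V → ℕ} (hx : IsTreeSequence x) :
    0 < (#(connectedWithDegrees x) : ℝ) := by
  obtain ⟨m, hm⟩ := Nat.exists_eq_add_of_le' hx.two_le_card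
  have h := card_connectedWithDegrees_mul m hx hm
  have hpos : 0 < (m.factorial : ℝ) := by exact_mod_cast m.factorial_pos
  rw [← h] at hpos
  exact pos_of_mul_pos_left hpos (prod_nonneg fun j _ => Nat.cast_nonneg _)

/-- The neighbour of a given leaf is `k` with probability `(x k - 1) / (card V - 2)`. -/
lemma card_connectedWithDegrees_leafDeleted {x : V → ℕ} (hx : IsTreeSequence x) {l : V}
    (hl : x l = 1) (hV : 3 ≤ Fintype.card V) (k : {v // v ≠ l}) :
    (#(connectedWithDegrees (leafDeleted x l k)) : ℝ) =
      ((x k : ℝ) - 1) / (Fintype.card V - 2) * #(connectedWithDegrees x) := by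
  obtain ⟨m, hm⟩ := Nat.exists_eq_add_of_le' hV
  have hcard : (Fintype.card V : ℝ) - 2 = m + 1 := by rw [hm]; push_cast; ring
  rcases (hx.1 k).eq_or_lt with hk | hk
  · rw [connectedWithDegrees_leafDeleted_eq_empty hk.symm hV, ← hk]
    simp
  · have hl' := card_ne_add_one l
    have h := card_connectedWithDegrees_mul (m + 1) hx (by lia)
    have h' := card_connectedWithDegrees_mul m (hx.leafDeleted hl hk) (by lia)
    rw [prod_factorial_leafDeleted hl hk, Nat.factorial_succ] at h
    push_cast at h
    rw [← h'] at h
    have hprod : (∏ j, ((leafDeleted x l k j - 1).factorial : ℝ)) ≠ 0 :=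
      prod_ne_zero_iff.2 fun j _ => Nat.cast_ne_zero.2 (Nat.factorial_ne_zero _)
    rw [hcard, div_mul_eq_mul_div, eq_div_iff (by positivity)]
    refine mul_right_cancel₀ hprod ?_
    linear_combination -h

/-- The mean of `edgeSum φ` over trees with degree sequence `x`, when `3 ≤ card V`. -/
noncomputable def meanEdgeSum (φ : V → ℝ) (x : V → ℕ) : ℝ :=
  (∑ j, ((x j : ℝ) - 1) * (φ j * (∑ i, φ i - φ j))) / (Fintype.card V - 2)

/-- Up to a constant, the conditional mean of `edgeSum φ` given that the leaf `l` is
adjacent to `k`. -/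
noncomputable def leafIncrement (φ : V → ℝ) (l : V) (k : {v // v ≠ l}) : ℝ :=
  φ l * φ k - φ k * (∑ i : {v // v ≠ l}, φ i - φ k) / (Fintype.card V - 3)

lemma meanEdgeSum_leafDeleted (φ : V → ℝ) {x : V → ℕ} (hx : IsTreeSequence x) {l : V}
    (k : {v // v ≠ l}) :
    φ l * φ k + meanEdgeSum (fun v : {v // v ≠ l} => φ v) (leafDeleted x l k) =
      (∑ j : {v // v ≠ l}, ((x j : ℝ) - 1) * (φ j * (∑ i : {v // v ≠ l}, φ i - φ j))) /
        (Fintype.card V - 3) + leafIncrement φ l k := by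
  have hcard : (Fintype.card V : ℝ) = Fintype.card {v // v ≠ l} + 1 := by
    exact_mod_cast (card_ne_add_one l).symm
  have hdel : ∀ j : {v // v ≠ l}, (leafDeleted x l k j : ℝ) = x j - if j = k then 1 else 0 := by
    intro j
    rw [← leafDeleted_add x hx.1 l k j]
    push_cast
    ring
  have hterm : ∀ j : {v // v ≠ l}, ((leafDeleted x l k j : ℝ) - 1) *
      (φ j * (∑ i : {v // v ≠ l}, φ i - φ j)) =
      ((x j : ℝ) - 1) * (φ j * (∑ i : {v // v ≠ l}, φ i - φ j)) -
        if j = k then φ j * (∑ i : {v // v ≠ l}, φ i - φ j) else 0 := by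
    intro j
    rw [hdel]
    split_ifs <;> ring
  simp only [meanEdgeSum, leafIncrement, hterm, sum_sub_distrib, sum_ite_eq', mem_univ, if_true,
    hcard]
  ring

lemma sum_mul_meanEdgeSum_leafDeleted (φ : V → ℝ) {x : V → ℕ} (hx : IsTreeSequence x) {l : V}
    (hl : x l = 1) (hV : 4 ≤ Fintype.card V) :
    ∑ k : {v // v ≠ l}, ((x k : ℝ) - 1) / (Fintype.card V - 2) *
      (φ l * φ k + meanEdgeSum (fun v : {v // v ≠ l} => φ v) (leafDeleted x l k)) =
      meanEdgeSum φ x := by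
  have hV' : (4 : ℝ) ≤ Fintype.card V := by exact_mod_cast hV
  have hsum := hx.sum_excess hl
  simp only [meanEdgeSum_leafDeleted φ hx]
  rw [meanEdgeSum, Fintype.sum_eq_add_sum_subtype_ne _ l, Fintype.sum_eq_add_sum_subtype_ne φ l, hl]
  simp only [leafIncrement]
  generalize (Fintype.card V : ℝ) = m at *
  generalize (∑ i : {v // v ≠ l}, φ i) = S
  have h2 : m - 2 ≠ 0 := by linarith
  have h3 : m - 3 ≠ 0 := by linarith
  set Q := ∑ j : {v // v ≠ l}, ((x j : ℝ) - 1) * (φ j * (S - φ j)) with hQ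
  have hleft : ∑ k : {v // v ≠ l}, ((x k : ℝ) - 1) / (m - 2) *
      (Q / (m - 3) + (φ l * φ k - φ k * (S - φ k) / (m - 3))) =
      (∑ k : {v // v ≠ l}, ((x k : ℝ) - 1)) / (m - 2) * (Q / (m - 3)) +
        φ l * (∑ k : {v // v ≠ l}, ((x k : ℝ) - 1) * φ k) / (m - 2) -
          Q / ((m - 2) * (m - 3)) := by
    have hterm : ∀ k : {v // v ≠ l}, ((x k : ℝ) - 1) / (m - 2) *
        (Q / (m - 3) + (φ l * φ k - φ k * (S - φ k) / (m - 3))) =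
        ((x k : ℝ) - 1) * (Q / (m - 3) / (m - 2)) + ((x k : ℝ) - 1) * φ k * (φ l / (m - 2)) -
          ((x k : ℝ) - 1) * (φ k * (S - φ k)) * (1 / ((m - 2) * (m - 3))) := by
      intro k
      field_simp
      ring
    simp only [hterm, sum_sub_distrib, sum_add_distrib, ← sum_mul, ← hQ]
    ring
  have hright : ∑ j : {v // v ≠ l}, ((x j : ℝ) - 1) * (φ j * (φ l + S - φ j)) =
      φ l * (∑ k : {v // v ≠ l}, ((x k : ℝ) - 1) * φ k) + Q := by
    rw [hQ, mul_sum, ← sum_add_distrib]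
    exact sum_congr rfl fun j _ => by ring
  rw [hleft, hright, hsum]
  push_cast
  field_simp
  ring

lemma abs_sub_le_of_mem_Icc {a b s t : ℝ} (hs : s ∈ Set.Icc a b) (ht : t ∈ Set.Icc a b) :
    |s - t| ≤ b - a :=
  abs_sub_le_iff.2 ⟨by linarith [hs.2, ht.1], by linarith [hs.1, ht.2]⟩

/-- Two increments differ by `φ k - φ k'` times the deviation of `φ l` from the average of `φ` over
the remaining vertices. -/
lemma leafIncrement_sub_abs_le {φ : V → ℝ} {a b : ℝ} (hφ : ∀ j, φ j ∈ Set.Icc a b) {l : V}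
    (hV : 4 ≤ Fintype.card V) (c : ℝ) (k k' : {v // v ≠ l}) :
    |leafIncrement φ l k - leafIncrement φ l k'| ≤ (b - a) *
      min (b - a) (|φ l - c| + (∑ j, |φ j - c|) / (Fintype.card V - 3)) := by
  have hV' : (4 : ℝ) ≤ Fintype.card V := by exact_mod_cast hV
  have hab : a ≤ b := (hφ l).1.trans (hφ l).2
  have hm : (0 : ℝ) < Fintype.card V - 3 := by linarith
  have hnonneg : 0 ≤ |φ l - c| + (∑ j, |φ j - c|) / (Fintype.card V - 3) := by positivity
  rcases eq_or_ne k k' with rfl | hne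
  · simp only [sub_self, abs_zero]
    exact mul_nonneg (by linarith) (le_min (by linarith) hnonneg)
  set R : Finset {v // v ≠ l} := (univ.erase k).erase k' with hR
  have hRcard : (#R : ℝ) = Fintype.card V - 3 := by
    have h1 := card_ne_add_one l
    have h2 : #R + 3 = Fintype.card V := by
      rw [hR, card_erase_of_mem (by simp [hne.symm]), card_erase_of_mem (mem_univ _), card_univ]
      lia
    rw [← h2]
    push_cast
    ring
  have hRsum : ∀ f : V → ℝ, ∑ i : {v // v ≠ l}, f i = f k + (f k' + ∑ i ∈ R, f i) := by
    intro f
    rw [hR, add_sum_erase (univ.erase k) (fun i => f i) (by simp [hne.symm]),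
      add_sum_erase univ (fun i : {v // v ≠ l} => f i) (mem_univ k)]
  have hdiff : leafIncrement φ l k - leafIncrement φ l k' =
      (φ k - φ k') * (φ l - (∑ i ∈ R, φ i) / (Fintype.card V - 3)) := by
    simp only [leafIncrement, hRsum φ]
    field_simp
    ring
  have hkk' : |φ k - φ k'| ≤ b - a := abs_sub_le_of_mem_Icc (hφ k) (hφ k')
  have havg : (∑ i ∈ R, φ i) / (Fintype.card V - 3) ∈ Set.Icc a b := by
    rw [← hRcard] at hm ⊢
    constructor
    · rw [le_div_iff₀ hm, mul_comm, ← nsmul_eq_mul]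
      exact card_nsmul_le_sum _ _ _ fun i _ => (hφ i).1
    · rw [div_le_iff₀ hm, mul_comm, ← nsmul_eq_mul]
      exact sum_le_card_nsmul _ _ _ fun i _ => (hφ i).2
  have hdev : |(∑ i ∈ R, φ i) / (Fintype.card V - 3) - c| ≤
      (∑ j, |φ j - c|) / (Fintype.card V - 3) := by
    have : (∑ i ∈ R, φ i) / (Fintype.card V - 3) - c =
        (∑ i ∈ R, (φ i - c)) / (Fintype.card V - 3) := by
      rw [sum_sub_distrib, sum_const, nsmul_eq_mul, hRcard]
      field_simp
    rw [this, abs_div, abs_of_pos hm]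
    gcongr
    refine (abs_sum_le_sum_abs _ _).trans ?_
    rw [Fintype.sum_eq_add_sum_subtype_ne _ l, hRsum fun i => |φ i - c|]
    have := abs_nonneg (φ l - c)
    have := abs_nonneg (φ k - c)
    have := abs_nonneg (φ k' - c)
    linarith
  rw [hdiff, abs_mul]
  refine mul_le_mul hkk' (le_min (abs_sub_le_of_mem_Icc (hφ l) havg) ?_) (abs_nonneg _)
    (by linarith)
  refine (abs_sub_le _ c _).trans ?_
  rw [abs_sub_comm c]
  linarith

lemma edgeSum_top (φ : V → ℝ) :
    edgeSum φ (⊤ : SimpleGraph V) = (∑ j, φ j * (∑ i, φ i - φ j)) / 2 := by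
  rw [edgeSum]
  congr 1
  refine sum_congr rfl fun u _ => ?_
  rw [mul_sub, mul_sum, ← add_sum_erase univ (fun i => φ u * φ i) (mem_univ u), add_sub_cancel_left,
    ← add_sum_erase univ _ (mem_univ u)]
  simp only [SimpleGraph.top_adj, ne_eq, not_true, if_false, zero_add]
  exact sum_congr rfl fun i hi => by simp [(ne_of_mem_erase hi).symm]

lemma edgeSum_eq_meanEdgeSum_of_card_eq_three (φ : V → ℝ) {x : V → ℕ} (hx : IsTreeSequence x)
    (hV : Fintype.card V = 3) {T : SimpleGraph V} (hT : T ∈ connectedWithDegrees x) :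
    edgeSum φ T = meanEdgeSum φ x := by
  obtain ⟨l, hl⟩ := hx.exists_leaf
  obtain ⟨H, k, rfl⟩ := exists_eq_attachLeaf (l := l)
    (((mem_connectedWithDegrees.1 hT).2 l).trans hl)
  rw [attachLeaf_mem_connectedWithDegrees hx.1 hl] at hT
  have hl' := card_ne_add_one l
  have hk : x k ≠ 1 := fun hk => by
    simp [connectedWithDegrees_leafDeleted_eq_empty hk hV.ge] at hT
  have hH := eq_top_of_card_eq_two (by lia) (mem_connectedWithDegrees.1 hT).1
  obtain ⟨k', hk'⟩ : ∃ k', k' ≠ k := by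
    have : Nontrivial {v // v ≠ l} := Fintype.one_lt_card_iff_nontrivial.1 (by lia)
    exact exists_ne k
  have hsum : ∀ f : {v // v ≠ l} → ℝ, ∑ j, f j = f k + f k' := by
    intro f
    rw [← sum_pair hk'.symm]
    congr 1
    symm
    rw [← card_eq_iff_eq_univ, card_pair hk'.symm]
    lia
  have hex := hx.sum_excess hl
  rw [hsum, hV] at hex
  have hxk : (2 : ℝ) ≤ x k := by
    have := hx.1 k
    exact_mod_cast (show 2 ≤ x k by lia)
  have hxk' : (1 : ℝ) ≤ x k' := by exact_mod_cast hx.1 k'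
  push_cast at hex
  have e1 : (x k : ℝ) = 2 := by linarith
  have e2 : (x k' : ℝ) = 1 := by linarith
  rw [edgeSum_attachLeaf, hH, edgeSum_top, meanEdgeSum, Fintype.sum_eq_add_sum_subtype_ne _ l,
    Fintype.sum_eq_add_sum_subtype_ne φ l, hl, hV]
  simp only [hsum, e1, e2]
  push_cast
  ring


/-- Hoeffding's lemma for a finitely supported distribution. -/
lemma sum_mul_exp_le_of_abs_sub_le {ι : Type*} [Fintype ι] {p X : ι → ℝ} (hp : ∀ i, 0 ≤ p i)
    (hsum : ∑ i, p i = 1) {r : ℝ} (hr : ∀ i j, |X i - X j| ≤ r) :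
    ∑ i, p i * Real.exp (X i) ≤ Real.exp (∑ i, p i * X i + r ^ 2 / 8) := by
  have hne : Nonempty ι := by
    by_contra h
    rw [not_nonempty_iff] at h
    simp at hsum
  obtain ⟨i₀, hi₀⟩ := Finite.exists_min X
  let _ : MeasurableSpace ι := ⊤
  let P : PMF ι := PMF.ofFintype (fun i => ENNReal.ofReal (p i)) (by
    rw [← ENNReal.ofReal_sum_of_nonneg fun i _ => hp i, hsum, ENNReal.ofReal_one])
  have hintegral : ∀ f : ι → ℝ, ∫ i, f i ∂P.toMeasure = ∑ i, p i * f i := by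
    intro f
    rw [PMF.integral_eq_sum]
    refine sum_congr rfl fun i _ => ?_
    simp [P, hp i]
  have hrange : ∀ i, X i ∈ Set.Icc (X i₀) (X i₀ + r) := fun i =>
    ⟨hi₀ i, by linarith [(abs_le.1 (hr i i₀)).2]⟩
  have h := (ProbabilityTheory.hasSubgaussianMGF_of_mem_Icc (μ := P.toMeasure) (X := X)
    (measurable_from_top.aemeasurable) (Filter.Eventually.of_forall hrange)).mgf_le 1
  have hr0 : 0 ≤ r := (abs_nonneg _).trans (hr i₀ i₀)
  rw [ProbabilityTheory.mgf, hintegral, hintegral] at h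
  simp only [one_mul, Real.exp_sub, add_sub_cancel_left, mul_div_assoc', ← sum_div] at h
  rw [div_le_iff₀ (Real.exp_pos _), ← Real.exp_add] at h
  refine h.trans_eq ?_
  congr 1
  push_cast
  rw [Real.norm_of_nonneg hr0]
  ring

lemma sum_edgeSum_eq (m : ℕ) : ∀ {V : Type*} [Fintype V] (φ : V → ℝ) {x : V → ℕ},
    IsTreeSequence x → Fintype.card V = m + 3 →
    ∑ T ∈ connectedWithDegrees x, edgeSum φ T =
      #(connectedWithDegrees x) * meanEdgeSum φ x := by
  induction m with
  | zero =>
    intro V _ φ x hx hV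
    rw [sum_congr rfl fun T hT => edgeSum_eq_meanEdgeSum_of_card_eq_three φ hx hV hT, sum_const,
      nsmul_eq_mul]
  | succ m ih =>
    intro V _ φ x hx hV
    obtain ⟨l, hl⟩ := hx.exists_leaf
    have hl' := card_ne_add_one l
    rw [sum_connectedWithDegrees_eq hx.1 hl, ← sum_mul_meanEdgeSum_leafDeleted φ hx hl (by lia),
      mul_sum]
    refine sum_congr rfl fun k _ => ?_
    rw [← mul_assoc, mul_comm (#_ : ℝ),
      ← card_connectedWithDegrees_leafDeleted hx hl (by lia) k]
    simp only [edgeSum_attachLeaf, sum_add_distrib, sum_const, nsmul_eq_mul]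
    rcases (hx.1 k).eq_or_lt with hk | hk
    · simp [connectedWithDegrees_leafDeleted_eq_empty hk.symm (by lia : 3 ≤ Fintype.card V)]
    · rw [ih _ (hx.leafDeleted hl hk) (by lia)]
      ring

lemma sum_exp_edgeSum_le {a b c D ξ : ℝ} (hξ : ξ = -1 ∨ ξ = 1) (m : ℕ) :
    ∀ {V : Type*} [Fintype V] {φ : V → ℝ} {x : V → ℕ}, IsTreeSequence x →
      (∀ j, φ j ∈ Set.Icc a b) → (∑ j, |φ j - c|) ≤ D → Fintype.card V = m + 3 →
      ∑ T ∈ connectedWithDegrees x, Real.exp (ξ * edgeSum φ T) ≤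
        #(connectedWithDegrees x) * Real.exp (ξ * meanEdgeSum φ x +
          (b - a) ^ 3 * min ((b - a) * m) (∑ j, |φ j - c| + D * harmonic m) / 8) := by
  induction m with
  | zero =>
    intro V _ φ x hx hφ hD hV
    rw [sum_congr rfl fun T hT => by
      rw [edgeSum_eq_meanEdgeSum_of_card_eq_three φ hx hV hT], sum_const, nsmul_eq_mul]
    have hmin : min ((b - a) * (0 : ℕ)) (∑ j, |φ j - c| + D * harmonic 0) = 0 := by
      simp [sum_nonneg]
    rw [hmin]
    simp
  | succ m ih =>
    intro V _ φ x hx hφ hD hV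
    obtain ⟨l, hl⟩ := hx.exists_leaf
    have hl' := card_ne_add_one l
    have hab : 0 ≤ b - a := sub_nonneg.2 ((hφ l).1.trans (hφ l).2)
    have hcard : (Fintype.card V : ℝ) - 3 = m + 1 := by rw [hV]; push_cast; ring
    have hcard2 : (0 : ℝ) < Fintype.card V - 2 := by
      have : (0 : ℝ) ≤ m := m.cast_nonneg
      linarith
    have hξabs : |ξ| = 1 := by rcases hξ with rfl | rfl <;> simp
    set s' := ∑ j : {v // v ≠ l}, |φ j - c| with hs'
    have hs : ∑ j, |φ j - c| = |φ l - c| + s' := Fintype.sum_eq_add_sum_subtype_ne _ l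
    set B := min ((b - a) * m) (s' + D * harmonic m) with hB
    set t := min (b - a) (|φ l - c| + D / (m + 1)) with ht
    set q : {v // v ≠ l} → ℝ := fun k => φ l * φ k +
      meanEdgeSum (fun v : {v // v ≠ l} => φ v) (leafDeleted x l k) with hq
    have hs'0 : 0 ≤ s' := sum_nonneg fun _ _ => abs_nonneg _
    have hD0 : 0 ≤ D := le_trans (by positivity) hD
    have ht0 : 0 ≤ t := le_min hab (by positivity)
    have hrange : ∀ k k', |ξ * q k - ξ * q k'| ≤ (b - a) * t := by
      intro k k'
      rw [← mul_sub, abs_mul, hξabs, one_mul, hq]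
      simp only [meanEdgeSum_leafDeleted φ hx, add_sub_add_left_eq_sub]
      refine (leafIncrement_sub_abs_le hφ (by lia) c k k').trans ?_
      rw [hcard, ht]
      gcongr
    have hstep : ∑ k : {v // v ≠ l}, ((x k : ℝ) - 1) / (Fintype.card V - 2) *
        Real.exp (ξ * q k) ≤ Real.exp (ξ * meanEdgeSum φ x + ((b - a) * t) ^ 2 / 8) := by
      refine (sum_mul_exp_le_of_abs_sub_le (fun k => ?_) ?_ hrange).trans_eq ?_
      · have : (1 : ℝ) ≤ x k := by exact_mod_cast hx.1 k
        exact div_nonneg (by linarith) hcard2.le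
      · rw [← sum_div, hx.sum_excess hl, div_self hcard2.ne']
      · rw [← sum_mul_meanEdgeSum_leafDeleted φ hx hl (by lia), mul_sum]
        simp only [hq, mul_left_comm]
    have hbound : ((b - a) * t) ^ 2 + (b - a) ^ 3 * B ≤ (b - a) ^ 3 *
        min ((b - a) * (m + 1 : ℕ)) (∑ j, |φ j - c| + D * harmonic (m + 1)) := by
      have ht2 : t ^ 2 ≤ (b - a) * t := by
        rw [sq]
        exact mul_le_mul_of_nonneg_right (min_le_left _ _) ht0
      have hmin : t + B ≤
          min ((b - a) * (m + 1 : ℕ)) (∑ j, |φ j - c| + D * harmonic (m + 1)) := by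
        refine le_min ?_ ?_
        · have h1 : t ≤ b - a := min_le_left _ _
          have h2 : B ≤ (b - a) * m := min_le_left _ _
          push_cast
          linarith
        · have h1 : t ≤ |φ l - c| + D / (m + 1) := min_le_right _ _
          have h2 : B ≤ s' + D * harmonic m := min_le_right _ _
          rw [hs, harmonic_succ]
          push_cast
          rw [mul_add, ← div_eq_mul_inv]
          linarith
      calc ((b - a) * t) ^ 2 + (b - a) ^ 3 * B
          ≤ (b - a) ^ 2 * ((b - a) * t) + (b - a) ^ 3 * B := by rw [mul_pow]; gcongr
        _ = (b - a) ^ 3 * (t + B) := by ring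
        _ ≤ _ := by gcongr
    have hfiber : ∀ k : {v // v ≠ l},
        ∑ H ∈ connectedWithDegrees (leafDeleted x l k),
          Real.exp (ξ * edgeSum φ (attachLeaf l H k)) ≤
        #(connectedWithDegrees x) * Real.exp ((b - a) ^ 3 * B / 8) *
          (((x k : ℝ) - 1) / (Fintype.card V - 2) * Real.exp (ξ * q k)) := by
      intro k
      rcases (hx.1 k).eq_or_lt with hk | hk
      · rw [connectedWithDegrees_leafDeleted_eq_empty hk.symm (by lia), ← hk]
        simp
      · have h := ih (hx.leafDeleted hl hk) (φ := fun v : {v // v ≠ l} => φ v)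
          (fun j => hφ j) (by linarith [abs_nonneg (φ l - c)]) (by lia)
        simp only [edgeSum_attachLeaf, mul_add, Real.exp_add, ← mul_sum]
        refine (mul_le_mul_of_nonneg_left h (Real.exp_pos _).le).trans_eq ?_
        rw [card_connectedWithDegrees_leafDeleted hx hl (by lia) k, hq]
        simp only [mul_add, Real.exp_add]
        ring
    rw [sum_connectedWithDegrees_eq hx.1 hl]
    refine (sum_le_sum fun k _ => hfiber k).trans ?_
    rw [← mul_sum, mul_assoc]
    refine mul_le_mul_of_nonneg_left ?_ (Nat.cast_nonneg _)
    refine (mul_le_mul_of_nonneg_left hstep (Real.exp_pos _).le).trans ?_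
    rw [← Real.exp_add]
    refine Real.exp_le_exp.2 ?_
    linarith

/-- Jensen's inequality for `exp` and a uniform average. -/
lemma exp_average_le {ι : Type*} {s : Finset ι} (hs : 0 < (#s : ℝ)) (f : ι → ℝ) :
    #s * Real.exp ((∑ i ∈ s, f i) / #s) ≤ ∑ i ∈ s, Real.exp (f i) := by
  set μ := (∑ i ∈ s, f i) / #s with hμ
  have hle : ∀ i ∈ s, Real.exp μ * (f i - μ + 1) ≤ Real.exp (f i) := fun i _ => by
    have h := mul_le_mul_of_nonneg_left (Real.add_one_le_exp (f i - μ)) (Real.exp_pos μ).le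
    rwa [← Real.exp_add, add_sub_cancel] at h
  refine le_trans (le_of_eq ?_) (sum_le_sum hle)
  have hsum : ∑ i ∈ s, f i = #s * μ := by rw [hμ]; field_simp
  rw [← mul_sum, sum_add_distrib, sum_sub_distrib, hsum]
  simp only [sum_const, nsmul_eq_mul]
  ring

lemma harmonic_sub_three_le_one_add_log {n m : ℕ} (h : n = m + 3) :
    (harmonic m : ℝ) ≤ 1 + Real.log n := by
  refine (harmonic_le_one_add_log m).trans ?_
  rcases m.eq_zero_or_pos with rfl | hm
  · simp [Real.log_natCast_nonneg]
  · gcongr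
    lia

/-- Upper bound for the moment generating function, for a fixed centre `c`. -/
lemma sum_exp_edgeSum_le_average {a b ξ : ℝ} (hab : a ≤ b) (hξ : ξ = -1 ∨ ξ = 1) {φ : V → ℝ}
    {x : V → ℕ} (hx : IsTreeSequence x) (hφ : ∀ j, φ j ∈ Set.Icc a b) (c : ℝ) :
    ∑ T ∈ connectedWithDegrees x, Real.exp (ξ * edgeSum φ T) ≤
      #(connectedWithDegrees x) * Real.exp
        (ξ * ((∑ T ∈ connectedWithDegrees x, edgeSum φ T) / #(connectedWithDegrees x)) +
        (b - a) ^ 3 * min ((b - a) * Fintype.card V)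
          ((∑ j, |φ j - c|) * (Real.log (Fintype.card V) + 2)) / 8) := by
  have hab' : 0 ≤ b - a := sub_nonneg.2 hab
  have hs : 0 ≤ ∑ j, |φ j - c| := by positivity
  have hlog := Real.log_natCast_nonneg (Fintype.card V)
  rcases hx.two_le_card.eq_or_lt with hV | hV
  · rw [connectedWithDegrees_of_card_eq_two hx hV.symm]
    simp only [sum_singleton, card_singleton, Nat.cast_one, one_mul, div_one]
    refine Real.exp_le_exp.2 (le_add_of_nonneg_right ?_)
    positivity
  · obtain ⟨m, hm : Fintype.card V = m + 3⟩ := Nat.exists_eq_add_of_le' hV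
    have hpos := card_connectedWithDegrees_pos hx
    refine (sum_exp_edgeSum_le (c := c) hξ m hx hφ le_rfl hm).trans ?_
    rw [sum_edgeSum_eq m φ hx hm, mul_div_cancel_left₀ _ hpos.ne']
    gcongr
    · lia
    · have := mul_le_mul_of_nonneg_left (harmonic_sub_three_le_one_add_log hm) hs
      linarith

end DegreeTrees

theorem tree_mgf_concentration (n : ℕ) (x : Fin n → ℕ)
    -- `x` is a tree degree sequence
    (hx1 : ∀ j, 1 ≤ x j) (hxsum : (∑ j, x j) + 2 = 2 * n)
    (a b : ℝ) (hab : a ≤ b) (φ : Fin n → ℝ) (hφ : ∀ j, φ j ∈ Set.Icc a b)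
    (F : SimpleGraph (Fin n) → ℝ)
    (hF : ∀ T : SimpleGraph (Fin n),
      F T = ∑ e ∈ T.edgeFinset,
        Sym2.lift ⟨fun j k => φ j * φ k, fun j k => by ring⟩ e)
    (Tx : Finset (SimpleGraph (Fin n)))
    (hTx : Tx = Finset.univ.filter
      (fun T : SimpleGraph (Fin n) => T.IsTree ∧ ∀ j, T.degree j = x j))
    (Fbar normφ L : ℝ)
    (hFbar : Fbar = (∑ T ∈ Tx, F T) / (Tx.card : ℝ))
    (hnorm : normφ = ⨅ c : ℝ, ∑ j, |φ j - c|)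
    (hL : L = (b - a) ^ 3 * min ((b - a) * n) (normφ * (Real.log n + 2)))
    (ξ : ℝ) (hξ : ξ = -1 ∨ ξ = 1) :
    ∃ K : ℝ, 0 ≤ K ∧ K ≤ L / 8 ∧
      (∑ T ∈ Tx, Real.exp (ξ * F T)) / (Tx.card : ℝ) = Real.exp (ξ * Fbar + K) := by
  have hx : DegreeTrees.IsTreeSequence x := ⟨hx1, by simpa using hxsum⟩
  have hTx' : Tx = DegreeTrees.connectedWithDegrees x := by
    rw [hTx]
    ext T
    rw [DegreeTrees.mem_connectedWithDegrees, Finset.mem_filter]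
    simp only [Finset.mem_univ, true_and]
    exact and_congr_left fun h => DegreeTrees.isTree_iff_connected_of_degree hx.2 h
  obtain rfl : F = DegreeTrees.edgeSum φ := by
    funext T
    rw [hF, DegreeTrees.sum_edgeFinset_eq_edgeSum]
  have hpos : 0 < (#Tx : ℝ) := hTx' ▸ DegreeTrees.card_connectedWithDegrees_pos hx
  have hlower := DegreeTrees.exp_average_le hpos fun T => ξ * DegreeTrees.edgeSum φ T
  have hupper := fun c => DegreeTrees.sum_exp_edgeSum_le_average hab hξ hx hφ c
  rw [← Finset.mul_sum, mul_div_assoc, ← hFbar, mul_comm, ← le_div_iff₀ hpos] at hlower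
  simp only [← hTx', ← hFbar, Fintype.card_fin, ← div_le_iff₀' hpos] at hupper
  set A := (∑ T ∈ Tx, Real.exp (ξ * DegreeTrees.edgeSum φ T)) / (#Tx : ℝ)
  have hA : 0 < A := (Real.exp_pos _).trans_le hlower
  refine ⟨Real.log A - ξ * Fbar, ?_, ?_, by rw [add_sub_cancel, Real.exp_log hA]⟩
  · rwa [sub_nonneg, Real.le_log_iff_exp_le hA]
  · have hK : ∀ c, Real.log A - ξ * Fbar ≤ (b - a) ^ 3 * min ((b - a) * n)
        ((∑ j, |φ j - c|) * (Real.log n + 2)) / 8 := fun c => by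
      rw [sub_le_iff_le_add', Real.log_le_iff_le_exp hA]
      exact hupper c
    have hab' : 0 ≤ b - a := sub_nonneg.2 hab
    have hlog : 0 ≤ Real.log n + 2 := by linarith [Real.log_natCast_nonneg n]
    rw [hL, hnorm, mul_min_of_nonneg _ _ (by positivity), ← min_div_div_right (by norm_num)]
    refine le_min ((hK 0).trans ?_) ?_
    · gcongr
      exact min_le_left _ _
    · rw [mul_comm (⨅ c, _), ← mul_assoc, mul_div_right_comm,
        Real.mul_iInf_of_nonneg (by positivity)]
      refine le_ciInf fun c => (hK c).trans ?_
      rw [← mul_div_right_comm, mul_assoc, mul_comm (Real.log n + 2)]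
      gcongr
      exact min_le_right _ _
end

section
/- Let x = (x_1,…,x_n) be a tree degree sequence, let a ≤ b be reals, let φ : {1,…,n} → [a,b], and for a tree T on {1,…,n} let F(T) = Σ_{{j,k}∈E(T)} φ(j)φ(k). Let F̄(x) be the average of F(T) over all trees T with degree sequence x, let ‖φ‖_m = min_{c∈ℝ} Σ_{j=1}^n |φ(j) − c|, and let L_φ = (b−a)³ · min{ (b−a)n, ‖φ‖_m (ln n + 2) }. If T̂ is a uniformly random tree with degree sequence x, then for any real t > 0, Pr( |F(T̂) − F̄(x)| > t ) ≤ 2·exp( −2t²/L_φ ). -/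
attribute [local instance] Classical.propDecidable

namespace TreeDegree

variable {V : Type}

/-- The graph obtained from `T` by attaching `l` as a leaf at the vertex `p`. -/
def addLeaf {l : V} (T : SimpleGraph {v // v ≠ l}) (p : {v // v ≠ l}) : SimpleGraph V where
  Adj u v := (∃ hu hv, T.Adj ⟨u, hu⟩ ⟨v, hv⟩) ∨ (u = l ∧ v = p) ∨ (u = p ∧ v = l)
  symm := ⟨by
    rintro u v (⟨hu, hv, h⟩ | h | h)
    · exact Or.inl ⟨hv, hu, h.symm⟩
    · exact Or.inr (Or.inr h.symm)
    · exact Or.inr (Or.inl h.symm)⟩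
  loopless := ⟨by
    rintro u (⟨hu, hv, h⟩ | h | h)
    · exact T.loopless.irrefl _ h
    · exact p.2 (h.2.symm.trans h.1)
    · exact p.2 (h.1.symm.trans h.2)⟩

section adj

variable {l : V} (T : SimpleGraph {v // v ≠ l}) (p : {v // v ≠ l})

@[simp] lemma addLeaf_adj_coe (u v : {v // v ≠ l}) :
    (addLeaf T p).Adj u v ↔ T.Adj u v := by
  simp [addLeaf, u.2, v.2]

@[simp] lemma addLeaf_adj_leaf_left (v : {v // v ≠ l}) :
    (addLeaf T p).Adj l v ↔ v = p := by
  simp [addLeaf, v.2, Subtype.ext_iff]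

@[simp] lemma addLeaf_adj_leaf_right (v : {v // v ≠ l}) :
    (addLeaf T p).Adj v l ↔ v = p := by
  rw [SimpleGraph.adj_comm, addLeaf_adj_leaf_left]

end adj

variable [Fintype V]

open MeasureTheory ProbabilityTheory in
/-- Hoeffding's lemma for a finitely supported distribution. -/
lemma sum_mul_exp_le_of_sub_le {W : Type} [Fintype W] (w z : W → ℝ) (hw : ∀ p, 0 ≤ w p)
    (hsum : ∑ p, w p = 1) (c : ℝ)
    (hz : ∀ p q, 0 < w p → 0 < w q → z p - z q ≤ c) (s : ℝ) :
    ∑ p, w p * Real.exp (s * z p) ≤ Real.exp (s * ∑ p, w p * z p + s ^ 2 / 8 * c ^ 2) := by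
  let _ : MeasurableSpace W := ⊤
  let μ : Measure W := ∑ p, ENNReal.ofReal (w p) • Measure.dirac p
  have hintegral : ∀ f : W → ℝ, ∫ p, f p ∂μ = ∑ p, w p * f p := fun f => by
    rw [integral_finsetSum_measure fun p _ => ?_]
    · refine Finset.sum_congr rfl fun p _ => ?_
      rw [integral_smul_measure, integral_dirac, ENNReal.toReal_ofReal (hw p), smul_eq_mul]
    · exact (integrable_dirac (by simp)).smul_measure (by simp)
  have : IsProbabilityMeasure μ := ⟨by
    simp only [μ, Measure.coe_finsetSum, Finset.sum_apply, Measure.smul_apply, measure_univ,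
      smul_eq_mul, mul_one]
    rw [← ENNReal.ofReal_sum_of_nonneg fun p _ => hw p, hsum, ENNReal.ofReal_one]⟩
  obtain ⟨p₀, hp₀⟩ : ∃ p, 0 < w p := by
    by_contra! h
    linarith [Finset.sum_nonpos fun p (_ : p ∈ Finset.univ) => h p]
  obtain ⟨q, hq, hmin⟩ := Finset.exists_min_image (Finset.univ.filter fun p => 0 < w p) z
    ⟨p₀, by simpa using hp₀⟩
  simp only [Finset.mem_filter, Finset.mem_univ, true_and] at hq hmin
  have hae : ∀ᵐ p ∂μ, z p ∈ Set.Icc (z q) (z q + c) := by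
    rw [ae_iff]
    simp only [μ, Measure.coe_finsetSum, Finset.sum_apply, Measure.smul_apply, smul_eq_mul]
    refine Finset.sum_eq_zero fun p _ => ?_
    rcases (hw p).eq_or_lt with h | h
    · simp [← h]
    · have : z p ∈ Set.Icc (z q) (z q + c) := ⟨hmin p h, by linarith [hz p q h hq]⟩
      simp [this.1, this.2]
  have hmgf := (hasSubgaussianMGF_of_mem_Icc (measurable_of_finite z).aemeasurable hae).mgf_le s
  rw [mgf, hintegral, hintegral] at hmgf
  set m := ∑ p, w p * z p
  calc ∑ p, w p * Real.exp (s * z p)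
      = Real.exp (s * m) * ∑ p, w p * Real.exp (s * (z p - m)) := by
        rw [Finset.mul_sum]
        refine Finset.sum_congr rfl fun p _ => ?_
        rw [mul_left_comm, ← Real.exp_add]
        ring_nf
    _ ≤ Real.exp (s * m) * _ := mul_le_mul_of_nonneg_left hmgf (Real.exp_pos _).le
    _ = _ := by
        rw [← Real.exp_add]
        push_cast
        simp only [add_sub_cancel_left, Real.norm_eq_abs, div_pow, sq_abs]
        ring_nf

/-- The sum of `φ j * φ k` over the edges `jk` of `T`. -/
noncomputable def edgeWeight (φ : V → ℝ) (T : SimpleGraph V) : ℝ :=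
  (∑ j, ∑ k, if T.Adj j k then φ j * φ k else 0) / 2

lemma sum_edgeFinset_eq_edgeWeight (φ : V → ℝ) (T : SimpleGraph V) :
    ∑ e ∈ T.edgeFinset, Sym2.lift ⟨fun j k => φ j * φ k, fun j k => by ring⟩ e
      = edgeWeight φ T := by
  set g : Sym2 V → ℝ := Sym2.lift ⟨fun j k => φ j * φ k, fun j k => by ring⟩ with hg
  have hdarts : ∑ d : T.Dart, g d.edge = ∑ j, ∑ k, if T.Adj j k then φ j * φ k else 0 := by
    rw [← Fintype.sum_prod_type' (fun j k => if T.Adj j k then φ j * φ k else 0),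
      ← Finset.sum_filter]
    refine Finset.sum_bij (fun d _ => d.toProd) (fun d _ => by simp) (fun d _ d' _ h => ?_)
      (fun p hp => ⟨⟨p, by simpa using hp⟩, by simp, rfl⟩) (fun d _ => rfl)
    exact SimpleGraph.Dart.ext _ _ h
  have hfib : ∑ d : T.Dart, g d.edge = ∑ e ∈ T.edgeFinset, 2 * g e := by
    rw [← Finset.sum_fiberwise_of_maps_to (t := T.edgeFinset)
      (g := fun d : T.Dart => d.edge) (fun d _ => by simp)]
    refine Finset.sum_congr rfl fun e he => ?_
    rw [Finset.sum_congr rfl (g := fun _ => g e) (fun d hd => by rw [(Finset.mem_filter.1 hd).2]),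
      Finset.sum_const, nsmul_eq_mul,
      T.dart_edge_fiber_card e (by simpa using he)]
    norm_num
  rw [edgeWeight, ← hdarts, hfib, ← Finset.mul_sum]
  ring

/-- The connected graphs in which every vertex `j` has degree `y j + 1`. -/
noncomputable def connectedGraphs (y : V → ℕ) : Finset (SimpleGraph V) :=
  Finset.univ.filter fun T => T.Connected ∧ ∀ j, T.degree j = y j + 1

lemma mem_connectedGraphs {y : V → ℕ} {T : SimpleGraph V} :
    T ∈ connectedGraphs y ↔ T.Connected ∧ ∀ j, T.degree j = y j + 1 := by
  simp [connectedGraphs]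

lemma degree_eq_sum (T : SimpleGraph V) (j : V) :
    T.degree j = ∑ k, if T.Adj j k then 1 else 0 := by
  rw [← SimpleGraph.card_neighborFinset_eq_degree, SimpleGraph.neighborFinset_eq_filter,
    Finset.card_filter]

section addLeaf

variable {l : V} (T : SimpleGraph {v // v ≠ l}) (p : {v // v ≠ l})

lemma edgeWeight_addLeaf (φ : V → ℝ) :
    edgeWeight φ (addLeaf T p)
      = φ l * φ p + edgeWeight (fun v : {v // v ≠ l} => φ v) T := by
  simp only [edgeWeight, Fintype.sum_eq_add_sum_subtype_ne _ l, Finset.sum_add_distrib]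
  simp
  ring

lemma degree_addLeaf_leaf : (addLeaf T p).degree l = 1 := by
  rw [degree_eq_sum, Fintype.sum_eq_add_sum_subtype_ne _ l]
  simp

lemma degree_addLeaf_coe (v : {v // v ≠ l}) :
    (addLeaf T p).degree v = T.degree v + if v = p then 1 else 0 := by
  rw [degree_eq_sum, degree_eq_sum, Fintype.sum_eq_add_sum_subtype_ne _ l]
  simp [add_comm]

lemma addLeaf_connected_iff : (addLeaf T p).Connected ↔ T.Connected := by
  constructor
  · intro h
    have := h.induce_compl_singleton_of_degree_eq_one (degree_addLeaf_leaf T p)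
    have e : (addLeaf T p).comap (Subtype.val : {v // v ≠ l} → V) = T := by ext; simp
    rw [← e]
    exact this
  · intro h
    rw [SimpleGraph.connected_iff_exists_forall_reachable]
    refine ⟨p, fun v => ?_⟩
    by_cases hv : v = l
    · subst hv
      exact SimpleGraph.Adj.reachable (by simp)
    · let f : T →g addLeaf T p := ⟨Subtype.val, fun h => by simpa using h⟩
      exact (h.preconnected p ⟨v, hv⟩).map f

end addLeaf

lemma addLeaf_comap_of_adj {l : V} {T : SimpleGraph V} (hl : T.degree l = 1)
    (p : {v // v ≠ l}) (hp : T.Adj l p) :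
    addLeaf (T.comap Subtype.val) p = T := by
  obtain ⟨q, hq, huniq⟩ := SimpleGraph.degree_eq_one_iff_existsUnique_adj.1 hl
  have hadj : ∀ v, T.Adj l v ↔ v = p := fun v =>
    ⟨fun h => (huniq v h).trans (huniq p hp).symm, fun h => h ▸ hp⟩
  ext u v
  by_cases hu : u = l <;> by_cases hv : v = l
  · subst hu hv; simp
  · subst hu
    rw [hadj, addLeaf_adj_leaf_left _ p ⟨v, hv⟩, Subtype.ext_iff]
  · subst hv
    rw [T.adj_comm, hadj, addLeaf_adj_leaf_right _ p ⟨u, hu⟩, Subtype.ext_iff]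
  · rw [addLeaf_adj_coe _ p ⟨u, hu⟩ ⟨v, hv⟩]; rfl

/-- The degree data left after removing the leaf `l` attached at `p`. -/
noncomputable def removeLeaf {l : V} (y : V → ℕ) (p : {v // v ≠ l}) (v : {v // v ≠ l}) : ℕ :=
  if v = p then y v - 1 else y v

lemma addLeaf_mem_connectedGraphs_iff {l : V} {y : V → ℕ} (hl : y l = 0)
    (T : SimpleGraph {v // v ≠ l}) {p : {v // v ≠ l}} (hp : 0 < y p) :
    addLeaf T p ∈ connectedGraphs y ↔ T ∈ connectedGraphs (removeLeaf y p) := by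
  rw [mem_connectedGraphs, mem_connectedGraphs, addLeaf_connected_iff]
  refine and_congr_right fun _ => ⟨fun h v => ?_, fun h v => ?_⟩
  · have := h v
    rw [degree_addLeaf_coe] at this
    unfold removeLeaf
    split_ifs at this ⊢ with hv
    · subst hv; omega
    · omega
  · by_cases hv : v = l
    · subst hv
      rw [degree_addLeaf_leaf, hl]
    · have := h ⟨v, hv⟩
      unfold removeLeaf at this
      rw [degree_addLeaf_coe T p ⟨v, hv⟩]
      split_ifs at this ⊢ with hv
      · subst hv; simp at *; omega
      · simp at *; omega

lemma sum_connectedGraphs_eq_sum_addLeaf {l : V} {y : V → ℕ} (hl : y l = 0)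
    (hcard : 3 ≤ Fintype.card V) (f : SimpleGraph V → ℝ) :
    ∑ T ∈ connectedGraphs y, f T
      = ∑ p : {v // v ≠ l}, if 0 < y p then
          ∑ T ∈ connectedGraphs (removeLeaf y p), f (addLeaf T p) else 0 := by
  have hdeg : ∀ T ∈ connectedGraphs y, T.degree l = 1 := fun T hT => by
    rw [(mem_connectedGraphs.1 hT).2, hl]
  have hsplit : ∀ T ∈ connectedGraphs y,
      f T = ∑ p : {v // v ≠ l}, if T.Adj l p then f T else 0 := fun T hT => by
    have := hdeg T hT
    rw [degree_eq_sum, Fintype.sum_eq_add_sum_subtype_ne _ l] at this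
    simp only [SimpleGraph.irrefl, if_false, zero_add] at this
    calc f T = f T * ((∑ p : {v // v ≠ l}, if T.Adj l p then 1 else 0 : ℕ) : ℝ) := by
          rw [this]; simp
      _ = _ := by push_cast; rw [Finset.mul_sum]; simp
  rw [Finset.sum_congr rfl hsplit, Finset.sum_comm]
  refine Finset.sum_congr rfl fun p _ => ?_
  rw [← Finset.sum_filter]
  split_ifs with hp
  · refine Finset.sum_bij' (fun T _ => T.comap Subtype.val) (fun T _ => addLeaf T p) ?_ ?_ ?_ ?_ ?_
    · intro T hT
      rw [Finset.mem_filter] at hT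
      rw [← addLeaf_mem_connectedGraphs_iff hl _ hp,
        addLeaf_comap_of_adj (hdeg T hT.1) p hT.2]
      exact hT.1
    · intro T hT
      rw [Finset.mem_filter, addLeaf_mem_connectedGraphs_iff hl _ hp]
      exact ⟨hT, by simp⟩
    · intro T hT
      rw [Finset.mem_filter] at hT
      exact addLeaf_comap_of_adj (hdeg T hT.1) p hT.2
    · intro T hT
      ext; simp
    · intro T hT
      rw [Finset.mem_filter] at hT
      rw [addLeaf_comap_of_adj (hdeg T hT.1) p hT.2]
  · refine Finset.sum_eq_zero fun T hT => ?_
    rw [Finset.mem_filter] at hT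
    exfalso
    have e := addLeaf_comap_of_adj (hdeg T hT.1) p hT.2
    obtain ⟨hc, hd⟩ := mem_connectedGraphs.1 hT.1
    rw [← e, addLeaf_connected_iff] at hc
    have h1 := hd p
    rw [← e, degree_addLeaf_coe] at h1
    have : Nontrivial {v // v ≠ l} := by
      rw [← Fintype.one_lt_card_iff_nontrivial, Fintype.card_subtype_compl,
        Fintype.card_subtype_eq]
      omega
    have h2 := hc.preconnected.degree_pos_of_nontrivial p
    rw [if_pos rfl] at h1
    rw [Nat.eq_zero_of_not_pos hp] at h1
    exact h2.ne' (by convert Nat.add_right_cancel h1)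

lemma connectedGraphs_eq_singleton_top {y : V → ℕ} (hcard : Fintype.card V = 2)
    (hy : ∀ v, y v = 0) : connectedGraphs y = {⊤} := by
  have : Nonempty V := Fintype.card_pos_iff.1 (by omega)
  have : Nontrivial V := Fintype.one_lt_card_iff_nontrivial.1 (by omega)
  ext T
  rw [mem_connectedGraphs, Finset.mem_singleton]
  constructor
  · rintro ⟨_, hd⟩
    ext u v
    rw [SimpleGraph.top_adj]
    refine ⟨fun h => h.ne, fun h => ?_⟩
    have hsub : T.neighborFinset u ⊆ Finset.univ.erase u := fun w hw => by
      simpa using (T.ne_of_adj (by simpa using hw)).symm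
    have heq := Finset.eq_of_subset_of_card_le hsub (by
      rw [Finset.card_erase_of_mem (Finset.mem_univ _), Finset.card_univ, hcard,
        SimpleGraph.card_neighborFinset_eq_degree, hd, hy])
    rw [← SimpleGraph.mem_neighborFinset, heq]
    simpa using h.symm
  · rintro rfl
    refine ⟨SimpleGraph.connected_top, fun j => ?_⟩
    rw [hy]
    have := SimpleGraph.complete_graph_degree j
    rw [hcard] at this
    convert this

/-- The number of trees in which every vertex `j` has degree `y j + 1`. -/
noncomputable def treeCount (y : V → ℕ) : ℝ :=
  ((∑ v, y v).factorial : ℝ) / ∏ v, ((y v).factorial : ℝ)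

/-- The average of `edgeWeight φ` over the trees in which every vertex `j` has degree `y j + 1`. -/
noncomputable def meanWeight (y : V → ℕ) (φ : V → ℝ) : ℝ :=
  if ∑ v, y v = 0 then ((∑ v, φ v) ^ 2 - ∑ v, φ v ^ 2) / 2
  else ((∑ v, y v * φ v) * ∑ v, φ v - ∑ v, y v * φ v ^ 2) / ((∑ v, y v : ℕ) : ℝ)

/-- The conditional mean of `edgeWeight φ` given that the leaf `l` is attached at `p`. -/
noncomputable def meanWeightGiven {l : V} (y : V → ℕ) (φ : V → ℝ) (p : {v // v ≠ l}) : ℝ :=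
  φ l * φ p + meanWeight (removeLeaf y p) (fun v : {v // v ≠ l} => φ v)

section removeLeaf

variable {l : V} {y : V → ℕ} {p : {v // v ≠ l}}

lemma sum_subtype_mul (hl : y l = 0) (g : V → ℝ) :
    ∑ v : {v // v ≠ l}, (y v : ℝ) * g v = ∑ v, (y v : ℝ) * g v := by
  rw [Fintype.sum_eq_add_sum_subtype_ne (fun v => (y v : ℝ) * g v) l, hl]
  simp

lemma sum_subtype (g : V → ℝ) : ∑ v : {v // v ≠ l}, g v = ∑ v, g v - g l := by
  rw [Fintype.sum_eq_add_sum_subtype_ne g l]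
  ring

lemma sum_removeLeaf_mul (hl : y l = 0) (hp : 0 < y p) (g : V → ℝ) :
    ∑ v : {v // v ≠ l}, (removeLeaf y p v : ℝ) * g v = ∑ v, (y v : ℝ) * g v - g p := by
  rw [← sum_subtype_mul hl, eq_sub_iff_add_eq]
  have : g p = ∑ v : {v // v ≠ l}, if v = p then g v else 0 := by simp
  rw [this, ← Finset.sum_add_distrib]
  refine Finset.sum_congr rfl fun v _ => ?_
  unfold removeLeaf
  split_ifs with hv
  · subst hv
    rw [Nat.cast_sub hp]
    push_cast
    ring
  · ring

lemma sum_removeLeaf (hl : y l = 0) (hp : 0 < y p) {K : ℕ} (hsum : ∑ v, y v = K + 1) :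
    ∑ v, removeLeaf y p v = K := by
  have := sum_removeLeaf_mul hl hp (fun _ => 1)
  simp only [mul_one] at this
  rw [eq_sub_iff_add_eq] at this
  norm_cast at this
  omega

lemma treeCount_removeLeaf (hl : y l = 0) (hp : 0 < y p) {K : ℕ} (hsum : ∑ v, y v = K + 1) :
    treeCount (removeLeaf y p) = treeCount y * (y p / (K + 1)) := by
  have hprod : ∏ v, ((y v).factorial : ℝ)
      = y p * ∏ v, ((removeLeaf y p v).factorial : ℝ) := by
    rw [Fintype.prod_eq_mul_prod_subtype_ne _ l, hl, Nat.factorial_zero, Nat.cast_one, one_mul]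
    have : (y p : ℝ) = ∏ v : {v // v ≠ l}, if v = p then (y v : ℝ) else 1 := by simp
    rw [this, ← Finset.prod_mul_distrib]
    refine Finset.prod_congr rfl fun v _ => ?_
    unfold removeLeaf
    split_ifs with hv
    · subst hv
      rw [← Nat.mul_factorial_pred hp.ne']
      push_cast
      ring
    · ring
  have h0 : ∏ v, ((removeLeaf y p v).factorial : ℝ) ≠ 0 :=
    Finset.prod_ne_zero_iff.2 fun v _ => by positivity
  have hy : (y p : ℝ) ≠ 0 := by positivity
  have hK : (K + 1 : ℝ) ≠ 0 := by positivity
  rw [treeCount, treeCount, sum_removeLeaf hl hp hsum, hsum, hprod, Nat.factorial_succ]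
  push_cast
  field_simp

lemma sum_ite_treeCount_mul (hl : y l = 0) {K : ℕ} (hsum : ∑ v, y v = K + 1)
    (g : {v // v ≠ l} → ℝ) :
    (∑ p : {v // v ≠ l}, if 0 < y p then treeCount (removeLeaf y p) * g p else 0)
      = treeCount y * ∑ p : {v // v ≠ l}, (y p / (K + 1) : ℝ) * g p := by
  rw [Finset.mul_sum]
  refine Finset.sum_congr rfl fun p _ => ?_
  split_ifs with hp
  · rw [treeCount_removeLeaf hl hp hsum]
    ring
  · simp [Nat.eq_zero_of_not_pos hp]

lemma sum_div_eq_one (hl : y l = 0) {K : ℕ} (hsum : ∑ v, y v = K + 1) :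
    ∑ p : {v // v ≠ l}, (y p / (K + 1) : ℝ) = 1 := by
  have h := sum_subtype_mul hl (fun _ => 1)
  simp only [mul_one] at h
  rw [← Finset.sum_div, h, ← Nat.cast_sum, hsum]
  push_cast
  exact div_self (by positivity)

lemma meanWeightGiven_eq (hl : y l = 0) (hp : 0 < y p) {K : ℕ} (hK : 0 < K)
    (hsum : ∑ v, y v = K + 1) (φ : V → ℝ) :
    meanWeightGiven y φ p = φ l * φ p
      + ((∑ v, y v * φ v - φ p) * (∑ v, φ v - φ l) - (∑ v, y v * φ v ^ 2 - φ p ^ 2)) / K := by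
  rw [meanWeightGiven, meanWeight, sum_removeLeaf hl hp hsum, if_neg hK.ne',
    sum_removeLeaf_mul hl hp, sum_removeLeaf_mul hl hp (fun v => φ v ^ 2), sum_subtype]

end removeLeaf

lemma eq_of_pos_of_sum_eq_one {y : V → ℕ} (hsum : ∑ v, y v = 1) {p q : V}
    (hp : 0 < y p) (hq : 0 < y q) : p = q := by
  by_contra hpq
  have := Finset.add_le_sum (s := Finset.univ) (fun v _ => Nat.zero_le (y v))
    (Finset.mem_univ p) (Finset.mem_univ q) hpq
  omega

lemma sum_mul_meanWeightGiven {l : V} {y : V → ℕ} (hl : y l = 0) {K : ℕ}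
    (hcard : Fintype.card V = K + 3) (hsum : ∑ v, y v = K + 1) (φ : V → ℝ) :
    ∑ p : {v // v ≠ l}, (y p / (K + 1) : ℝ) * meanWeightGiven y φ p = meanWeight y φ := by
  rcases K.eq_zero_or_pos with rfl | hK
  · obtain ⟨p, hp⟩ : ∃ p, 0 < y p := by
      by_contra! h
      simp [fun v => Nat.le_zero.1 (h v)] at hsum
    have hpl : p ≠ l := by rintro rfl; omega
    have hother : ∀ v, v ≠ p → y v = 0 := fun v hv => by
      by_contra h
      exact hv (eq_of_pos_of_sum_eq_one hsum (Nat.pos_of_ne_zero h) hp)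
    have hyp : y p = 1 := by
      rwa [Finset.sum_eq_single p (fun v _ hv => hother v hv) (by simp)] at hsum
    obtain ⟨q, hq⟩ : ∃ q, (Finset.univ.erase l).erase p = {q} := by
      rw [← Finset.card_eq_one, Finset.card_erase_of_mem (by simpa using hpl),
        Finset.card_erase_of_mem (Finset.mem_univ _), Finset.card_univ, hcard]
    have hthree : ∀ g : V → ℝ, ∑ v, g v = g l + (g p + g q) := fun g => by
      rw [← Finset.add_sum_erase _ _ (Finset.mem_univ l),
        ← Finset.add_sum_erase _ _ (show p ∈ Finset.univ.erase l by simpa using hpl), hq,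
        Finset.sum_singleton]
    have hsingle : ∀ g : V → ℝ, ∑ v, (y v : ℝ) * g v = g p := fun g => by
      rw [Finset.sum_eq_single p (fun v _ hv => by simp [hother v hv]) (by simp), hyp]
      simp
    rw [Finset.sum_eq_single ⟨p, hpl⟩
      (fun v _ hv => by simp [hother v (fun h => hv (Subtype.ext h))]) (by simp)]
    rw [meanWeightGiven, meanWeight, meanWeight, sum_removeLeaf hl (by exact hp) hsum, if_pos rfl,
      if_neg (by omega), hsum, hsingle, hsingle, sum_subtype, sum_subtype (fun v => φ v ^ 2),
      hthree, hthree (fun v => φ v ^ 2), hyp]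
    push_cast
    ring
  · have hK' : (K : ℝ) ≠ 0 := by positivity
    have hK1 : (K + 1 : ℝ) ≠ 0 := by positivity
    set A := ∑ v, (y v : ℝ) * φ v with hA
    set Q := ∑ v, (y v : ℝ) * φ v ^ 2 with hQ
    set S := ∑ v, φ v with hS
    have hterm : ∀ p : {v // v ≠ l}, (y p / (K + 1) : ℝ) * meanWeightGiven y φ p
        = (φ l / (K + 1) - (S - φ l) / (K * (K + 1))) * (y p * φ p)
          + (1 / (K * (K + 1))) * (y p * φ p ^ 2)
          + ((A * (S - φ l) - Q) / K) * (y p / (K + 1)) := fun p => by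
      rcases (y p).eq_zero_or_pos with hp | hp
      · simp [hp]
      · rw [meanWeightGiven_eq hl hp hK hsum, ← hA, ← hQ, ← hS]
        field_simp
        ring
    rw [Finset.sum_congr rfl fun p _ => hterm p, Finset.sum_add_distrib, Finset.sum_add_distrib,
      ← Finset.mul_sum, ← Finset.mul_sum, ← Finset.mul_sum, sum_div_eq_one hl hsum,
      sum_subtype_mul hl, sum_subtype_mul hl (fun v => φ v ^ 2), ← hA, ← hQ, meanWeight,
      if_neg (by omega), hsum, ← hA, ← hQ, ← hS]
    push_cast
    field_simp
    ring

lemma meanWeightGiven_sub_le {l : V} {y : V → ℕ} (hl : y l = 0) {K : ℕ}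
    (hcard : Fintype.card V = K + 3) (hsum : ∑ v, y v = K + 1) {φ : V → ℝ} {a b : ℝ}
    (hφ : ∀ v, φ v ∈ Set.Icc a b) (c : ℝ) {p q : {v // v ≠ l}} (hp : 0 < y p) (hq : 0 < y q) :
    meanWeightGiven y φ p - meanWeightGiven y φ q
      ≤ (b - a) * min (b - a) (|φ l - c| + (∑ v, |φ v - c|) / K) := by
  have hab : 0 ≤ b - a := by linarith [(hφ l).1, (hφ l).2]
  have hD : 0 ≤ ∑ v, |φ v - c| := Finset.sum_nonneg fun v _ => abs_nonneg _
  by_cases hpq : p = q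
  · subst hpq
    rw [sub_self]
    positivity
  have hpq' : (q : V) ≠ p := fun h => hpq (Subtype.ext h.symm)
  have hK : 0 < K := by
    by_contra! h
    obtain rfl := Nat.le_zero.1 h
    exact hpq' (eq_of_pos_of_sum_eq_one hsum hq hp)
  have hK' : (0 : ℝ) < K := by positivity
  set E := ((Finset.univ.erase l).erase (p : V)).erase (q : V) with hE
  have hmem_p : (p : V) ∈ Finset.univ.erase l := by simpa using p.2
  have hmem_q : (q : V) ∈ (Finset.univ.erase l).erase (p : V) := by simpa using ⟨hpq', q.2⟩
  have hcardE : (E.card : ℝ) = K := by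
    rw [hE, Finset.card_erase_of_mem hmem_q, Finset.card_erase_of_mem hmem_p,
      Finset.card_erase_of_mem (Finset.mem_univ _), Finset.card_univ, hcard]
    simp
  have hsumE : ∑ v, φ v = φ l + (φ p + (φ q + ∑ v ∈ E, φ v)) := by
    rw [Finset.add_sum_erase _ _ hmem_q, Finset.add_sum_erase _ _ hmem_p,
      Finset.add_sum_erase _ _ (Finset.mem_univ _)]
  have hdiff : meanWeightGiven y φ p - meanWeightGiven y φ q
      = (φ p - φ q) * ((∑ v ∈ E, (φ l - φ v)) / K) := by
    rw [meanWeightGiven_eq hl hp hK hsum, meanWeightGiven_eq hl hq hK hsum, hsumE,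
      Finset.sum_sub_distrib, Finset.sum_const, nsmul_eq_mul, hcardE]
    field_simp
    ring
  have hsub : ∀ u v, |φ u - φ v| ≤ b - a := fun u v =>
    abs_sub_le_iff.2 ⟨by linarith [(hφ u).2, (hφ v).1], by linarith [(hφ v).2, (hφ u).1]⟩
  have havg : |(∑ v ∈ E, (φ l - φ v)) / K| ≤ min (b - a) (|φ l - c| + (∑ v, |φ v - c|) / K) := by
    rw [abs_div, abs_of_pos hK', div_le_iff₀ hK', min_mul_of_nonneg _ _ hK'.le]
    refine (Finset.abs_sum_le_sum_abs _ _).trans (le_min ?_ ?_)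
    · refine (Finset.sum_le_sum fun v _ => hsub l v).trans_eq ?_
      rw [Finset.sum_const, nsmul_eq_mul, hcardE, mul_comm]
    · calc ∑ v ∈ E, |φ l - φ v| ≤ ∑ v ∈ E, (|φ l - c| + |φ v - c|) :=
            Finset.sum_le_sum fun v _ => by
              rw [abs_sub_comm (φ v)]
              exact abs_sub_le _ _ _
        _ = |φ l - c| * K + ∑ v ∈ E, |φ v - c| := by
            rw [Finset.sum_add_distrib, Finset.sum_const, nsmul_eq_mul, hcardE, mul_comm]
        _ ≤ |φ l - c| * K + ∑ v, |φ v - c| := by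
            gcongr
            exact Finset.subset_univ _
        _ = _ := by field_simp
  calc _ ≤ |(φ p - φ q) * ((∑ v ∈ E, (φ l - φ v)) / K)| := hdiff ▸ le_abs_self _
    _ = |φ p - φ q| * |(∑ v ∈ E, (φ l - φ v)) / K| := abs_mul _ _
    _ ≤ _ := mul_le_mul (hsub _ _) havg (abs_nonneg _) hab

/-- The variance proxy of `edgeWeight φ` on a random tree with `K + 2` vertices, where `φ` takes
values in an interval of length `δ` and has total deviation `D` from some centre. -/
noncomputable def varianceProxy (δ D : ℝ) (K : ℕ) : ℝ :=
  δ ^ 3 * min (δ * K) (D * (1 + harmonic (K - 1)))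

lemma varianceProxy_add_le {δ D u : ℝ} (hδ : 0 ≤ δ) (hu : 0 ≤ u) (huD : u ≤ D) (K : ℕ) :
    varianceProxy δ (D - u) K + (δ * min δ (u + D / K)) ^ 2 ≤ varianceProxy δ D (K + 1) := by
  have hD : 0 ≤ D := hu.trans huD
  set r := min δ (u + D / K) with hr
  have hr0 : 0 ≤ r := by positivity
  have hrδ : r ≤ δ := min_le_left _ _
  have hru : r ≤ u + D / K := min_le_right _ _
  have hsq : (δ * r) ^ 2 ≤ δ ^ 3 * r := by
    have : δ ^ 2 * (r * r) ≤ δ ^ 2 * (δ * r) := by gcongr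
    linarith
  have hstep : min (δ * K) ((D - u) * (1 + harmonic (K - 1))) + r
      ≤ min (δ * (K + 1 : ℕ)) (D * (1 + harmonic (K + 1 - 1))) := by
    refine le_min ?_ ?_
    · push_cast
      linarith [min_le_left (δ * K) ((D - u) * (1 + harmonic (K - 1)))]
    · rcases K with _ | K
      · simp only [Nat.cast_zero, div_zero, add_zero, zero_add, Nat.sub_self, harmonic_zero,
          Rat.cast_zero, mul_one, mul_zero] at hru ⊢
        linarith [min_le_left 0 ((D - u) * (1 + (harmonic (0 - 1) : ℝ)))]
      · have h1 := min_le_right (δ * (K + 1 : ℕ)) ((D - u) * (1 + harmonic (K + 1 - 1)))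
        have hH : (0 : ℝ) ≤ harmonic K := by
          rw [harmonic]
          positivity
        simp only [Nat.add_sub_cancel, harmonic_succ K] at h1 hru ⊢
        have h2 := mul_nonneg hu hH
        push_cast at h1 hru ⊢
        rw [div_eq_mul_inv] at hru
        linarith
  calc _ ≤ δ ^ 3 * (min (δ * K) ((D - u) * (1 + harmonic (K - 1))) + r) := by
        rw [varianceProxy, mul_add]
        linarith
    _ ≤ _ := mul_le_mul_of_nonneg_left hstep (by positivity)

lemma exists_eq_zero_of_sum_lt_card {y : V → ℕ} (h : ∑ v, y v < Fintype.card V) :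
    ∃ l, y l = 0 := by
  by_contra! hy
  have := Finset.card_nsmul_le_sum Finset.univ y 1 fun v _ => Nat.pos_of_ne_zero (hy v)
  rw [Finset.card_univ, smul_eq_mul, mul_one] at this
  exact this.not_gt h

lemma card_subtype_ne {l : V} {m : ℕ} (h : Fintype.card V = m + 1) :
    Fintype.card {v // v ≠ l} = m := by
  rw [Fintype.card_subtype_compl, Fintype.card_subtype_eq, h, Nat.add_sub_cancel]

lemma treeCount_eq_one {y : V → ℕ} (hy : ∀ v, y v = 0) : treeCount y = 1 := by
  simp [treeCount, hy]

lemma edgeWeight_top {y : V → ℕ} (hy : ∀ v, y v = 0) (φ : V → ℝ) :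
    edgeWeight φ ⊤ = meanWeight y φ := by
  have h : ∀ j k, (if j = k then 0 else φ j * φ k)
      = φ j * φ k - if j = k then φ j * φ k else 0 := fun j k => by
    split_ifs <;> simp
  simp [edgeWeight, meanWeight, hy, h, Finset.sum_sub_distrib, ← Finset.mul_sum,
    ← Finset.sum_mul, sq]

theorem card_connectedGraphs (K : ℕ) : ∀ {V : Type} [Fintype V] (y : V → ℕ),
    Fintype.card V = K + 2 → ∑ v, y v = K → ((connectedGraphs y).card : ℝ) = treeCount y := by
  induction K with
  | zero =>
    intro V _ y hcard hsum
    have hy : ∀ v, y v = 0 := by simpa using hsum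
    rw [connectedGraphs_eq_singleton_top hcard hy, treeCount_eq_one hy]
    simp
  | succ K ih =>
    intro V _ y hcard hsum
    obtain ⟨l, hl⟩ := exists_eq_zero_of_sum_lt_card (y := y) (by omega)
    rw [Finset.cast_card, sum_connectedGraphs_eq_sum_addLeaf hl (by omega)]
    calc _ = ∑ p : {v // v ≠ l}, if 0 < y p then treeCount (removeLeaf y p) * 1 else 0 := by
          refine Finset.sum_congr rfl fun p _ => if_ctx_congr Iff.rfl (fun hp => ?_) fun _ => rfl
          rw [← Finset.cast_card, ih _ (card_subtype_ne hcard) (sum_removeLeaf hl hp hsum), mul_one]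
      _ = treeCount y := by
          rw [sum_ite_treeCount_mul hl hsum]
          simp only [mul_one]
          rw [sum_div_eq_one hl hsum, mul_one]

theorem sum_edgeWeight (K : ℕ) : ∀ {V : Type} [Fintype V] (y : V → ℕ) (φ : V → ℝ),
    Fintype.card V = K + 2 → ∑ v, y v = K →
      ∑ T ∈ connectedGraphs y, edgeWeight φ T = treeCount y * meanWeight y φ := by
  induction K with
  | zero =>
    intro V _ y φ hcard hsum
    have hy : ∀ v, y v = 0 := by simpa using hsum
    rw [connectedGraphs_eq_singleton_top hcard hy, treeCount_eq_one hy, Finset.sum_singleton,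
      edgeWeight_top hy, one_mul]
  | succ K ih =>
    intro V _ y φ hcard hsum
    obtain ⟨l, hl⟩ := exists_eq_zero_of_sum_lt_card (y := y) (by omega)
    rw [sum_connectedGraphs_eq_sum_addLeaf hl (by omega), ← sum_mul_meanWeightGiven hl hcard hsum,
      ← sum_ite_treeCount_mul hl hsum]
    refine Finset.sum_congr rfl fun p _ => if_ctx_congr Iff.rfl (fun hp => ?_) fun _ => rfl
    have hcard' := card_subtype_ne (l := l) hcard
    have hsum' := sum_removeLeaf hl hp hsum
    simp only [edgeWeight_addLeaf, Finset.sum_add_distrib, Finset.sum_const, nsmul_eq_mul]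
    rw [ih _ _ hcard' hsum', card_connectedGraphs K _ hcard' hsum', meanWeightGiven, mul_add]

theorem sum_exp_edgeWeight_le (s a b c : ℝ) (K : ℕ) :
    ∀ {V : Type} [Fintype V] (y : V → ℕ) (φ : V → ℝ),
      Fintype.card V = K + 2 → ∑ v, y v = K → (∀ v, φ v ∈ Set.Icc a b) →
      ∑ T ∈ connectedGraphs y, Real.exp (s * edgeWeight φ T)
        ≤ treeCount y * Real.exp (s * meanWeight y φ
          + s ^ 2 / 8 * varianceProxy (b - a) (∑ v, |φ v - c|) K) := by
  induction K with
  | zero =>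
    intro V _ y φ hcard hsum _
    have hy : ∀ v, y v = 0 := by simpa using hsum
    have hD : 0 ≤ ∑ v, |φ v - c| := Finset.sum_nonneg fun v _ => abs_nonneg _
    rw [connectedGraphs_eq_singleton_top hcard hy, treeCount_eq_one hy, Finset.sum_singleton,
      edgeWeight_top hy, one_mul]
    simp [varianceProxy, hD]
  | succ K ih =>
    intro V _ y φ hcard hsum hφ
    obtain ⟨l, hl⟩ := exists_eq_zero_of_sum_lt_card (y := y) (by omega)
    have hab : 0 ≤ b - a := by linarith [(hφ l).1, (hφ l).2]
    have hcount : 0 ≤ treeCount y := by rw [treeCount]; positivity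
    set D := ∑ v, |φ v - c| with hD
    set P := varianceProxy (b - a) (D - |φ l - c|) K with hP
    have hvar := varianceProxy_add_le hab (abs_nonneg (φ l - c))
      (Finset.single_le_sum (f := fun v => |φ v - c|) (fun v _ => abs_nonneg _)
        (Finset.mem_univ l)) K
    rw [← hD, ← hP] at hvar
    set R := (b - a) * min (b - a) (|φ l - c| + D / K) with hR
    rw [sum_connectedGraphs_eq_sum_addLeaf hl (by omega)]
    calc _ ≤ ∑ p : {v // v ≠ l}, if 0 < y p then treeCount (removeLeaf y p)
            * (Real.exp (s * meanWeightGiven y φ p) * Real.exp (s ^ 2 / 8 * P)) else 0 := by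
          refine Finset.sum_le_sum fun p _ => ?_
          split_ifs with hp
          · have h := ih (removeLeaf y p) (fun v => φ v) (card_subtype_ne hcard)
              (sum_removeLeaf hl hp hsum) (fun v => hφ v)
            rw [sum_subtype (fun v => |φ v - c|), ← hD, ← hP] at h
            simp only [edgeWeight_addLeaf, mul_add, Real.exp_add, ← Finset.mul_sum]
            refine (mul_le_mul_of_nonneg_left h (Real.exp_pos _).le).trans_eq ?_
            rw [meanWeightGiven, mul_add, Real.exp_add, Real.exp_add]
            ring
          · exact le_rfl
      _ = treeCount y * ((∑ p : {v // v ≠ l}, (y p / (K + 1) : ℝ)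
            * Real.exp (s * meanWeightGiven y φ p)) * Real.exp (s ^ 2 / 8 * P)) := by
          rw [sum_ite_treeCount_mul hl hsum, Finset.sum_mul]
          simp only [mul_assoc]
      _ ≤ treeCount y * (Real.exp (s * meanWeight y φ + s ^ 2 / 8 * R ^ 2)
            * Real.exp (s ^ 2 / 8 * P)) := by
          gcongr
          rw [← sum_mul_meanWeightGiven hl hcard hsum]
          have hpos : ∀ p : {v // v ≠ l}, 0 < (y p / (K + 1) : ℝ) → 0 < y p := fun p hp => by
            by_contra h
            simp [Nat.eq_zero_of_not_pos h] at hp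
          exact sum_mul_exp_le_of_sub_le _ _ (fun p => by positivity) (sum_div_eq_one hl hsum) R
            (fun p q hp hq =>
              meanWeightGiven_sub_le hl hcard hsum hφ c (hpos p hp) (hpos q hq)) s
      _ ≤ _ := by
          rw [← Real.exp_add, add_assoc, ← mul_add]
          gcongr
          linarith

lemma mem_connectedGraphs_iff_isTree {x : V → ℕ} (hx : ∀ j, 1 ≤ x j)
    (hsum : (∑ j, x j) + 2 = 2 * Fintype.card V) (T : SimpleGraph V) :
    T ∈ connectedGraphs (fun j => x j - 1) ↔ T.IsTree ∧ ∀ j, T.degree j = x j := by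
  have hdeg : (∀ j, T.degree j = x j - 1 + 1) ↔ ∀ j, T.degree j = x j :=
    forall_congr' fun j => by rw [Nat.sub_add_cancel (hx j)]
  rw [mem_connectedGraphs, hdeg, SimpleGraph.isTree_iff_connected_and_card]
  refine and_congr_left fun h => ⟨fun hc => ⟨hc, ?_⟩, fun hc => hc.1⟩
  have hedges := T.sum_degrees_eq_twice_card_edges
  have hx_sum : ∑ j, T.degree j = ∑ j, x j := Finset.sum_congr rfl fun j _ => h j
  rw [Nat.card_eq_fintype_card, Nat.card_eq_fintype_card, ← SimpleGraph.edgeFinset_card]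
  omega

lemma card_filter_lt_le {α : Type} (s : Finset α) (f : α → ℝ) (u : ℝ) :
    ((s.filter fun i => u < f i).card : ℝ) ≤ Real.exp (-u) * ∑ i ∈ s, Real.exp (f i) := by
  rw [Finset.cast_card, Finset.mul_sum]
  calc ∑ i ∈ s.filter fun i => u < f i, (1 : ℝ)
      ≤ ∑ i ∈ s.filter fun i => u < f i, Real.exp (-u) * Real.exp (f i) :=
        Finset.sum_le_sum fun i hi => by
          rw [← Real.exp_add]
          exact Real.one_le_exp (by linarith [(Finset.mem_filter.1 hi).2])
    _ ≤ _ := Finset.sum_le_sum_of_subset_of_nonneg (Finset.filter_subset _ _)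
        fun i _ _ => by positivity

lemma card_filter_lt_abs_sub_le {α : Type} (s : Finset α) (f : α → ℝ) {m L t : ℝ} (hL : 0 ≤ L)
    (ht : 0 < t)
    (hmgf : ∀ r : ℝ, ∑ i ∈ s, Real.exp (r * f i) ≤ s.card * Real.exp (r * m + r ^ 2 / 8 * L)) :
    ((s.filter fun i => t < |f i - m|).card : ℝ) / s.card ≤ 2 * Real.exp (-2 * t ^ 2 / L) := by
  refine div_le_of_le_mul₀ (by positivity) (by positivity) ?_
  rcases hL.eq_or_lt with rfl | hL
  · have : ((s.filter fun i => t < |f i - m|).card : ℝ) ≤ s.card := by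
      exact_mod_cast Finset.card_filter_le _ _
    simp only [div_zero, Real.exp_zero, mul_one]
    linarith [Nat.cast_nonneg (α := ℝ) s.card]
  have htail : ∀ σ : ℝ, σ ^ 2 = 1 → ((s.filter fun i => t < σ * (f i - m)).card : ℝ)
      ≤ s.card * Real.exp (-2 * t ^ 2 / L) := fun σ hσ => by
    set r := 4 * t / L with hr
    have hr0 : 0 < r := by positivity
    calc ((s.filter fun i => t < σ * (f i - m)).card : ℝ)
        = ((s.filter fun i => r * t + r * σ * m < r * σ * f i).card : ℝ) := by
          congr 2
          refine Finset.filter_congr fun i _ => ?_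
          rw [← mul_lt_mul_iff_right₀ hr0]
          constructor <;> intro h <;> linarith
      _ ≤ Real.exp (-(r * t + r * σ * m)) * ∑ i ∈ s, Real.exp (r * σ * f i) :=
          card_filter_lt_le _ _ _
      _ ≤ Real.exp (-(r * t + r * σ * m))
            * (s.card * Real.exp (r * σ * m + (r * σ) ^ 2 / 8 * L)) := by
          gcongr
          exact hmgf _
      _ = s.card * Real.exp (-2 * t ^ 2 / L) := by
          rw [mul_left_comm, ← Real.exp_add, mul_pow, hσ, hr]
          congr 2
          field_simp
          ring
  have hsub : (s.filter fun i => t < |f i - m|)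
      ⊆ (s.filter fun i => t < 1 * (f i - m)) ∪ s.filter fun i => t < -1 * (f i - m) := by
    intro i hi
    simp only [Finset.mem_union, Finset.mem_filter, lt_abs] at hi ⊢
    rcases hi with ⟨hs, h | h⟩
    · exact Or.inl ⟨hs, by linarith⟩
    · exact Or.inr ⟨hs, by linarith⟩
  have hcard : ((s.filter fun i => t < |f i - m|).card : ℝ)
      ≤ (s.filter fun i => t < 1 * (f i - m)).card
        + (s.filter fun i => t < -1 * (f i - m)).card := by
    exact_mod_cast (Finset.card_le_card hsub).trans (Finset.card_union_le _ _)
  linarith [htail 1 (by norm_num), htail (-1) (by norm_num)]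

lemma varianceProxy_le {δ D : ℝ} (hδ : 0 ≤ δ) (hD : 0 ≤ D) (K : ℕ) :
    varianceProxy δ D K
      ≤ δ ^ 3 * min (δ * (K + 2 : ℕ)) (D * (Real.log (K + 2 : ℕ) + 2)) := by
  have hharm : (harmonic (K - 1) : ℝ) ≤ 1 + Real.log (K + 2 : ℕ) := by
    refine (harmonic_le_one_add_log _).trans ?_
    rcases Nat.eq_zero_or_pos (K - 1) with h | h
    · rw [h, Nat.cast_zero, Real.log_zero]
      gcongr
      exact Real.log_natCast_nonneg _
    · gcongr
      omega
  rw [varianceProxy]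
  refine mul_le_mul_of_nonneg_left (min_le_min ?_ ?_) (by positivity)
  · gcongr
    omega
  · exact mul_le_mul_of_nonneg_left (by linarith) hD

lemma sum_exp_edgeWeight_le_iInf {K : ℕ} {y : V → ℕ} {φ : V → ℝ} {a b : ℝ} (hab : a ≤ b)
    (hcard : Fintype.card V = K + 2) (hsum : ∑ v, y v = K) (hφ : ∀ v, φ v ∈ Set.Icc a b)
    (s : ℝ) :
    ∑ T ∈ connectedGraphs y, Real.exp (s * edgeWeight φ T)
      ≤ treeCount y * Real.exp (s * meanWeight y φ + s ^ 2 / 8 * ((b - a) ^ 3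
        * min ((b - a) * (K + 2 : ℕ))
          ((⨅ c : ℝ, ∑ v, |φ v - c|) * (Real.log (K + 2 : ℕ) + 2)))) := by
  have hδ : 0 ≤ b - a := sub_nonneg.2 hab
  have hlog := Real.log_natCast_nonneg (K + 2)
  have hcount : 0 < treeCount y :=
    div_pos (by positivity) (Finset.prod_pos fun v _ => by positivity)
  set Z := ∑ T ∈ connectedGraphs y, Real.exp (s * edgeWeight φ T) with hZ
  rcases (show 0 ≤ Z from Finset.sum_nonneg fun T _ => (Real.exp_pos _).le).eq_or_lt with h0 | h0
  · rw [← h0]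
    positivity
  have hle : ∀ c, Real.log (Z / treeCount y) - s * meanWeight y φ ≤ s ^ 2 / 8 * ((b - a) ^ 3
      * min ((b - a) * (K + 2 : ℕ)) ((∑ v, |φ v - c|) * (Real.log (K + 2 : ℕ) + 2))) := fun c => by
    have hD : 0 ≤ ∑ v, |φ v - c| := Finset.sum_nonneg fun v _ => abs_nonneg _
    have h1 := sum_exp_edgeWeight_le s a b c K y φ hcard hsum hφ
    rw [← hZ, ← div_le_iff₀' hcount, ← Real.log_le_iff_le_exp (by positivity)] at h1
    have h2 := mul_le_mul_of_nonneg_left (varianceProxy_le hδ hD K)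
      (show 0 ≤ s ^ 2 / 8 by positivity)
    linarith
  rw [← div_le_iff₀' hcount, ← Real.log_le_iff_le_exp (by positivity), ← sub_le_iff_le_add']
  rw [mul_min_of_nonneg _ _ (by positivity : 0 ≤ (b - a) ^ 3),
    mul_min_of_nonneg _ _ (by positivity : 0 ≤ s ^ 2 / 8)]
  simp only [mul_min_of_nonneg _ _ (by positivity : 0 ≤ (b - a) ^ 3),
    mul_min_of_nonneg _ _ (by positivity : 0 ≤ s ^ 2 / 8), le_min_iff] at hle
  refine le_min (hle 0).1 ?_
  rw [Real.iInf_mul_of_nonneg (by positivity), Real.mul_iInf_of_nonneg (by positivity),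
    Real.mul_iInf_of_nonneg (by positivity)]
  exact le_ciInf fun c => (hle c).2

end TreeDegree

theorem tree_tail_concentration (n : ℕ) (x : Fin n → ℕ)
    -- `x` is a tree degree sequence
    (hx1 : ∀ j, 1 ≤ x j) (hxsum : (∑ j, x j) + 2 = 2 * n)
    (a b : ℝ) (hab : a ≤ b) (φ : Fin n → ℝ) (hφ : ∀ j, φ j ∈ Set.Icc a b)
    (F : SimpleGraph (Fin n) → ℝ)
    (hF : ∀ T : SimpleGraph (Fin n),
      F T = ∑ e ∈ T.edgeFinset,
        Sym2.lift ⟨fun j k => φ j * φ k, fun j k => by ring⟩ e)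
    (Tx : Finset (SimpleGraph (Fin n)))
    (hTx : Tx = Finset.univ.filter
      (fun T : SimpleGraph (Fin n) => T.IsTree ∧ ∀ j, T.degree j = x j))
    (Fbar normφ L : ℝ)
    (hFbar : Fbar = (∑ T ∈ Tx, F T) / (Tx.card : ℝ))
    (hnorm : normφ = ⨅ c : ℝ, ∑ j, |φ j - c|)
    (hL : L = (b - a) ^ 3 * min ((b - a) * n) (normφ * (Real.log n + 2))) :
    ∀ t : ℝ, 0 < t →
      ((Tx.filter (fun T => t < |F T - Fbar|)).card : ℝ) / (Tx.card : ℝ)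
        ≤ 2 * Real.exp (-2 * t ^ 2 / L) := by
  intro t ht
  obtain ⟨K, rfl⟩ : ∃ K, n = K + 2 := by
    refine ⟨n - 2, ?_⟩
    have : n ≤ ∑ j, x j := by
      simpa using Finset.card_nsmul_le_sum Finset.univ x 1 fun j _ => hx1 j
    omega
  set y : Fin (K + 2) → ℕ := fun j => x j - 1 with hy
  have hcard : Fintype.card (Fin (K + 2)) = K + 2 := Fintype.card_fin _
  have hysum : ∑ j, y j = K := by
    have h : ∑ j, x j = ∑ j, (y j + 1) :=
      Finset.sum_congr rfl fun j _ => (Nat.sub_add_cancel (hx1 j)).symm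
    rw [Finset.sum_add_distrib, Finset.sum_const, Finset.card_univ, hcard, smul_eq_mul] at h
    omega
  have hTxy : Tx = TreeDegree.connectedGraphs y := by
    ext T
    rw [TreeDegree.mem_connectedGraphs_iff_isTree hx1 (by rwa [hcard]), hTx, Finset.mem_filter]
    simp
  obtain rfl : F = TreeDegree.edgeWeight φ := funext fun T => by
    rw [hF, TreeDegree.sum_edgeFinset_eq_edgeWeight]
  have hcount := TreeDegree.card_connectedGraphs K y hcard hysum
  have hpos : 0 < TreeDegree.treeCount y :=
    div_pos (by positivity) (Finset.prod_pos fun v _ => by positivity)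
  have hmean : Fbar = TreeDegree.meanWeight y φ := by
    rw [hFbar, hTxy, TreeDegree.sum_edgeWeight K y φ hcard hysum, hcount,
      mul_div_cancel_left₀ _ hpos.ne']
  have hδ : 0 ≤ b - a := sub_nonneg.2 hab
  have hlog := Real.log_natCast_nonneg (K + 2)
  have hnorm0 : 0 ≤ normφ :=
    hnorm ▸ Real.iInf_nonneg fun c => Finset.sum_nonneg fun j _ => abs_nonneg _
  refine TreeDegree.card_filter_lt_abs_sub_le Tx _ (by rw [hL]; positivity) ht fun r => ?_
  rw [hTxy, hmean, hcount, hL, hnorm]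
  exact TreeDegree.sum_exp_edgeWeight_le_iInf hab hcard hysum hφ r
end

section
/- Let x = (x_1,…,x_n) be a tree degree sequence. Let S be a forest with vertex set {1,…,n} and degree sequence (s_1,…,s_n) with s_j ≤ x_j for all j, and suppose S is disconnected with components S_1,…,S_r (r ≥ 2; isolated vertices count as components). Then the probability that a uniformly random tree with degree sequence x contains every edge of S equals ( ∏_{i=1}^r Σ_{j∈V(S_i)} (x_j − s_j) ) / (n−2)_{n−r} · ∏_{j=1}^n (x_j−1)_{s_j−1}, where by convention (x_j−1)_{s_j−1} is interpreted as 1/x_j when s_j = 0. -/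
attribute [local instance] Classical.propDecidable

open Finset

namespace SimpleGraph

variable {V ι : Type*} {S T : SimpleGraph V} {f : V → ι} {u v : V}

/-- The fibres of `f` are exactly the connected components of `S`. -/
def LabelsComponents (S : SimpleGraph V) (f : V → ι) : Prop :=
  ∀ a b, f a = f b ↔ S.Reachable a b

/-- Relabelling that identifies the label of `v` with the label of `u`. -/
noncomputable def mergeLabel (f : V → ι) (u v : V) (w : V) : ι :=
  if f w = f v then f u else f w

lemma LabelsComponents.sup_edge (hf : S.LabelsComponents f) (huv : f u ≠ f v) :
    (S ⊔ edge u v).LabelsComponents (mergeLabel f u v) := by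
  have hne : u ≠ v := fun h => huv (by rw [h])
  have hS : ∀ {a b}, f a = f b → (S ⊔ edge u v).Reachable a b := fun h =>
    ((hf _ _).1 h).mono le_sup_left
  have he : (S ⊔ edge u v).Reachable u v :=
    Adj.reachable (by simp [edge_adj, hne])
  intro a b
  constructor
  · intro h
    unfold mergeLabel at h
    split_ifs at h with h1 h2 h2
    · exact hS (h1.trans h2.symm)
    · exact ((hS h1).trans he.symm).trans (hS h)
    · exact (hS h).trans (he.trans (hS h2.symm))
    · exact hS h
  · rintro ⟨p⟩
    induction p with
    | nil => rfl
    | cons hadj p ih =>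
      refine Eq.trans ?_ ih
      rw [sup_adj, edge_adj] at hadj
      rcases hadj with h | ⟨⟨rfl, rfl⟩ | ⟨rfl, rfl⟩, -⟩
      · simp [mergeLabel, (hf _ _).2 h.reachable]
      · simp [mergeLabel]
      · simp [mergeLabel]

lemma image_mergeLabel [Fintype V] (huv : f u ≠ f v) :
    univ.image (mergeLabel f u v) = (univ.image f).erase (f v) := by
  ext c
  simp only [mem_image, mem_univ, true_and, mem_erase, mergeLabel]
  constructor
  · rintro ⟨w, rfl⟩
    split_ifs with h
    · exact ⟨huv, u, rfl⟩
    · exact ⟨h, w, rfl⟩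
  · rintro ⟨h, w, rfl⟩
    exact ⟨w, if_neg h⟩

lemma degree_sup_edge [Fintype V] (hne : u ≠ v) (hadj : ¬ S.Adj u v) (w : V)
    [Fintype ((S ⊔ edge u v).neighborSet w)] :
    (S ⊔ edge u v).degree w =
      S.degree w + ((if w = u then 1 else 0) + if w = v then 1 else 0) := by
  have hadj' : ¬ S.Adj v u := fun h => hadj h.symm
  simp only [← card_neighborFinset_eq_degree]
  by_cases h1 : w = u
  · subst h1
    have : (S ⊔ edge w v).neighborFinset w = insert v (S.neighborFinset w) := by
      ext a; simp only [mem_neighborFinset, sup_adj, edge_adj, mem_insert]; grind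
    rw [this, card_insert_of_notMem (by simpa)]; simp [hne]
  by_cases h2 : w = v
  · subst h2
    have : (S ⊔ edge u w).neighborFinset w = insert u (S.neighborFinset w) := by
      ext a; simp only [mem_neighborFinset, sup_adj, edge_adj, mem_insert]; grind
    rw [this, card_insert_of_notMem (by simpa)]; simp [h1]
  have : (S ⊔ edge u v).neighborFinset w = S.neighborFinset w := by
    ext a; simp only [mem_neighborFinset, sup_adj, edge_adj]; grind
  rw [this]; simp [h1, h2]

lemma LabelsComponents.not_adj (hf : S.LabelsComponents f) (huv : f u ≠ f v) : ¬ S.Adj u v :=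
  fun h => huv ((hf _ _).2 h.reachable)

lemma LabelsComponents.connected [Fintype V] (hf : S.LabelsComponents f)
    (h : #(univ.image f) = 1) : S.Connected := by
  obtain ⟨c, hc⟩ := card_eq_one.1 h
  have hfc : ∀ w, f w = c := fun w => by
    rw [← mem_singleton, ← hc]; exact mem_image_of_mem _ (mem_univ _)
  have : Nonempty V := by
    have : c ∈ univ.image f := by simp [hc]
    obtain ⟨w, -⟩ := mem_image.1 this
    exact ⟨w⟩
  exact ⟨fun a b => (hf a b).1 ((hfc a).trans (hfc b).symm)⟩

lemma IsTree.sum_degree_add_two [Fintype V] (hT : T.IsTree) :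
    ∑ w, T.degree w + 2 = 2 * Fintype.card V := by
  rw [sum_degrees_eq_twice_card_edges, ← hT.card_edgeFinset]; ring

/-- In a forest the number of edges is the number of vertices minus the number of components. -/
lemma IsAcyclic.sum_degree_add_card_image [Fintype V] [Nonempty V] (hS : S.IsAcyclic)
    (hf : S.LabelsComponents f) :
    ∑ w, S.degree w + 2 * #(univ.image f) = 2 * Fintype.card V := by
  obtain ⟨k, hk⟩ : ∃ k, #(univ.image f) = k + 1 :=
    ⟨_, (Nat.succ_pred_eq_of_pos (card_pos.2 (univ_nonempty.image f))).symm⟩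
  induction k generalizing S f with
  | zero =>
    rw [hk]
    exact IsTree.sum_degree_add_two ⟨hf.connected hk, hS⟩
  | succ k ih =>
    obtain ⟨c, hc, d, hd, hcd⟩ := one_lt_card.1 (by omega : 1 < #(univ.image f))
    obtain ⟨u, -, rfl⟩ := mem_image.1 hc
    obtain ⟨v, -, rfl⟩ := mem_image.1 hd
    have hcard : #(univ.image (mergeLabel f u v)) = k + 1 := by
      rw [image_mergeLabel hcd, card_erase_of_mem hd, hk]; rfl
    have := ih (hS.sup_edge_of_not_reachable fun h => hcd ((hf _ _).2 h)) (hf.sup_edge hcd) hcard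
    simp only [degree_sup_edge (fun h => hcd (by rw [h])) (hf.not_adj hcd), sum_add_distrib,
      sum_ite_eq', mem_univ, if_true] at this
    omega

/-- The trees with degree sequence `x` that contain `S`. -/
noncomputable def treesAbove [Fintype V] (S : SimpleGraph V) (x : V → ℕ) :
    Finset (SimpleGraph V) :=
  univ.filter fun T => (T.IsTree ∧ ∀ w, T.degree w = x w) ∧ S ≤ T

lemma mem_treesAbove [Fintype V] {x : V → ℕ} :
    T ∈ treesAbove S x ↔ (T.IsTree ∧ ∀ w, T.degree w = x w) ∧ S ≤ T := by
  simp [treesAbove]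

lemma eq_of_le_of_degree_eq [Fintype V] (hle : S ≤ T) (h : ∀ w, S.degree w = T.degree w) :
    S = T := by
  refine le_antisymm hle fun a b hab => ?_
  have : S.neighborFinset a = T.neighborFinset a :=
    eq_of_subset_of_card_le (fun b => by simpa using @hle a b) (by simp [h])
  rw [← mem_neighborFinset, this]; simpa

lemma Connected.treesAbove_eq [Fintype V] {x : V → ℕ} (hS : S.Connected)
    (hdeg : ∀ w, S.degree w = x w) (hx : ∑ w, x w + 2 = 2 * Fintype.card V) :
    treesAbove S x = {S} := by
  ext T
  rw [mem_treesAbove, mem_singleton]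
  constructor
  · rintro ⟨⟨-, hT⟩, hle⟩
    exact (eq_of_le_of_degree_eq hle fun w => by rw [hdeg, hT]).symm
  · rintro rfl
    refine ⟨⟨isTree_iff_connected_and_card.2 ⟨hS, ?_⟩, hdeg⟩, le_rfl⟩
    have := T.sum_degrees_eq_twice_card_edges
    simp only [hdeg] at this
    rw [Nat.card_eq_fintype_card, ← edgeFinset_card, Nat.card_eq_fintype_card]
    omega

/-- A pair of adjacent vertices of a tree `T ⊇ S` lies in different components of `S`
exactly when it is not an edge of `S`. -/
lemma LabelsComponents.sup_edge_le_iff (hf : S.LabelsComponents f) (hT : T.IsAcyclic)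
    (hle : S ≤ T) : (f u ≠ f v ∧ S ⊔ edge u v ≤ T) ↔ T.Adj u v ∧ ¬ S.Adj u v := by
  rw [sup_le_iff, edge_le_iff]
  constructor
  · rintro ⟨h, -, rfl | h2⟩
    · exact absurd rfl h
    · exact ⟨h2, hf.not_adj h⟩
  · rintro ⟨h, hn⟩
    refine ⟨fun he => ?_, hle, .inr h⟩
    refine isBridge_iff.1 (isAcyclic_iff_forall_adj_isBridge.1 hT h) (((hf _ _).1 he).mono ?_)
    intro a b hab
    rw [deleteEdges_adj]
    refine ⟨hle hab, fun hm => hn ?_⟩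
    rwa [← mem_edgeSet, ← (Set.mem_singleton_iff.1 hm : s(a, b) = s(u, v)), mem_edgeSet]

lemma card_adj_and_not_adj [Fintype V] {m : V → ℕ} (hle : S ≤ T)
    (hm : ∀ w, S.degree w + m w = T.degree w) :
    #(univ.filter fun p : V × V => T.Adj p.1 p.2 ∧ ¬ S.Adj p.1 p.2) = ∑ w, m w := by
  rw [card_filter, Fintype.sum_prod_type]
  refine sum_congr rfl fun w _ => ?_
  rw [← card_filter]
  have : (univ.filter fun b => T.Adj w b ∧ ¬ S.Adj w b) =
      T.neighborFinset w \ S.neighborFinset w := by ext; simp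
  rw [this, card_sdiff_of_subset (fun b => by simpa using @hle w b)]
  simp [← hm]

/-- Double counting of pairs (tree above `S`, oriented edge of the tree outside `S`). -/
lemma LabelsComponents.sum_mul_card_treesAbove [Fintype V] {x m : V → ℕ}
    (hf : S.LabelsComponents f) (hm : ∀ w, S.degree w + m w = x w) :
    (∑ w, m w) * #(treesAbove S x) =
      ∑ p : V × V with f p.1 ≠ f p.2, #(treesAbove (S ⊔ edge p.1 p.2) x) := by
  have hcount : ∀ T ∈ treesAbove S x,
      #(univ.filter fun p : V × V => f p.1 ≠ f p.2 ∧ S ⊔ edge p.1 p.2 ≤ T) = ∑ w, m w := by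
    intro T hT
    obtain ⟨⟨hT, hdeg⟩, hle⟩ := mem_treesAbove.1 hT
    rw [← card_adj_and_not_adj hle fun w => (hm w).trans (hdeg w).symm]
    simp only [hf.sup_edge_le_iff hT.isAcyclic hle]
  rw [mul_comm, ← smul_eq_mul, ← sum_const, ← sum_congr rfl hcount]
  simp only [card_filter]
  rw [sum_comm, sum_filter]
  refine sum_congr rfl fun p _ => ?_
  rw [← card_filter]
  split_ifs with h
  · congr 1
    ext T
    have : S ⊔ edge p.1 p.2 ≤ T → S ≤ T := le_sup_left.trans
    simp only [mem_filter, mem_treesAbove]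
    tauto
  · simp [h]

/-- The total weight of the vertices with label `c`. -/
noncomputable def labelWeight [Fintype V] (f : V → ι) (m : V → ℕ) (c : ι) : ℝ :=
  ∑ w with f w = c, (m w : ℝ)

lemma sum_labelWeight [Fintype V] (m : V → ℕ) :
    ∑ c ∈ univ.image f, labelWeight f m c = ∑ w, (m w : ℝ) :=
  sum_fiberwise_of_maps_to (fun _ _ => mem_image_of_mem _ (mem_univ _)) _

/-- Summing a function of labels over weighted pairs of vertices with distinct labels. -/
lemma sum_pairs_eq_sum_offDiag [Fintype V] (m : V → ℕ) (W : ι → ι → ℝ) :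
    ∑ p : V × V with f p.1 ≠ f p.2, (m p.1 : ℝ) * m p.2 * W (f p.1) (f p.2) =
      ∑ q ∈ (univ.image f).offDiag,
        labelWeight f m q.1 * labelWeight f m q.2 * W q.1 q.2 := by
  rw [← sum_fiberwise_of_maps_to (t := (univ.image f).offDiag)
    (g := fun p : V × V => (f p.1, f p.2)) (by simp)]
  refine sum_congr rfl fun q hq => ?_
  have hset : (univ.filter fun p : V × V => f p.1 ≠ f p.2).filter
      (fun p => (f p.1, f p.2) = q) =
      (univ.filter fun w => f w = q.1) ×ˢ (univ.filter fun w => f w = q.2) := by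
    have := (mem_offDiag.1 hq).2.2
    ext p
    simp only [mem_filter, mem_univ, true_and, mem_product, Prod.ext_iff]
    grind
  rw [hset, sum_product, labelWeight, labelWeight, sum_mul_sum, sum_mul]
  refine sum_congr rfl fun a ha => ?_
  rw [sum_mul]
  refine sum_congr rfl fun b hb => ?_
  rw [(mem_filter.1 ha).2, (mem_filter.1 hb).2]

lemma labelWeight_mergeLabel_self [Fintype V] {m m' : V → ℕ} (huv : f u ≠ f v)
    (hm : ∀ w, m w = m' w + ((if w = u then 1 else 0) + if w = v then 1 else 0)) :
    labelWeight (mergeLabel f u v) m' (f u) =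
      labelWeight f m (f u) + labelWeight f m (f v) - 2 := by
  have hset : (univ.filter fun w => mergeLabel f u v w = f u) =
      (univ.filter fun w => f w = f u).disjUnion (univ.filter fun w => f w = f v)
        (disjoint_filter.2 fun w _ h h' => huv (h.symm.trans h')) := by
    ext w
    simp only [mem_filter, mem_univ, true_and, mem_disjUnion, mergeLabel]
    grind
  have hne : u ≠ v := fun h => huv (by rw [h])
  simp only [labelWeight]
  rw [hset, sum_disjUnion]
  simp only [hm, Nat.cast_add, sum_add_distrib, Nat.cast_ite, Nat.cast_one, Nat.cast_zero,
    sum_ite_eq', mem_filter, mem_univ, true_and, huv, huv.symm, if_true, if_false]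
  ring

lemma labelWeight_mergeLabel_of_ne [Fintype V] {m m' : V → ℕ} {c : ι} (hu : c ≠ f u) (hv : c ≠ f v)
    (hm : ∀ w, m w = m' w + ((if w = u then 1 else 0) + if w = v then 1 else 0)) :
    labelWeight (mergeLabel f u v) m' c = labelWeight f m c := by
  have hset : (univ.filter fun w => mergeLabel f u v w = c) = univ.filter fun w => f w = c := by
    ext w
    simp only [mem_filter, mem_univ, true_and, mergeLabel]
    grind
  rw [labelWeight, labelWeight, hset]
  refine sum_congr rfl fun w hw => ?_
  have := (mem_filter.1 hw).2
  rw [hm, if_neg (by grind), if_neg (by grind)]; rfl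

lemma prod_labelWeight_mergeLabel [Fintype V] {m m' : V → ℕ} (huv : f u ≠ f v)
    (hm : ∀ w, m w = m' w + ((if w = u then 1 else 0) + if w = v then 1 else 0)) :
    ∏ c ∈ univ.image (mergeLabel f u v), labelWeight (mergeLabel f u v) m' c =
      (labelWeight f m (f u) + labelWeight f m (f v) - 2) *
        ∏ c ∈ ((univ.image f).erase (f v)).erase (f u), labelWeight f m c := by
  have hu : f u ∈ (univ.image f).erase (f v) := by simp [huv]
  rw [image_mergeLabel huv, ← mul_prod_erase _ _ hu, labelWeight_mergeLabel_self huv hm]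
  congr 1
  refine prod_congr rfl fun c hc => ?_
  simp only [mem_erase] at hc
  exact labelWeight_mergeLabel_of_ne hc.1 hc.2.1 hm

lemma prod_factorial_of_eq_add [Fintype V] {m m' : V → ℕ} (hne : u ≠ v)
    (hm : ∀ w, m w = m' w + ((if w = u then 1 else 0) + if w = v then 1 else 0)) :
    ∏ w, (m w).factorial = m u * m v * ∏ w, (m' w).factorial := by
  have h : ∀ w, (m w).factorial =
      ((if w = u then m u else 1) * if w = v then m v else 1) * (m' w).factorial := by
    intro w
    by_cases h1 : w = u
    · subst h1
      have : m w = m' w + 1 := by simpa [hne] using hm w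
      simp [hne, this, Nat.factorial_succ]
    by_cases h2 : w = v
    · subst h2
      have : m w = m' w + 1 := by simpa [h1] using hm w
      simp [h1, this, Nat.factorial_succ]
    simp [h1, h2, hm w]
  simp only [h, prod_mul_distrib, prod_ite_eq', mem_univ, if_true]

/-- The value of `#(treesAbove S x) * ∏ (m w)!` when `S` has `k + 1` components and residual
degrees `m`. -/
noncomputable def treeCountValue [Fintype V] (f : V → ι) (m : V → ℕ) : ℕ → ℝ
  | 0 => 1
  | k + 1 => k.factorial * ∏ c ∈ univ.image f, labelWeight f m c

/-- The coefficient contributed to `treeCountValue` by merging the components `c` and `d`. -/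
noncomputable def mergeCoeff (A : ι → ℝ) (c d : ι) : ℕ → ℝ
  | 0 => 1
  | k + 1 => k.factorial * (A c + A d - 2)

lemma treeCountValue_mergeLabel [Fintype V] {m m' : V → ℕ} {k : ℕ} (huv : f u ≠ f v)
    (hcard : #(univ.image f) = k + 2)
    (hm : ∀ w, m w = m' w + ((if w = u then 1 else 0) + if w = v then 1 else 0)) :
    treeCountValue (mergeLabel f u v) m' k = mergeCoeff (labelWeight f m) (f u) (f v) k *
      ∏ c ∈ ((univ.image f).erase (f v)).erase (f u), labelWeight f m c := by
  cases k with
  | zero =>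
    have : ((univ.image f).erase (f v)).erase (f u) = ∅ := by
      rw [← card_eq_zero, card_erase_of_mem (by simp [huv]), card_erase_of_mem (by simp), hcard]
    simp [treeCountValue, mergeCoeff, this]
  | succ k =>
    rw [treeCountValue, prod_labelWeight_mergeLabel huv hm, mergeCoeff, mul_assoc]

lemma sum_offDiag_fst (C : Finset ι) (A : ι → ℝ) :
    ∑ q ∈ C.offDiag, A q.1 = (#C - 1) * ∑ c ∈ C, A c := by
  have h := sum_union (f := fun q : ι × ι => A q.1) C.disjoint_diag_offDiag
  rw [diag_union_offDiag, sum_product, sum_diag] at h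
  simp only [sum_const, nsmul_eq_mul, ← mul_sum] at h
  linarith

lemma sum_offDiag_snd (C : Finset ι) (A : ι → ℝ) :
    ∑ q ∈ C.offDiag, A q.2 = (#C - 1) * ∑ c ∈ C, A c := by
  have h := sum_union (f := fun q : ι × ι => A q.2) C.disjoint_diag_offDiag
  rw [diag_union_offDiag, sum_product, sum_diag] at h
  simp only [sum_const, nsmul_eq_mul] at h
  linarith

lemma sum_mergeCoeff {C : Finset ι} {A : ι → ℝ} {k : ℕ} (hC : #C = k + 2)
    (hA : ∑ c ∈ C, A c = 2 * (k + 1)) :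
    ∑ q ∈ C.offDiag, mergeCoeff A q.1 q.2 k = 2 * (k + 1) * k.factorial := by
  have hoff : (#C.offDiag : ℝ) = (k + 2) * (k + 1) := by
    have : #C.offDiag = (k + 2) * (k + 1) := by
      rw [offDiag_card, hC, ← Nat.mul_sub_one]; rfl
    rw [this]; push_cast; ring
  cases k with
  | zero => simp [mergeCoeff, hoff, -offDiag_card]
  | succ k =>
    simp only [mergeCoeff, ← mul_sum, sum_sub_distrib, sum_add_distrib, sum_offDiag_fst,
      sum_offDiag_snd, hA, hC, sum_const, nsmul_eq_mul, hoff, Nat.factorial_succ]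
    push_cast
    ring

lemma sum_pairs_treeCountValue [Fintype V] {m : V → ℕ} {k : ℕ}
    (hcard : #(univ.image f) = k + 2) (hsum : ∑ w, m w = 2 * (k + 1)) :
    ∑ p : V × V with f p.1 ≠ f p.2, (m p.1 : ℝ) * m p.2 *
      (mergeCoeff (labelWeight f m) (f p.1) (f p.2) k *
        ∏ c ∈ ((univ.image f).erase (f p.2)).erase (f p.1), labelWeight f m c) =
      2 * (k + 1) * treeCountValue f m (k + 1) := by
  rw [sum_pairs_eq_sum_offDiag m fun c d => mergeCoeff (labelWeight f m) c d k *
        ∏ c ∈ ((univ.image f).erase d).erase c, labelWeight f m c]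
  have hterm : ∀ q ∈ (univ.image f).offDiag,
      labelWeight f m q.1 * labelWeight f m q.2 * (mergeCoeff (labelWeight f m) q.1 q.2 k *
        ∏ c ∈ ((univ.image f).erase q.2).erase q.1, labelWeight f m c) =
      mergeCoeff (labelWeight f m) q.1 q.2 k * ∏ c ∈ univ.image f, labelWeight f m c := by
    intro q hq
    obtain ⟨h1, h2, hne⟩ := mem_offDiag.1 hq
    rw [← mul_prod_erase _ _ h2, ← mul_prod_erase _ _ (mem_erase.2 ⟨hne, h1⟩)]
    ring
  rw [sum_congr rfl hterm, ← sum_mul, sum_mergeCoeff hcard, treeCountValue]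
  · ring
  · rw [sum_labelWeight]
    exact_mod_cast hsum

lemma treesAbove_eq_empty [Fintype V] {x : V → ℕ} {w : V} (h : x w < S.degree w) :
    treesAbove S x = ∅ := by
  refine eq_empty_of_forall_notMem fun T hT => ?_
  obtain ⟨⟨-, hdeg⟩, hle⟩ := mem_treesAbove.1 hT
  have := degree_le_of_le (v := w) hle
  rw [hdeg] at this
  omega

/-- The number of trees with a given degree sequence that contain a given spanning forest. -/
theorem LabelsComponents.card_treesAbove_mul [Fintype V] {x m : V → ℕ} {k : ℕ}
    (hf : S.LabelsComponents f) (hcard : #(univ.image f) = k + 1)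
    (hm : ∀ w, S.degree w + m w = x w) (hsum : ∑ w, m w = 2 * k)
    (hx : ∑ w, x w + 2 = 2 * Fintype.card V) :
    (#(treesAbove S x) : ℝ) * ∏ w, ((m w).factorial : ℝ) = treeCountValue f m k := by
  induction k generalizing S f m with
  | zero =>
    have hm0 : ∀ w, m w = 0 := by simpa using hsum
    rw [(hf.connected hcard).treesAbove_eq (fun w => by simpa [hm0] using hm w) hx]
    simp [hm0, treeCountValue]
  | succ k ih =>
    have hterm : ∀ p ∈ univ.filter fun p : V × V => f p.1 ≠ f p.2,
        (#(treesAbove (S ⊔ edge p.1 p.2) x) : ℝ) * ∏ w, ((m w).factorial : ℝ) =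
        (m p.1 : ℝ) * m p.2 * (mergeCoeff (labelWeight f m) (f p.1) (f p.2) k *
          ∏ c ∈ ((univ.image f).erase (f p.2)).erase (f p.1), labelWeight f m c) := by
      rintro ⟨u, v⟩ hp
      have huv : f u ≠ f v := (mem_filter.1 hp).2
      have hne : u ≠ v := fun h => huv (by rw [h])
      dsimp only
      by_cases hu : m u = 0
      · rw [treesAbove_eq_empty (w := u) (by
          have := hm u; rw [degree_sup_edge hne (hf.not_adj huv)]; simp [hne]; omega)]
        simp [hu]
      by_cases hv : m v = 0
      · rw [treesAbove_eq_empty (w := v) (by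
          have := hm v; rw [degree_sup_edge hne (hf.not_adj huv)]; simp [hne.symm]; omega)]
        simp [hv]
      obtain ⟨m', hm'⟩ : ∃ m' : V → ℕ, ∀ w,
          m w = m' w + ((if w = u then 1 else 0) + if w = v then 1 else 0) := by
        refine ⟨fun w => m w - ((if w = u then 1 else 0) + if w = v then 1 else 0), fun w => ?_⟩
        by_cases h1 : w = u
        · subst h1; simp [hne]; omega
        by_cases h2 : w = v
        · subst h2; simp [h1]; omega
        simp [h1, h2]
      have hcard' : #(univ.image (mergeLabel f u v)) = k + 1 := by
        rw [image_mergeLabel huv, card_erase_of_mem (by simp), hcard]; rfl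
      have hsum' : ∑ w, m' w = 2 * k := by
        simp only [hm', sum_add_distrib, sum_ite_eq', mem_univ, if_true] at hsum
        omega
      have := ih (m := m') (hf.sup_edge huv) hcard'
        (fun w => by rw [degree_sup_edge hne (hf.not_adj huv), ← hm w, hm' w]; ring) hsum'
      rw [← treeCountValue_mergeLabel huv hcard hm', ← this]
      have hfac := prod_factorial_of_eq_add hne hm'
      have hfac' : ∏ w, ((m w).factorial : ℝ) = m u * m v * ∏ w, ((m' w).factorial : ℝ) := by
        exact_mod_cast hfac
      rw [hfac']
      ring
    have hdouble : (2 * (k + 1) : ℝ) * #(treesAbove S x) =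
        ∑ p : V × V with f p.1 ≠ f p.2, (#(treesAbove (S ⊔ edge p.1 p.2) x) : ℝ) := by
      have := hf.sum_mul_card_treesAbove hm
      rw [hsum] at this
      exact_mod_cast this
    have hk : (2 * (k + 1) : ℝ) ≠ 0 := by positivity
    apply mul_left_cancel₀ hk
    rw [← sum_pairs_treeCountValue hcard hsum, ← mul_assoc, hdouble, sum_mul,
      sum_congr rfl hterm]

lemma labelsComponents_connectedComponentMk (S : SimpleGraph V) :
    S.LabelsComponents S.connectedComponentMk := fun _ _ => ConnectedComponent.eq

/-- Closed form for the number of trees above a disconnected forest. -/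
theorem IsAcyclic.card_treesAbove_mul [Fintype V] [Nonempty V] [Fintype S.ConnectedComponent]
    {x : V → ℕ} (hS : S.IsAcyclic) (hr : 2 ≤ Nat.card S.ConnectedComponent)
    (hsx : ∀ w, S.degree w ≤ x w) (hx : ∑ w, x w + 2 = 2 * Fintype.card V) :
    (#(treesAbove S x) : ℝ) * ∏ w, ((x w - S.degree w).factorial : ℝ) =
      (Nat.card S.ConnectedComponent - 2).factorial * ∏ c : S.ConnectedComponent,
        ∑ w with S.connectedComponentMk w = c, ((x w - S.degree w : ℕ) : ℝ) := by
  obtain ⟨k, hk⟩ := Nat.exists_eq_add_of_le' hr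
  have hf := labelsComponents_connectedComponentMk S
  have himage : univ.image S.connectedComponentMk = univ :=
    image_univ_of_surjective Quot.mk_surjective
  have hcard : #(univ.image S.connectedComponentMk) = k + 2 := by
    rw [himage, card_univ, ← Nat.card_eq_fintype_card, hk]
  have hsum : ∑ w, (x w - S.degree w) = 2 * (k + 1) := by
    have h1 := hS.sum_degree_add_card_image hf
    have h2 : ∑ w, x w = ∑ w, (x w - S.degree w) + ∑ w, S.degree w := by
      rw [← sum_add_distrib]
      exact sum_congr rfl fun w _ => (Nat.sub_add_cancel (hsx w)).symm
    rw [hcard] at h1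
    omega
  have := hf.card_treesAbove_mul hcard (fun w => Nat.add_sub_of_le (hsx w)) hsum hx
  rw [this, treeCountValue, himage, hk]
  rfl

/-- The number of trees with a given degree sequence. -/
theorem card_treesAbove_bot_mul [Fintype V] {x : V → ℕ} (hV : 2 ≤ Fintype.card V)
    (hx : ∑ w, x w + 2 = 2 * Fintype.card V) :
    (#(treesAbove ⊥ x) : ℝ) * ∏ w, ((x w).factorial : ℝ) =
      (Fintype.card V - 2).factorial * ∏ w, (x w : ℝ) := by
  obtain ⟨k, hk⟩ := Nat.exists_eq_add_of_le' hV
  have hf : (⊥ : SimpleGraph V).LabelsComponents id := by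
    intro a b
    simp
  have := hf.card_treesAbove_mul (x := x) (m := x) (k := k + 1) (by simp [hk])
    (fun w => by simp) (by omega) hx
  rw [this, treeCountValue, hk]
  simp [labelWeight, sum_filter]

end SimpleGraph

lemma Nat.factorial_eq_mul_descFactorial_pred {a s : ℕ} (ha : 1 ≤ a) (hs : s ≤ a) :
    (a.factorial : ℝ) = (a - s).factorial * (a * if s = 0 then (a : ℝ)⁻¹
      else ((a - 1).descFactorial (s - 1) : ℝ)) := by
  split_ifs with h
  · have : (a : ℝ) ≠ 0 := by positivity
    simp [h, this]
  · have h1 := Nat.mul_factorial_pred (by omega : a ≠ 0)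
    have h2 := Nat.factorial_mul_descFactorial (by omega : s - 1 ≤ a - 1)
    rw [show a - 1 - (s - 1) = a - s by omega] at h2
    rw [← h1, ← h2]
    push_cast
    ring

open SimpleGraph in
theorem tree_contains_forest_probability (n : ℕ) (x : Fin n → ℕ)
    -- `x` is a tree degree sequence
    (hx1 : ∀ j, 1 ≤ x j) (hxsum : (∑ j, x j) + 2 = 2 * n)
    -- `S` is a disconnected forest on `{1,…,n}` with degrees `s j ≤ x j`
    (S : SimpleGraph (Fin n)) (hSforest : S.IsAcyclic) (hSdisc : ¬ S.Connected)
    (hsx : ∀ j, S.degree j ≤ x j)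
    (r : ℕ) (hr : r = Nat.card S.ConnectedComponent)
    (Tx : Finset (SimpleGraph (Fin n)))
    (hTx : Tx = Finset.univ.filter
      (fun T : SimpleGraph (Fin n) => T.IsTree ∧ ∀ j, T.degree j = x j)) :
    ((Tx.filter (fun T => S ≤ T)).card : ℝ) / (Tx.card : ℝ)
      = (∏ c : S.ConnectedComponent,
            ∑ j ∈ Finset.univ.filter (fun j => S.connectedComponentMk j = c),
              ((x j - S.degree j : ℕ) : ℝ)) /
          (Nat.descFactorial (n - 2) (n - r) : ℝ) *
        ∏ j, (if S.degree j = 0 then ((x j : ℝ))⁻¹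
              else (Nat.descFactorial (x j - 1) (S.degree j - 1) : ℝ)) := by
  have hn : 2 ≤ n := by
    have : n ≤ ∑ j, x j := by simpa using Finset.sum_le_sum fun j (_ : j ∈ Finset.univ) => hx1 j
    omega
  have : Nonempty (Fin n) := ⟨⟨0, by omega⟩⟩
  have hr2 : 2 ≤ r := by
    by_contra hlt
    refine hSdisc ⟨fun a b => ?_⟩
    have : Subsingleton S.ConnectedComponent :=
      Finite.card_le_one_iff_subsingleton.1 (by omega)
    exact ConnectedComponent.eq.1 (Subsingleton.elim _ _)
  have hrn : r ≤ n := by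
    rw [hr]
    simpa using Nat.card_le_card_of_surjective S.connectedComponentMk Quot.mk_surjective
  have hx : ∑ j, x j + 2 = 2 * Fintype.card (Fin n) := by simpa using hxsum
  have hA := hSforest.card_treesAbove_mul (hr ▸ hr2) hsx hx
  have hB := card_treesAbove_bot_mul (by simpa using hn) hx
  rw [← hr] at hA
  rw [Fintype.card_fin] at hB
  have hTA : Tx.filter (fun T => S ≤ T) = treesAbove S x := by
    ext T
    simp [hTx, mem_treesAbove]
  have hTB : Tx = treesAbove ⊥ x := by
    ext T
    simp [hTx, mem_treesAbove]
  rw [hTA, hTB]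
  have hfac : ((n - 2).factorial : ℝ) = (r - 2).factorial * (n - 2).descFactorial (n - r) := by
    have := Nat.factorial_mul_descFactorial (by omega : n - r ≤ n - 2)
    rw [show n - 2 - (n - r) = r - 2 by omega] at this
    exact_mod_cast this.symm
  have hprod := Finset.prod_congr rfl fun j (_ : j ∈ Finset.univ) =>
    Nat.factorial_eq_mul_descFactorial_pred (hx1 j) (hsx j)
  rw [Finset.prod_mul_distrib, Finset.prod_mul_distrib] at hprod
  have hm0 : (∏ j, ((x j - S.degree j).factorial : ℝ)) ≠ 0 :=
    Finset.prod_ne_zero_iff.2 fun j _ => by positivity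
  have hx0 : (∏ j, (x j : ℝ)) ≠ 0 :=
    Finset.prod_ne_zero_iff.2 fun j _ => by have := hx1 j; positivity
  have hr0 : ((r - 2).factorial : ℝ) ≠ 0 := by positivity
  have hn0 : ((n - 2).factorial : ℝ) ≠ 0 := by positivity
  have hd0 : ((n - 2).descFactorial (n - r) : ℝ) ≠ 0 := right_ne_zero_of_mul (hfac ▸ hn0)
  have hB0 : (#(treesAbove ⊥ x) : ℝ) ≠ 0 :=
    left_ne_zero_of_mul (hB ▸ mul_ne_zero hn0 hx0)
  rw [hprod, hfac] at hB
  rw [div_mul_eq_mul_div, div_eq_div_iff hB0 hd0]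
  refine mul_left_cancel₀ (mul_ne_zero (mul_ne_zero hm0 hr0) hx0) ?_
  linear_combination ((n - 2).descFactorial (n - r) : ℝ) * (r - 2).factorial *
    (∏ j, (x j : ℝ)) * hA - (r - 2).factorial * (∏ c : S.ConnectedComponent,
      ∑ j with S.connectedComponentMk j = c, ((x j - S.degree j : ℕ) : ℝ)) * hB
end

section
/- Let n ≥ 3 and let x = (x_1,…,x_n) be a tree degree sequence. For any distinct j, k ∈ {1,…,n}, the proportion of trees on {1,…,n} with degree sequence x in which vertices j and k are adjacent equals (x_j + x_k − 2)/(n − 2). -/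
attribute [local instance] Classical.propDecidable

universe u

namespace SimpleGraph

variable {V : Type*} {v : V}

/-- Attach the vertex `v` as a leaf with neighbour `i` to a graph on the other vertices. -/
def attachLeaf (v : V) (i : ({v}ᶜ : Set V)) (S : SimpleGraph ({v}ᶜ : Set V)) : SimpleGraph V where
  Adj a b := (∃ ha hb, S.Adj ⟨a, ha⟩ ⟨b, hb⟩) ∨ (a = v ∧ b = i) ∨ (a = i ∧ b = v)
  symm := ⟨fun a b h => by
    rcases h with ⟨ha, hb, h⟩ | h | h
    · exact Or.inl ⟨hb, ha, h.symm⟩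
    · exact Or.inr (Or.inr h.symm)
    · exact Or.inr (Or.inl h.symm)⟩
  loopless := ⟨fun a h => by
    have hi : (i : V) ≠ v := i.2
    rcases h with ⟨_, _, h⟩ | ⟨h, h'⟩ | ⟨h, h'⟩
    · exact h.ne rfl
    · exact hi (h'.symm.trans h)
    · exact hi (h.symm.trans h')⟩

variable {i : ({v}ᶜ : Set V)} {S : SimpleGraph ({v}ᶜ : Set V)}

lemma attachLeaf_adj_coe (a b : ({v}ᶜ : Set V)) :
    (attachLeaf v i S).Adj a b ↔ S.Adj a b := by
  have ha : (a : V) ≠ v := a.2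
  have hb : (b : V) ≠ v := b.2
  simp [attachLeaf, ha, hb]

lemma attachLeaf_adj_left (b : V) : (attachLeaf v i S).Adj v b ↔ b = i := by
  have hi : (i : V) ≠ v := i.2
  simp [attachLeaf, hi.symm]

lemma induce_attachLeaf : (attachLeaf v i S).induce {v}ᶜ = S := by
  ext a b
  simp [attachLeaf_adj_coe]

lemma attachLeaf_induce {G : SimpleGraph V} (h : G.neighborSet v = {(i : V)}) :
    attachLeaf v i (G.induce {v}ᶜ) = G := by
  have hv : ∀ b, G.Adj v b ↔ b = i := fun b => by
    rw [← mem_neighborSet, h, Set.mem_singleton_iff]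
  ext a b
  by_cases ha : a = v
  · subst ha
    rw [attachLeaf_adj_left, hv]
  by_cases hb : b = v
  · subst hb
    rw [adj_comm, attachLeaf_adj_left, adj_comm, hv]
  · exact attachLeaf_adj_coe ⟨a, ha⟩ ⟨b, hb⟩

lemma neighborSet_attachLeaf_self : (attachLeaf v i S).neighborSet v = {(i : V)} := by
  ext b
  simp [attachLeaf_adj_left]

lemma ncard_neighborSet_attachLeaf_coe [Finite V] (w : ({v}ᶜ : Set V)) :
    ((attachLeaf v i S).neighborSet w).ncard =
      (S.neighborSet w).ncard + if w = i then 1 else 0 := by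
  have himage : Set.ncard ((↑) '' S.neighborSet w : Set V) = (S.neighborSet w).ncard :=
    Set.ncard_image_of_injective _ Subtype.val_injective
  have hmem : ∀ b, b ∈ (attachLeaf v i S).neighborSet w ↔
      b ∈ ((↑) '' S.neighborSet w : Set V) ∨ (w = i ∧ b = v) := fun b => by
    by_cases hb : b = v
    · subst hb
      rw [mem_neighborSet, adj_comm, attachLeaf_adj_left]
      simp [Subtype.ext_iff]
    · have := attachLeaf_adj_coe (i := i) (S := S) w ⟨b, hb⟩
      simp_all
  by_cases hw : w = i
  · have : (attachLeaf v i S).neighborSet w = insert v ((↑) '' S.neighborSet w : Set V) := by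
      ext b
      rw [hmem, Set.mem_insert_iff]
      tauto
    rw [this, Set.ncard_insert_of_notMem (by simp) (Set.toFinite _), himage, if_pos hw]
  · have : (attachLeaf v i S).neighborSet w = ((↑) '' S.neighborSet w : Set V) := by
      ext b
      rw [hmem]
      tauto
    rw [this, himage, if_neg hw, add_zero]

lemma attachLeaf_connected_iff [Finite V] : (attachLeaf v i S).Connected ↔ S.Connected := by
  constructor
  · intro h
    have := Fintype.ofFinite V
    have hdeg : (attachLeaf v i S).degree v = 1 := by
      rw [← card_neighborSet_eq_degree, ← Nat.card_eq_fintype_card, Nat.card_coe_set_eq,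
        neighborSet_attachLeaf_self, Set.ncard_singleton]
    have := h.induce_compl_singleton_of_degree_eq_one hdeg
    rwa [induce_attachLeaf] at this
  · intro h
    have hcoe : ∀ a : ({v}ᶜ : Set V), (attachLeaf v i S).Reachable a i := fun a =>
      (h.preconnected a i).map ⟨Subtype.val, fun {a b} hab => (attachLeaf_adj_coe a b).2 hab⟩
    have hall : ∀ a : V, (attachLeaf v i S).Reachable a i := fun a => by
      by_cases ha : a = v
      · subst ha
        exact ((attachLeaf_adj_left _).2 rfl).reachable
      · exact hcoe ⟨a, ha⟩
    have : Nonempty V := ⟨v⟩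
    exact ⟨fun a b => (hall a).trans (hall b).symm⟩

/-- The number of connected graphs satisfying `P` in which each vertex `i` has degree `y i + 1`. -/
noncomputable def connectedCount (y : V → ℕ) (P : SimpleGraph V → Prop) : ℕ :=
  Nat.card {G : SimpleGraph V // G.Connected ∧ (∀ i, (G.neighborSet i).ncard = y i + 1) ∧ P G}

lemma connectedCount_eq_sum [Fintype V] {y : V → ℕ} (hv : y v = 0) (P : SimpleGraph V → Prop) :
    connectedCount y P = ∑ i : ({v}ᶜ : Set V), Nat.card {S : SimpleGraph ({v}ᶜ : Set V) //
      S.Connected ∧ (∀ w, (S.neighborSet w).ncard + (if w = i then 1 else 0) = y w + 1) ∧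
        P (attachLeaf v i S)} := by
  rw [← Nat.card_sigma]
  symm
  refine Nat.card_eq_of_bijective
    (fun p => ⟨attachLeaf v p.1 p.2.1, attachLeaf_connected_iff.2 p.2.2.1, fun w => ?_,
      p.2.2.2.2⟩) ⟨?_, ?_⟩
  · by_cases hw : w = v
    · subst hw
      rw [neighborSet_attachLeaf_self, Set.ncard_singleton, hv]
    · rw [ncard_neighborSet_attachLeaf_coe ⟨w, hw⟩]
      exact p.2.2.2.1 ⟨w, hw⟩
  · rintro ⟨i, S, hS⟩ ⟨i', S', hS'⟩ h
    have h : attachLeaf v i S = attachLeaf v i' S' := congrArg Subtype.val h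
    have hi : i = i' := by
      have := congrArg (fun G => G.neighborSet v) h
      simpa [neighborSet_attachLeaf_self, Subtype.ext_iff] using this
    have hSS : S = S' := by
      have := congrArg (fun G => G.induce {v}ᶜ) h
      simpa [induce_attachLeaf] using this
    subst hi hSS
    rfl
  · rintro ⟨G, hG, hdeg, hP⟩
    obtain ⟨i, hi⟩ := Set.ncard_eq_one.1 ((hdeg v).trans (by rw [hv]))
    have hiv : i ∈ ({v}ᶜ : Set V) := by
      have : G.Adj v i := by rw [← mem_neighborSet, hi]; rfl
      exact this.ne'
    have hind := attachLeaf_induce (i := ⟨i, hiv⟩) hi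
    refine ⟨⟨⟨i, hiv⟩, G.induce {v}ᶜ, ?_, fun w => ?_, ?_⟩, Subtype.ext hind⟩
    · exact attachLeaf_connected_iff (i := ⟨i, hiv⟩).1 (hind.symm ▸ hG)
    · rw [← ncard_neighborSet_attachLeaf_coe, hind, hdeg]
    · rwa [hind]

lemma card_compl_singleton [Fintype V] : Fintype.card ({v}ᶜ : Set V) + 1 = Fintype.card V := by
  rw [Fintype.card_compl_set, Set.card_singleton]
  exact Nat.sub_add_cancel (Fintype.card_pos_iff.2 ⟨v⟩)

/-- Recursion for `connectedCount` obtained by removing the leaf `v`. -/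
lemma connectedCount_mul_prod_factorial [Fintype V] (hV : 3 ≤ Fintype.card V) {y : V → ℕ}
    (hv : y v = 0) (P : SimpleGraph V → Prop) :
    connectedCount y P * ∏ w, (y w).factorial = ∑ i : ({v}ᶜ : Set V), y i *
      (connectedCount (fun w : ({v}ᶜ : Set V) => y w - if w = i then 1 else 0)
        (fun S => P (attachLeaf v i S)) *
        ∏ w : ({v}ᶜ : Set V), (y w - if w = i then 1 else 0).factorial) := by
  have hprod : ∏ w, (y w).factorial = ∏ w : ({v}ᶜ : Set V), (y w).factorial := by
    rw [Fintype.prod_eq_mul_prod_compl v, hv, Nat.factorial_zero, one_mul]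
    exact Finset.prod_subtype _ (fun a => by simp) _
  rw [connectedCount_eq_sum hv, Finset.sum_mul, hprod]
  refine Finset.sum_congr rfl fun i _ => ?_
  rcases Nat.eq_zero_or_pos (y i) with hi | hi
  · rw [hi, zero_mul, Nat.card_eq_zero.2 (Or.inl ⟨?_⟩), zero_mul]
    rintro ⟨S, hS, hdeg, -⟩
    have hz := hdeg i
    rw [hi, if_pos rfl] at hz
    have hempty : S.neighborSet i = ∅ := by
      rw [← Set.ncard_eq_zero (Set.toFinite _)]
      lia
    have hcard := card_compl_singleton (v := v)
    have : Nontrivial ({v}ᶜ : Set V) := Fintype.one_lt_card_iff_nontrivial.1 (by lia)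
    obtain ⟨b, hb⟩ := hS.preconnected.exists_adj_of_nontrivial i
    have : b ∈ S.neighborSet i := hb
    simp [hempty] at this
  · have hfac : ∏ w : ({v}ᶜ : Set V), (y w).factorial =
        y i * ∏ w : ({v}ᶜ : Set V), (y w - if w = i then 1 else 0).factorial := by
      rw [Fintype.prod_eq_mul_prod_compl i, Fintype.prod_eq_mul_prod_compl i, if_pos rfl,
        ← mul_assoc, Nat.mul_factorial_pred hi.ne']
      congr 1
      refine Finset.prod_congr rfl fun w hw => ?_
      rw [if_neg (by simpa using hw), Nat.sub_zero]
    rw [hfac, mul_left_comm]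
    congr 2
    refine Nat.card_congr (Equiv.subtypeEquivRight fun S => ?_)
    refine and_congr_right fun _ => and_congr_left fun _ => forall_congr' fun w => ?_
    by_cases hw : w = i
    · subst hw
      simp only [if_true]
      lia
    · simp [hw]

lemma sum_compl_singleton [Fintype V] {y : V → ℕ} (hv : y v = 0) :
    ∑ w : ({v}ᶜ : Set V), y w = ∑ w, y w := by
  rw [Fintype.sum_eq_add_sum_compl v, hv, zero_add]
  exact (Finset.sum_subtype _ (fun a => by simp) _).symm

lemma sum_sub_ite_add_one {W : Type*} [Fintype W] [DecidableEq W] {y : W → ℕ} {i : W}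
    (hi : y i ≠ 0) : ∑ w, (y w - if w = i then 1 else 0) + 1 = ∑ w, y w := by
  rw [Fintype.sum_eq_add_sum_compl i, Fintype.sum_eq_add_sum_compl i, if_pos rfl]
  have : ∑ w ∈ {i}ᶜ, (y w - if w = i then 1 else 0) = ∑ w ∈ {i}ᶜ, y w :=
    Finset.sum_congr rfl fun w hw => by rw [if_neg (by simpa using hw), Nat.sub_zero]
  lia

lemma sum_mul_sub_ite_add {W : Type*} [Fintype W] [DecidableEq W] (y : W → ℕ) (j : W) :
    ∑ i, y i * (y j - if j = i then 1 else 0) + y j = (∑ i, y i) * y j := by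
  rw [Fintype.sum_eq_add_sum_compl j, Fintype.sum_eq_add_sum_compl j, if_pos rfl, add_mul,
    Finset.sum_mul]
  have : ∑ i ∈ {j}ᶜ, y i * (y j - if j = i then 1 else 0) = ∑ i ∈ {j}ᶜ, y i * y j :=
    Finset.sum_congr rfl fun i hi => by
      rw [if_neg (Ne.symm (by simpa using hi)), Nat.sub_zero]
  rw [this]
  cases y j <;> simp; ring

lemma exists_eq_zero_of_sum_lt_card [Fintype V] {y : V → ℕ} (h : ∑ w, y w < Fintype.card V) :
    ∃ v, y v = 0 := by
  by_contra! hne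
  have : ∑ _w : V, 1 ≤ ∑ w, y w :=
    Finset.sum_le_sum fun w _ => Nat.one_le_iff_ne_zero.2 (hne w)
  rw [Finset.sum_const, smul_eq_mul, mul_one, Finset.card_univ] at this
  lia

lemma connectedCount_of_card_eq_two [Fintype V] (hV : Fintype.card V = 2) :
    connectedCount (fun _ : V => 0) (fun _ => True) = 1 := by
  have : Nontrivial V := Fintype.one_lt_card_iff_nontrivial.1 (by lia)
  have hdeg : ∀ i : V, ((⊤ : SimpleGraph V).neighborSet i).ncard = 1 := fun i => by
    rw [neighborSet_top, Set.ncard_compl, Set.ncard_singleton, Nat.card_eq_fintype_card, hV]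
  refine Nat.card_eq_one_iff_unique.2 ⟨⟨?_⟩, ⟨⟨⊤, connected_top, hdeg, trivial⟩⟩⟩
  have htop : ∀ G : SimpleGraph V, G.Connected → G = ⊤ := fun G hG => by
    ext a b
    rw [top_adj]
    refine ⟨Adj.ne, fun hab => ?_⟩
    obtain ⟨c, hc⟩ := hG.preconnected.exists_adj_of_nontrivial a
    obtain rfl : c = b := by
      by_contra hcb
      have := Fintype.two_lt_card_iff.2 ⟨a, b, c, hab, hc.ne, Ne.symm hcb⟩
      lia
    exact hc
  rintro ⟨G, hG, -⟩ ⟨H, hH, -⟩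
  exact Subtype.ext ((htop G hG).trans (htop H hH).symm)

/-- The number of trees with prescribed degrees is a multinomial coefficient. -/
theorem connectedCount_true_mul_prod_factorial (n : ℕ) {V : Type u} [Fintype V]
    (hV : Fintype.card V = n + 2) (y : V → ℕ) (hy : ∑ w, y w = n) :
    connectedCount y (fun _ => True) * ∏ w, (y w).factorial = n.factorial := by
  induction n generalizing V with
  | zero =>
    obtain rfl : y = fun _ => 0 := by
      funext w
      exact Finset.sum_eq_zero_iff.1 hy w (Finset.mem_univ w)
    simp [connectedCount_of_card_eq_two hV]
  | succ n ih =>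
    obtain ⟨v, hv⟩ := exists_eq_zero_of_sum_lt_card (y := y) (by lia)
    have hcard := card_compl_singleton (v := v)
    have hsum := sum_compl_singleton hv
    rw [connectedCount_mul_prod_factorial (by lia) hv]
    trans ∑ i : ({v}ᶜ : Set V), y i * n.factorial
    · refine Finset.sum_congr rfl fun i _ => ?_
      by_cases hi : y i = 0
      · rw [hi, zero_mul, zero_mul]
      · have := sum_sub_ite_add_one (y := fun w : ({v}ᶜ : Set V) => y w) hi
        rw [ih (by lia) _ (by lia)]
    · rw [← Finset.sum_mul, hsum, hy, Nat.factorial_succ]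

lemma connectedCount_congr {y : V → ℕ} {P Q : SimpleGraph V → Prop} (h : ∀ G, P G ↔ Q G) :
    connectedCount y P = connectedCount y Q := by
  rw [show P = Q from funext fun G => propext (h G)]

lemma connectedCount_false {y : V → ℕ} : connectedCount y (fun _ => False) = 0 := by
  simp [connectedCount]

lemma connectedCount_adj_of_eq_zero {n : ℕ} [Fintype V] (hV : Fintype.card V = n + 3)
    {y : V → ℕ} (hy : ∑ w, y w = n + 1) {j k : V} (hjk : j ≠ k) (hj : y j = 0) :
    connectedCount y (fun G => G.Adj j k) * ∏ w, (y w).factorial = y k * n.factorial := by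
  have hcard := card_compl_singleton (v := j)
  have hsum := sum_compl_singleton hj
  rw [connectedCount_mul_prod_factorial (by lia) hj,
    Fintype.sum_eq_single (⟨k, hjk.symm⟩ : ({j}ᶜ : Set V)) fun i hi => ?_]
  · by_cases hk : y k = 0
    · simp [hk]
    · have := sum_sub_ite_add_one (y := fun w : ({j}ᶜ : Set V) => y w) (i := ⟨k, hjk.symm⟩) hk
      rw [connectedCount_congr (Q := fun _ => True) fun S => by simp [attachLeaf_adj_left],
        connectedCount_true_mul_prod_factorial n (by lia) _ (by lia)]
  · rw [connectedCount_congr (Q := fun _ => False) fun S => ?_, connectedCount_false, zero_mul,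
      mul_zero]
    rw [attachLeaf_adj_left, iff_false]
    exact fun h => hi (Subtype.ext h.symm)

/-- The number of trees with prescribed degrees in which `j` and `k` are adjacent. -/
theorem connectedCount_adj_mul_prod_factorial (n : ℕ) {V : Type u} [Fintype V]
    (hV : Fintype.card V = n + 3) (y : V → ℕ) (hy : ∑ w, y w = n + 1) {j k : V} (hjk : j ≠ k) :
    connectedCount y (fun G => G.Adj j k) * ∏ w, (y w).factorial =
      (y j + y k) * n.factorial := by
  induction n generalizing V with
  | zero =>
    by_cases hj : y j = 0
    · rw [connectedCount_adj_of_eq_zero hV hy hjk hj, hj, zero_add]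
    by_cases hk : y k = 0
    · rw [connectedCount_congr fun G => G.adj_comm j k,
        connectedCount_adj_of_eq_zero hV hy hjk.symm hk, hk, add_zero]
    have := Finset.add_le_sum (f := y) (fun _ _ => Nat.zero_le _) (Finset.mem_univ j)
      (Finset.mem_univ k) hjk
    lia
  | succ n ih =>
    by_cases hj : y j = 0
    · rw [connectedCount_adj_of_eq_zero hV hy hjk hj, hj, zero_add]
    by_cases hk : y k = 0
    · rw [connectedCount_congr fun G => G.adj_comm j k,
        connectedCount_adj_of_eq_zero hV hy hjk.symm hk, hk, add_zero]
    obtain ⟨v, hv⟩ := exists_eq_zero_of_sum_lt_card (y := y) (by lia)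
    have hcard := card_compl_singleton (v := v)
    have hsum := sum_compl_singleton hv
    let j' : ({v}ᶜ : Set V) := ⟨j, fun h => hj (h ▸ hv)⟩
    let k' : ({v}ᶜ : Set V) := ⟨k, fun h => hk (h ▸ hv)⟩
    have hjk' : j' ≠ k' := fun h => hjk (congrArg Subtype.val h)
    rw [connectedCount_mul_prod_factorial (by lia) hv]
    trans ∑ i : ({v}ᶜ : Set V), (y i * (y j' - if j' = i then 1 else 0) +
      y i * (y k' - if k' = i then 1 else 0)) * n.factorial
    · refine Finset.sum_congr rfl fun i _ => ?_
      by_cases hi : y i = 0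
      · simp [hi]
      · have := sum_sub_ite_add_one (y := fun w : ({v}ᶜ : Set V) => y w) hi
        rw [connectedCount_congr (Q := fun S => S.Adj j' k')
          fun S => attachLeaf_adj_coe j' k', ih (by lia) _ (by lia) hjk', ← mul_add, mul_assoc]
    · have hj' := sum_mul_sub_ite_add (fun w : ({v}ᶜ : Set V) => y w) j'
      have hk' := sum_mul_sub_ite_add (fun w : ({v}ᶜ : Set V) => y w) k'
      rw [hsum, hy] at hj' hk'
      rw [← Finset.sum_mul, Finset.sum_add_distrib, Nat.factorial_succ, ← mul_assoc]
      congr 1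
      change _ = (y j' + y k') * (n + 1)
      linarith

lemma ncard_neighborSet (G : SimpleGraph V) (i : V) [Fintype (G.neighborSet i)] :
    (G.neighborSet i).ncard = G.degree i := by
  rw [← card_neighborSet_eq_degree, ← Nat.card_eq_fintype_card, Nat.card_coe_set_eq]

lemma isTree_iff_connected_of_ncard_neighborSet_eq [Fintype V] {y : V → ℕ}
    (hy : ∑ w, y w + 2 = Fintype.card V) {G : SimpleGraph V}
    (hG : ∀ i, (G.neighborSet i).ncard = y i + 1) : G.IsTree ↔ G.Connected := by
  rw [isTree_iff_connected_and_card, and_iff_left_iff_imp]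
  intro _
  have := G.sum_degrees_eq_twice_card_edges
  simp_rw [← ncard_neighborSet, hG] at this
  rw [Finset.sum_add_distrib, Finset.sum_const, smul_eq_mul, mul_one, Finset.card_univ] at this
  rw [Nat.card_eq_fintype_card, Nat.card_eq_fintype_card, ← edgeFinset_card]
  lia

lemma card_eq_connectedCount [Fintype V] {y : V → ℕ} (hy : ∑ w, y w + 2 = Fintype.card V)
    {P : SimpleGraph V → Prop} {s : Finset (SimpleGraph V)}
    (hs : ∀ G, G ∈ s ↔ (G.IsTree ∧ ∀ i, (G.neighborSet i).ncard = y i + 1) ∧ P G) :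
    s.card = connectedCount y P := by
  refine (Nat.subtype_card s fun G => ?_).symm
  rw [hs, and_assoc]
  constructor
  · rintro ⟨hT, hG, hP⟩
    exact ⟨hT.connected, hG, hP⟩
  · rintro ⟨hC, hG, hP⟩
    exact ⟨(isTree_iff_connected_of_ncard_neighborSet_eq hy hG).2 hC, hG, hP⟩

end SimpleGraph

theorem tree_adjacency_probability (n : ℕ) (hn : 3 ≤ n) (x : Fin n → ℕ)
    -- `x` is a tree degree sequence
    (hx1 : ∀ j, 1 ≤ x j) (hxsum : (∑ j, x j) + 2 = 2 * n)
    (j k : Fin n) (hjk : j ≠ k)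
    (Tx : Finset (SimpleGraph (Fin n)))
    (hTx : Tx = Finset.univ.filter
      (fun T : SimpleGraph (Fin n) => T.IsTree ∧ ∀ i, T.degree i = x i)) :
    ((Tx.filter (fun T => T.Adj j k)).card : ℝ) / (Tx.card : ℝ)
      = ((x j : ℝ) + (x k : ℝ) - 2) / ((n : ℝ) - 2) := by
  obtain ⟨m, rfl⟩ : ∃ m, n = m + 3 := ⟨n - 3, by lia⟩
  obtain ⟨y, rfl⟩ : ∃ y : Fin (m + 3) → ℕ, x = fun i => y i + 1 :=
    ⟨fun i => x i - 1, funext fun i => (Nat.sub_add_cancel (hx1 i)).symm⟩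
  have hy : ∑ i, y i = m + 1 := by
    rw [Finset.sum_add_distrib, Finset.sum_const, Finset.card_univ, Fintype.card_fin] at hxsum
    simp only [smul_eq_mul, mul_one] at hxsum
    lia
  have hy2 : ∑ i, y i + 2 = Fintype.card (Fin (m + 3)) := by
    rw [Fintype.card_fin]
    lia
  have hall : Tx.card = SimpleGraph.connectedCount y (fun _ => True) := by
    refine SimpleGraph.card_eq_connectedCount hy2 fun G => ?_
    simp only [hTx, Finset.mem_filter_univ, SimpleGraph.ncard_neighborSet, and_true]
  have hadj : (Tx.filter (fun T => T.Adj j k)).card =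
      SimpleGraph.connectedCount y (fun G => G.Adj j k) := by
    refine SimpleGraph.card_eq_connectedCount hy2 fun G => ?_
    simp only [hTx, Finset.mem_filter, Finset.mem_univ, true_and, SimpleGraph.ncard_neighborSet]
  have hN := SimpleGraph.connectedCount_true_mul_prod_factorial (m + 1) (by simp) y hy
  have hA := SimpleGraph.connectedCount_adj_mul_prod_factorial m (by simp) y hy hjk
  rw [← hall] at hN
  rw [← hadj] at hA
  have hprod : ∏ i, (y i).factorial ≠ 0 := Finset.prod_ne_zero_iff.2 fun i _ =>
    Nat.factorial_ne_zero _
  have hTx0 : Tx.card ≠ 0 := by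
    rintro h
    rw [h, zero_mul] at hN
    exact Nat.factorial_ne_zero _ hN.symm
  have key : (Tx.filter (fun T => T.Adj j k)).card * (m + 1) = (y j + y k) * Tx.card := by
    apply Nat.eq_of_mul_eq_mul_right (Nat.pos_of_ne_zero hprod)
    rw [mul_right_comm, hA, mul_assoc (y j + y k) Tx.card, hN, Nat.factorial_succ]
    ring
  have hcast : (((m + 3 : ℕ) : ℝ) - 2) = m + 1 := by
    push_cast
    ring
  rw [hcast, div_eq_div_iff (Nat.cast_ne_zero.2 hTx0) (by positivity)]
  have keyR := congrArg (Nat.cast (R := ℝ)) key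
  push_cast at keyR ⊢
  rw [keyR]
  ring
end

section
/- Let n ≥ 3, let x = (x_1,…,x_n) be a tree degree sequence, let φ : {1,…,n} → ℝ, and for a tree T on {1,…,n} let F(T) = Σ_{{j,k}∈E(T)} φ(j)φ(k). Then the average value of F over all trees with degree sequence x equals (1/(n−2)) · ( Σ_{k=1}^n φ(k) ) · ( Σ_{j=1}^n (x_j−1) φ(j) ) − (1/(n−2)) · Σ_{j=1}^n (x_j−1) φ(j)². -/
attribute [local instance] Classical.propDecidable

open Finset

namespace SimpleGraph

variable {V : Type*}

theorem sup_edge_sdiff_edge {G : SimpleGraph V} {v w : V} (h : ¬ G.Adj v w) :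
    (G ⊔ edge v w) \ edge v w = G := by
  rw [sup_sdiff_right_self, sdiff_edge G h]

theorem sdiff_edge_sup_edge {G : SimpleGraph V} {v w : V} (h : G.Adj v w) :
    (G \ edge v w) ⊔ edge v w = G := by
  rw [sdiff_sup_self, sup_edge_of_adj G h]

theorem not_adj_sdiff_edge {G : SimpleGraph V} {v w : V} (hvw : v ≠ w) :
    ¬ (G \ edge v w).Adj v w := by
  simp [edge_adj, hvw]

/-- The degree sequence left after deleting an edge between `v` and `w`. -/
def dropEdge [DecidableEq V] (x : V → ℕ) (v w : V) (j : V) : ℕ :=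
  x j - if j = v ∨ j = w then 1 else 0

theorem cast_dropEdge_sub_one [DecidableEq V] {x : V → ℕ} {v w : V} (hv : x v = 1)
    (hw : 2 ≤ x w) (j : V) :
    ((dropEdge x v w j - 1 : ℕ) : ℝ) = ((x j - 1 : ℕ) : ℝ) - if j = w then 1 else 0 := by
  have h : x j - 1 = (dropEdge x v w j - 1) + if j = w then 1 else 0 := by
    simp only [dropEdge]
    grind
  rw [h]
  push_cast
  ring

variable [Fintype V]

/-- The vertices of positive degree. -/
def posSupport (x : V → ℕ) : Finset V := univ.filter fun j => 1 ≤ x j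

theorem mem_posSupport {x : V → ℕ} {j : V} : j ∈ posSupport x ↔ 1 ≤ x j := by
  simp [posSupport]

theorem not_adj_of_degree_eq_zero {G : SimpleGraph V} {v : V} (h : G.degree v = 0) (w : V) :
    ¬ G.Adj v w := by
  intro hw
  have := (G.degree_pos_iff_exists_adj v).2 ⟨w, hw⟩
  omega

theorem not_reachable_of_degree_eq_zero {G : SimpleGraph V} {v w : V} (hvw : v ≠ w)
    (h : G.degree v = 0) : ¬ G.Reachable v w := by
  rintro ⟨p⟩
  cases p with
  | nil => exact hvw rfl
  | cons hadj _ => exact not_adj_of_degree_eq_zero h _ hadj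

theorem IsAcyclic.card_edgeFinset_lt [Nonempty V] {G : SimpleGraph V} [Fintype G.edgeSet]
    (h : G.IsAcyclic) : #G.edgeFinset < Fintype.card V := by
  obtain ⟨T, hle, -, hT⟩ := connected_top.exists_isTree_le_of_le_of_isAcyclic le_top h
  have h1 := hT.card_edgeFinset
  have h2 := card_le_card (edgeFinset_mono hle)
  omega

theorem isTree_of_isAcyclic_of_card [Nonempty V] {G : SimpleGraph V} [Fintype G.edgeSet]
    (h : G.IsAcyclic) (hcard : #G.edgeFinset + 1 = Fintype.card V) : G.IsTree := by
  obtain ⟨T, hle, -, hT⟩ := connected_top.exists_isTree_le_of_le_of_isAcyclic le_top h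
  have h1 := hT.card_edgeFinset
  have h2 := eq_of_subset_of_card_le (edgeFinset_mono hle) (by omega)
  rwa [edgeFinset_inj.1 h2]

theorem sum_filter_two_le (x : V → ℕ) (ψ : V → ℝ) :
    ∑ w with 2 ≤ x w, ((x w - 1 : ℕ) : ℝ) * ψ w = ∑ w, ((x w - 1 : ℕ) : ℝ) * ψ w := by
  refine sum_subset (subset_univ _) fun w _ hw => ?_
  have : x w - 1 = 0 := by
    simp only [mem_filter, mem_univ, true_and] at hw
    omega
  simp [this]

theorem sum_sub_one_add_card (x : V → ℕ) : ∑ j, (x j - 1) + #(posSupport x) = ∑ j, x j := by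
  rw [posSupport, card_filter, ← sum_add_distrib]
  refine sum_congr rfl fun j _ => ?_
  grind

theorem exists_leaf {x : V → ℕ} (h : ∑ j, x j < 2 * #(posSupport x)) : ∃ v, x v = 1 := by
  by_contra! hne
  refine h.not_ge ?_
  calc 2 * #(posSupport x) = ∑ j ∈ posSupport x, 2 := by simp [mul_comm]
    _ ≤ ∑ j ∈ posSupport x, x j := sum_le_sum fun j hj => by
        have := mem_posSupport.1 hj
        have := hne j
        omega
    _ ≤ ∑ j, x j := sum_le_sum_of_subset (subset_univ _)

theorem sum_mul_quadratic (d φ : V → ℝ) (a b c : ℝ) :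
    ∑ j, d j * (a + b * φ j + c * φ j ^ 2) =
      a * ∑ j, d j + b * ∑ j, d j * φ j + c * ∑ j, d j * φ j ^ 2 := by
  simp only [mul_sum, ← sum_add_distrib]
  exact sum_congr rfl fun j _ => by ring

/-- The sum over the edges `{j, k}` of `φ j * φ k`. -/
noncomputable def edgeProductSum (φ : V → ℝ) (T : SimpleGraph V) : ℝ :=
  ∑ e ∈ T.edgeFinset, Sym2.lift ⟨fun j k => φ j * φ k, fun j k => by ring⟩ e

theorem edgeProductSum_bot (φ : V → ℝ) : edgeProductSum φ ⊥ = 0 := by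
  have h : ∀ G : SimpleGraph V, G = ⊥ → edgeProductSum φ G = 0 := fun G hG =>
    sum_eq_zero fun e he => absurd (mem_edgeFinset.1 he) (by simp [hG])
  exact h ⊥ rfl

variable [DecidableEq V]

/-- The forests on `V` in which every vertex `j` has degree `x j`. -/
noncomputable def forestsWithDegree (x : V → ℕ) : Finset (SimpleGraph V) :=
  univ.filter fun T => T.IsAcyclic ∧ ∀ j, T.degree j = x j

theorem mem_forestsWithDegree {x : V → ℕ} {T : SimpleGraph V} :
    T ∈ forestsWithDegree x ↔ T.IsAcyclic ∧ ∀ j, T.degree j = x j := by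
  simp [forestsWithDegree]

theorem degree_sup_edge_s14 {G : SimpleGraph V} {v w : V} (hvw : v ≠ w) (h : ¬ G.Adj v w) (j : V)
    [Fintype (G.neighborSet j)] [Fintype ((G ⊔ edge v w).neighborSet j)] :
    (G ⊔ edge v w).degree j = G.degree j + if j = v ∨ j = w then 1 else 0 := by
  have h' : ¬ G.Adj w v := fun h' => h h'.symm
  simp only [← card_neighborFinset_eq_degree]
  by_cases hj : j = v
  · subst hj
    have : (G ⊔ edge j w).neighborFinset j = insert w (G.neighborFinset j) := by
      ext k; simp [edge_adj]; grind
    rw [this, card_insert_of_notMem (by simpa)]; simp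
  by_cases hj' : j = w
  · subst hj'
    have : (G ⊔ edge v j).neighborFinset j = insert v (G.neighborFinset j) := by
      ext k; simp [edge_adj]; grind
    rw [this, card_insert_of_notMem (by simpa)]; simp
  · have : (G ⊔ edge v w).neighborFinset j = G.neighborFinset j := by
      ext k; simp [edge_adj, hj, hj']
    simp [this, hj, hj']

theorem edgeProductSum_sup_edge (φ : V → ℝ) {G : SimpleGraph V} {v w : V} (hvw : v ≠ w)
    (h : ¬ G.Adj v w) :
    edgeProductSum φ (G ⊔ edge v w) = edgeProductSum φ G + φ v * φ w := by
  rw [edgeProductSum, sum_congr (s₂ := insert s(v, w) G.edgeFinset) _ fun _ _ => rfl,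
    sum_insert (by simpa using h), add_comm]
  · simp [edgeProductSum]
  · ext e
    simp only [mem_edgeFinset, mem_insert, edgeSet_sup, edgeSet_edge_of_ne hvw, Set.mem_union,
      Set.mem_singleton_iff, or_comm]

theorem sum_forestsWithDegree_adj (f : SimpleGraph V → ℝ) {x : V → ℕ} {v w : V} (hv : x v = 1)
    (hvw : v ≠ w) (hw : 1 ≤ x w) :
    ∑ T ∈ (forestsWithDegree x).filter (fun T => T.Adj v w), f T =
      ∑ T ∈ forestsWithDegree (dropEdge x v w), f (T ⊔ edge v w) := by
  have hisolated : ∀ T ∈ forestsWithDegree (dropEdge x v w), T.degree v = 0 := by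
    intro T hT
    rw [(mem_forestsWithDegree.1 hT).2 v]
    simp [dropEdge, hv]
  refine sum_bij' (fun T _ => T \ edge v w) (fun T _ => T ⊔ edge v w) ?_ ?_ ?_ ?_ ?_
  · intro T hT
    obtain ⟨hT, hadj⟩ := mem_filter.1 hT
    obtain ⟨hac, hdeg⟩ := mem_forestsWithDegree.1 hT
    refine mem_forestsWithDegree.2 ⟨hac.anti sdiff_le, fun j => ?_⟩
    have hj : T.degree j = (T \ edge v w).degree j + if j = v ∨ j = w then 1 else 0 := by
      convert degree_sup_edge_s14 hvw (not_adj_sdiff_edge (G := T) hvw) j using 2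
      exact (sdiff_edge_sup_edge hadj).symm
    rw [dropEdge, ← hdeg j, hj, Nat.add_sub_cancel]
    congr!
  · intro T hT
    have h0 := hisolated T hT
    obtain ⟨hac, hdeg⟩ := mem_forestsWithDegree.1 hT
    refine mem_filter.2 ⟨mem_forestsWithDegree.2
      ⟨hac.sup_edge_of_not_reachable (not_reachable_of_degree_eq_zero hvw h0), fun j => ?_⟩, ?_⟩
    · rw [degree_sup_edge_s14 hvw (not_adj_of_degree_eq_zero h0 w), hdeg, dropEdge]
      grind
    · simp [edge_adj, hvw]
  · intro T hT
    exact sdiff_edge_sup_edge (mem_filter.1 hT).2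
  · intro T hT
    exact sup_edge_sdiff_edge (not_adj_of_degree_eq_zero (hisolated T hT) w)
  · intro T hT
    rw [sdiff_edge_sup_edge (mem_filter.1 hT).2]

/-- Summing over forests by first deleting the leaf `v`. -/
theorem sum_forestsWithDegree_leaf (f : SimpleGraph V → ℝ) {x : V → ℕ} {v : V} (hv : x v = 1) :
    ∑ T ∈ forestsWithDegree x, f T =
      ∑ w with v ≠ w ∧ 1 ≤ x w,
        ∑ T ∈ forestsWithDegree (dropEdge x v w), f (T ⊔ edge v w) := by
  have hone : ∀ T ∈ forestsWithDegree x, f T = ∑ w, if T.Adj v w then f T else 0 := by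
    intro T hT
    have h1 := (mem_forestsWithDegree.1 hT).2 v
    rw [hv, ← card_neighborFinset_eq_degree, neighborFinset_eq_filter] at h1
    rw [← sum_filter, sum_const, h1, one_smul]
  rw [sum_congr rfl hone, sum_comm, sum_filter]
  refine sum_congr rfl fun w _ => ?_
  rw [← sum_filter]
  split_ifs with h
  · exact sum_forestsWithDegree_adj f hv h.1 h.2
  · rw [filter_false_of_mem, sum_empty]
    intro T hT hadj
    refine h ⟨hadj.ne, ?_⟩
    rw [← (mem_forestsWithDegree.1 hT).2 w]
    exact (T.degree_pos_iff_exists_adj w).2 ⟨v, hadj.symm⟩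

/-- A nonempty forest has fewer edges than non-isolated vertices. -/
theorem sum_lt_of_mem_forestsWithDegree {x : V → ℕ} {T : SimpleGraph V}
    (hT : T ∈ forestsWithDegree x) (hx : (posSupport x).Nonempty) :
    ∑ j, x j < 2 * #(posSupport x) := by
  obtain ⟨hac, hdeg⟩ := mem_forestsWithDegree.1 hT
  have hsum := T.sum_degrees_eq_twice_card_edges
  simp only [hdeg] at hsum
  have hsupp : T.support ⊆ (posSupport x : Set V) := by
    intro j hj
    rw [mem_coe, mem_posSupport, ← hdeg j]
    exact (T.degree_pos_iff_exists_adj j).2 hj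
  have : Nonempty (posSupport x : Set V) := hx.to_subtype
  have hlt := (hac.induce (posSupport x : Set V)).card_edgeFinset_lt
  have hind : #(T.induce (posSupport x : Set V)).edgeFinset = #T.edgeFinset := by
    convert card_edgeFinset_induce_of_support_subset hsupp
  rw [hind, Fintype.card_eq_nat_card, Nat.card_coe_set_eq, Set.ncard_coe_finset] at hlt
  omega

theorem sum_dropEdge {x : V → ℕ} {v w : V} (hvw : v ≠ w) (hv : 1 ≤ x v) (hw : 1 ≤ x w) :
    ∑ j, dropEdge x v w j + 2 = ∑ j, x j := by
  have h : ∀ j, x j = dropEdge x v w j + ((if j = v then 1 else 0) + if j = w then 1 else 0) := by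
    intro j
    simp only [dropEdge]
    grind
  rw [sum_congr rfl fun j _ => h j, sum_add_distrib, sum_add_distrib]
  simp

theorem posSupport_dropEdge {x : V → ℕ} {v w : V} (hv : x v = 1) (hw : 2 ≤ x w) :
    posSupport (dropEdge x v w) = (posSupport x).erase v := by
  ext j
  simp only [mem_posSupport, mem_erase, dropEdge]
  grind

theorem card_posSupport_dropEdge {x : V → ℕ} {v w : V} (hv : x v = 1) (hw : 2 ≤ x w) :
    #(posSupport (dropEdge x v w)) = #(posSupport x) - 1 := by
  rw [posSupport_dropEdge hv hw, card_erase_of_mem (mem_posSupport.2 hv.ge)]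

theorem posSupport_dropEdge_leaf {x : V → ℕ} {v w : V} (hv : x v = 1) (hw : x w = 1) :
    posSupport (dropEdge x v w) = ((posSupport x).erase v).erase w := by
  ext j
  simp only [mem_posSupport, mem_erase, dropEdge]
  grind

/-- Leaf deletion when there are at least three non-isolated vertices: the neighbour of the
leaf is not itself a leaf. -/
theorem sum_forestsWithDegree_leaf_of_three_le (f : SimpleGraph V → ℝ) {x : V → ℕ} {v : V}
    (hv : x v = 1) (hsum : ∑ j, x j + 2 = 2 * #(posSupport x)) (h3 : 3 ≤ #(posSupport x)) :
    ∑ T ∈ forestsWithDegree x, f T =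
      ∑ w with 2 ≤ x w, ∑ T ∈ forestsWithDegree (dropEdge x v w), f (T ⊔ edge v w) := by
  rw [sum_forestsWithDegree_leaf f hv]
  symm
  refine sum_subset (fun w hw => ?_) fun w hw hw' => ?_
  · simp only [mem_filter, mem_univ, true_and] at hw ⊢
    refine ⟨?_, by omega⟩
    rintro rfl
    omega
  · simp only [mem_filter, mem_univ, true_and] at hw hw'
    obtain ⟨hvw, hw1⟩ := hw
    have hw1 : x w = 1 := by omega
    refine sum_eq_zero fun T hT => ?_
    have hsupp := posSupport_dropEdge_leaf hv hw1
    have hcard : #(posSupport (dropEdge x v w)) + 2 = #(posSupport x) := by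
      rw [hsupp, card_erase_of_mem, card_erase_of_mem (by rw [mem_posSupport]; omega)]
      · omega
      · rw [mem_erase, mem_posSupport]
        exact ⟨hvw.symm, by omega⟩
    have h1 := sum_lt_of_mem_forestsWithDegree hT (card_pos.1 (by omega))
    have h2 := sum_dropEdge hvw (by omega : 1 ≤ x v) (by omega : 1 ≤ x w)
    omega

theorem prod_factorial_dropEdge {x : V → ℕ} {v w : V} (hv : x v = 1) (hw : 2 ≤ x w) :
    ∏ j, (x j - 1).factorial = (x w - 1) * ∏ j, (dropEdge x v w j - 1).factorial := by
  have h : ∀ j, (x j - 1).factorial = (if j = w then x w - 1 else 1) * (dropEdge x v w j - 1).factorial := by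
    intro j
    simp only [dropEdge]
    by_cases hj : j = w
    · subst hj
      obtain ⟨k, hk⟩ := Nat.exists_eq_add_of_le hw
      have : 2 + k - 1 = k + 1 := by omega
      simp [hk, this, Nat.factorial_succ]
    · by_cases hjv : j = v
      · subst hjv; simp [hj, hv]
      · simp [hj, hjv]
  rw [prod_congr rfl fun j _ => h j, prod_mul_distrib]
  simp

theorem sum_dropEdge_sub_one_mul {x : V → ℕ} {v w : V} (hv : x v = 1) (hw : 2 ≤ x w)
    (ψ : V → ℝ) :
    ∑ j, ((dropEdge x v w j - 1 : ℕ) : ℝ) * ψ j = ∑ j, ((x j - 1 : ℕ) : ℝ) * ψ j - ψ w := by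
  simp only [cast_dropEdge_sub_one hv hw, sub_mul, sum_sub_distrib]
  simp

/-- Sums over the forests on two non-isolated vertices. -/
theorem sum_forestsWithDegree_of_card_two (f : SimpleGraph V → ℝ) {x : V → ℕ}
    (hsum : ∑ j, x j = 2) (hcard : #(posSupport x) = 2) :
    ∃ v w, v ≠ w ∧ posSupport x = {v, w} ∧ ∏ j, (x j - 1).factorial = 1 ∧
      ∑ T ∈ forestsWithDegree x, f T = f (⊥ ⊔ edge v w) := by
  obtain ⟨v, w, hvw, hS⟩ := card_eq_two.1 hcard
  have hsub := sum_sub_one_add_card x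
  have hle : ∀ j, x j - 1 = 0 := by
    have : ∑ j, (x j - 1) = 0 := by omega
    simpa using this
  have hv : x v = 1 := by
    have := mem_posSupport.1 (hS ▸ mem_insert_self v {w} : v ∈ posSupport x)
    have := hle v
    omega
  have hw : x w = 1 := by
    have := mem_posSupport.1 (hS ▸ by simp : w ∈ posSupport x)
    have := hle w
    omega
  refine ⟨v, w, hvw, hS, by simp [hle], ?_⟩
  have hfilter : (univ.filter fun u => v ≠ u ∧ 1 ≤ x u) = {w} := by
    ext u
    have : 1 ≤ x u ↔ u = v ∨ u = w := by rw [← mem_posSupport, hS]; simp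
    simp only [mem_filter, mem_univ, true_and, this, mem_singleton]
    grind
  rw [sum_forestsWithDegree_leaf f hv, hfilter, sum_singleton]
  have hzero : dropEdge x v w = 0 := by
    funext j
    have : 1 ≤ x j ↔ j = v ∨ j = w := by rw [← mem_posSupport, hS]; simp
    have := hle j
    simp only [dropEdge, Pi.zero_apply]
    grind
  have hbot : forestsWithDegree (dropEdge x v w) = {⊥} := by
    ext T
    rw [mem_forestsWithDegree, mem_singleton, hzero]
    constructor
    · rintro ⟨-, hT⟩
      ext a b
      simpa using not_adj_of_degree_eq_zero (hT a) b
    · rintro rfl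
      exact ⟨isAcyclic_bot, fun j => by simp⟩
  rw [hbot, sum_singleton]

theorem card_forestsWithDegree (m : ℕ) (x : V → ℕ) (hsum : ∑ j, x j = 2 * m + 2)
    (hcard : #(posSupport x) = m + 2) :
    (#(forestsWithDegree x) : ℝ) * ((∏ j, (x j - 1).factorial : ℕ) : ℝ) = (m.factorial : ℝ) := by
  induction m generalizing x with
  | zero =>
    obtain ⟨v, w, -, -, hprod, h⟩ := sum_forestsWithDegree_of_card_two (fun _ => 1) hsum hcard
    rw [hprod]
    simpa using h
  | succ m ih =>
    obtain ⟨v, hv⟩ := exists_leaf (x := x) (by omega)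
    have h := sum_forestsWithDegree_leaf_of_three_le (fun _ => 1) hv (by omega) (by omega)
    simp only [sum_const, nsmul_eq_mul, mul_one] at h
    rw [h, sum_mul]
    have hterm : ∀ w ∈ univ.filter (fun w => 2 ≤ x w),
        (#(forestsWithDegree (dropEdge x v w)) : ℝ) * ((∏ j, (x j - 1).factorial : ℕ) : ℝ) =
          ((x w - 1 : ℕ) : ℝ) * (m.factorial : ℝ) := by
      intro w hw
      have hw : 2 ≤ x w := by simpa using hw
      have hvw : v ≠ w := by rintro rfl; omega
      have hd := sum_dropEdge hvw (by omega : 1 ≤ x v) (by omega : 1 ≤ x w)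
      rw [← ih (dropEdge x v w) (by omega) 
        (by rw [card_posSupport_dropEdge hv hw, hcard]; rfl),
        prod_factorial_dropEdge hv hw]
      push_cast
      ring
    rw [sum_congr rfl hterm, sum_filter_two_le x fun _ => (m.factorial : ℝ), ← sum_mul, ← Nat.cast_sum]
    have := sum_sub_one_add_card x
    rw [show ∑ j, (x j - 1) = m + 1 by omega, Nat.factorial_succ]
    push_cast
    ring

theorem sum_edgeProductSum_dropEdge (φ : V → ℝ) {m : ℕ} {x : V → ℕ} {v w : V}
    (hv : x v = 1) (hw : 2 ≤ x w) (hsum : ∑ j, x j = 2 * m + 4)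
    (hcard : #(posSupport x) = m + 3) :
    (∑ T ∈ forestsWithDegree (dropEdge x v w), edgeProductSum φ (T ⊔ edge v w)) *
        ((∏ j, (x j - 1).factorial : ℕ) : ℝ) =
      ((x w - 1 : ℕ) : ℝ) *
        ((∑ T ∈ forestsWithDegree (dropEdge x v w), edgeProductSum φ T) *
          ((∏ j, (dropEdge x v w j - 1).factorial : ℕ) : ℝ) + φ v * φ w * m.factorial) := by
  have hvw : v ≠ w := by rintro rfl; omega
  have hd := sum_dropEdge hvw (by omega : 1 ≤ x v) (by omega : 1 ≤ x w)
  have hN := card_forestsWithDegree m (dropEdge x v w) (by omega)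
    (by rw [card_posSupport_dropEdge hv hw, hcard]; rfl)
  have hF : ∀ T ∈ forestsWithDegree (dropEdge x v w),
      edgeProductSum φ (T ⊔ edge v w) = edgeProductSum φ T + φ v * φ w := by
    intro T hT
    refine edgeProductSum_sup_edge φ hvw (not_adj_of_degree_eq_zero ?_ w)
    rw [(mem_forestsWithDegree.1 hT).2 v]
    simp [dropEdge, hv]
  rw [sum_congr rfl hF, sum_add_distrib, sum_const, nsmul_eq_mul, ← hN,
    prod_factorial_dropEdge hv hw]
  push_cast
  ring

theorem sum_edgeProductSum_forestsWithDegree (φ : V → ℝ) (m : ℕ) (x : V → ℕ)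
    (hsum : ∑ j, x j = 2 * m + 4) (hcard : #(posSupport x) = m + 3) :
    (∑ T ∈ forestsWithDegree x, edgeProductSum φ T) * ((∏ j, (x j - 1).factorial : ℕ) : ℝ) =
      (m.factorial : ℝ) * ((∑ k ∈ posSupport x, φ k) * (∑ j, ((x j - 1 : ℕ) : ℝ) * φ j) -
        ∑ j, ((x j - 1 : ℕ) : ℝ) * φ j ^ 2) := by
  induction m generalizing x with
  | zero =>
    obtain ⟨v, hv⟩ := exists_leaf (x := x) (by omega)
    rw [sum_forestsWithDegree_leaf_of_three_le _ hv (by omega) (by omega), sum_mul]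
    have hΦ := add_sum_erase (posSupport x) φ (mem_posSupport.2 hv.ge)
    have hterm : ∀ w ∈ univ.filter (fun w => 2 ≤ x w),
        (∑ T ∈ forestsWithDegree (dropEdge x v w), edgeProductSum φ (T ⊔ edge v w)) *
            ((∏ j, (x j - 1).factorial : ℕ) : ℝ) =
          ((x w - 1 : ℕ) : ℝ) * (0 + (∑ k ∈ posSupport x, φ k) * φ w + (-1) * φ w ^ 2) := by
      intro w hw
      have hw : 2 ≤ x w := by simpa using hw
      have hvw : v ≠ w := by rintro rfl; omega
      have hd := sum_dropEdge hvw (by omega : 1 ≤ x v) (by omega : 1 ≤ x w)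
      have hw' : w ∈ (posSupport x).erase v :=
        mem_erase.2 ⟨hvw.symm, mem_posSupport.2 (by omega)⟩
      obtain ⟨a, b, hab, hS, hprod, hval⟩ := sum_forestsWithDegree_of_card_two
        (edgeProductSum φ) (x := dropEdge x v w) (by omega)
        (by rw [card_posSupport_dropEdge hv hw, hcard])
      rw [sum_edgeProductSum_dropEdge φ hv hw hsum hcard, hprod, hval,
        edgeProductSum_sup_edge φ hab (by simp), edgeProductSum_bot, ← hΦ]
      rw [posSupport_dropEdge hv hw] at hS
      rw [hS, sum_pair hab]
      rw [hS, mem_insert, mem_singleton] at hw'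
      rw [Nat.cast_one, Nat.factorial_zero, Nat.cast_one]
      rcases hw' with rfl | rfl <;> ring
    rw [sum_congr rfl hterm, sum_filter_two_le x fun w =>
      0 + (∑ k ∈ posSupport x, φ k) * φ w + (-1) * φ w ^ 2, sum_mul_quadratic]
    rw [Nat.factorial_zero, Nat.cast_one]
    ring
  | succ m ih =>
    obtain ⟨v, hv⟩ := exists_leaf (x := x) (by omega)
    rw [sum_forestsWithDegree_leaf_of_three_le _ hv (by omega) (by omega), sum_mul]
    have hΦ := add_sum_erase (posSupport x) φ (mem_posSupport.2 hv.ge)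
    set Φ := ∑ k ∈ posSupport x, φ k
    set D := ∑ j, ((x j - 1 : ℕ) : ℝ) * φ j with hD
    set Q := ∑ j, ((x j - 1 : ℕ) : ℝ) * φ j ^ 2 with hQ
    have hterm : ∀ w ∈ univ.filter (fun w => 2 ≤ x w),
        (∑ T ∈ forestsWithDegree (dropEdge x v w), edgeProductSum φ (T ⊔ edge v w)) *
            ((∏ j, (x j - 1).factorial : ℕ) : ℝ) =
          ((x w - 1 : ℕ) : ℝ) * (m.factorial * ((Φ - φ v) * D - Q) +
            m.factorial * ((m + 1) * φ v - (Φ - φ v)) * φ w + m.factorial * φ w ^ 2) := by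
      intro w hw
      have hw : 2 ≤ x w := by simpa using hw
      have hvw : v ≠ w := by rintro rfl; omega
      have hd := sum_dropEdge hvw (by omega : 1 ≤ x v) (by omega : 1 ≤ x w)
      rw [sum_edgeProductSum_dropEdge φ hv hw hsum hcard, ih (dropEdge x v w) (by omega)
        (by rw [card_posSupport_dropEdge hv hw, hcard]; rfl), posSupport_dropEdge hv hw,
        sum_dropEdge_sub_one_mul hv hw φ, sum_dropEdge_sub_one_mul hv hw fun j => φ j ^ 2,
        ← hD, ← hQ, ← hΦ, Nat.factorial_succ]
      push_cast
      ring
    have hM : ∑ j, ((x j - 1 : ℕ) : ℝ) = m + 2 := by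
      have := sum_sub_one_add_card x
      rw [← Nat.cast_sum, show ∑ j, (x j - 1) = m + 2 by omega]
      push_cast
      rfl
    rw [sum_congr rfl hterm, sum_filter_two_le x fun w => m.factorial * ((Φ - φ v) * D - Q) +
      m.factorial * ((m + 1) * φ v - (Φ - φ v)) * φ w + m.factorial * φ w ^ 2,
      sum_mul_quadratic, hM, ← hD, ← hQ, Nat.factorial_succ]
    push_cast
    ring

end SimpleGraph

open SimpleGraph

theorem tree_average_edge_sum (n : ℕ) (hn : 3 ≤ n) (x : Fin n → ℕ)
    -- `x` is a tree degree sequence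
    (hx1 : ∀ j, 1 ≤ x j) (hxsum : (∑ j, x j) + 2 = 2 * n)
    (φ : Fin n → ℝ)
    (F : SimpleGraph (Fin n) → ℝ)
    (hF : ∀ T : SimpleGraph (Fin n),
      F T = ∑ e ∈ T.edgeFinset,
        Sym2.lift ⟨fun j k => φ j * φ k, fun j k => by ring⟩ e)
    (Tx : Finset (SimpleGraph (Fin n)))
    (hTx : Tx = Finset.univ.filter
      (fun T : SimpleGraph (Fin n) => T.IsTree ∧ ∀ j, T.degree j = x j)) :
    (∑ T ∈ Tx, F T) / (Tx.card : ℝ)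
      = (1 / ((n : ℝ) - 2)) * (∑ k, φ k) * (∑ j, ((x j : ℝ) - 1) * φ j)
        - (1 / ((n : ℝ) - 2)) * ∑ j, ((x j : ℝ) - 1) * φ j ^ 2 := by
  obtain ⟨m, rfl⟩ := Nat.exists_eq_add_of_le' hn
  have hTx' : Tx = forestsWithDegree x := by
    ext T
    rw [hTx, mem_forestsWithDegree, mem_filter]
    refine ⟨fun h => ⟨h.2.1.isAcyclic, h.2.2⟩,
      fun h => ⟨mem_univ _, ?_, h.2⟩⟩
    refine isTree_of_isAcyclic_of_card h.1 ?_
    have hdeg := T.sum_degrees_eq_twice_card_edges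
    simp only [h.2] at hdeg
    rw [Fintype.card_fin]
    omega
  have hFφ : F = edgeProductSum φ := by
    funext T
    rw [hF, edgeProductSum]
  have hS : posSupport x = univ := by
    ext j
    simp [mem_posSupport, hx1 j]
  have hcard : #(posSupport x) = m + 3 := by simp [hS]
  have hd : ∀ j, ((x j - 1 : ℕ) : ℝ) = (x j : ℝ) - 1 := fun j => by
    rw [Nat.cast_sub (hx1 j), Nat.cast_one]
  have hN := card_forestsWithDegree (m + 1) x (by omega) (by omega)
  have hE := sum_edgeProductSum_forestsWithDegree φ m x (by omega) hcard
  simp only [hd, hS] at hE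
  rw [hTx', hFφ]
  have hP : ((∏ j, (x j - 1).factorial : ℕ) : ℝ) ≠ 0 := by
    exact_mod_cast prod_ne_zero_iff.2 fun j _ => Nat.factorial_ne_zero _
  have hm : (m.factorial : ℝ) ≠ 0 := by exact_mod_cast Nat.factorial_ne_zero m
  have hm1 : (m : ℝ) + 1 ≠ 0 := by positivity
  have hn2 : ((m + 3 : ℕ) : ℝ) - 2 = m + 1 := by
    push_cast
    ring
  rw [← mul_div_mul_right _ _ hP, hE, hN, hn2, Nat.factorial_succ]
  push_cast
  field_simp
end
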